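/- (Bott periodicity, real form) The homotopy groups of the infinite orthogonal group O(∞) = colim_n O(n) are periodic with period 8: for all k ≥ 0, π_{k+8}(O(∞)) ≅ π_k(O(∞)). -/

import Mathlib

noncomputable section

/-- Extend an `n × n` matrix to an `ℕ × ℕ` array by the identity outside the block. -/
def embMat (n : ℕ) (A : Matrix (Fin n) (Fin n) ℝ) : ℕ → ℕ → ℝ := fun i j =>
  if h : i < n ∧ j < n then A ⟨i, h.1⟩ ⟨j, h.2⟩ else if i = j then 1 else 0

/-- The underlying set of `O(∞) = colim_n O(n)`, the union of the orthogonal groups under the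
standard block inclusions `O(n) ↪ O(n+1)`. -/
def OInfCarrier : Set (ℕ → ℕ → ℝ) :=
  {f | ∃ (n : ℕ) (A : Matrix (Fin n) (Fin n) ℝ),
    A ∈ Matrix.orthogonalGroup (Fin n) ℝ ∧ f = embMat n A}

/-- The infinite orthogonal group `O(∞)`. -/
def OInf : Type := OInfCarrier

/-- The inclusion `O(n) → O(∞)`. -/
def OInf.incl (n : ℕ) (A : {A : Matrix (Fin n) (Fin n) ℝ // A ∈ Matrix.orthogonalGroup (Fin n) ℝ}) :
    OInf :=
  ⟨embMat n A.1, n, A.1, A.2, rfl⟩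

/-- `O(∞)` carries the colimit topology: the finest topology making all inclusions
`O(n) → O(∞)` continuous. -/
instance : TopologicalSpace OInf :=
  ⨆ n : ℕ, TopologicalSpace.coinduced (OInf.incl n) inferInstance

/-- The identity element of `O(∞)`. -/
def OInf.one : OInf :=
  ⟨embMat 0 1, 0, 1, Submonoid.one_mem _, rfl⟩

set_option linter.all false
set_option linter.unusedSectionVars false
set_option linter.unusedSimpArgs false
namespace BottP
open Matrix Topology
section polar
open scoped Matrix.Norms.L2Operator
variable {n : Type} [Fintype n] [DecidableEq n]

def polH (X : Matrix n n ℝ) : Matrix n n ℝ := cfc (fun t : ℝ => (√t)⁻¹) (star X * X)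

lemma spec_pos {X : Matrix n n ℝ} (hX : IsUnit X) : ∀ t ∈ spectrum ℝ (star X * X), 0 < t := by
  intro t ht
  have h1 : 0 ≤ t := by
    have : (star X * X).PosSemidef := posSemidef_conjTranspose_mul_self X
    exact (posSemidef_iff_isHermitian_and_spectrum_nonneg.mp this).2 ht
  rcases h1.lt_or_eq with h | h
  · exact h
  · exfalso
    subst h
    have : IsUnit (star X * X) := hX.star.mul hX
    exact (spectrum.zero_notMem_iff ℝ).mpr this ht

lemma polH_cont : ContinuousOn (polH (n := n)) {X | IsUnit X} := by
  unfold polH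
  refine ContinuousOn.cfc_of_mem_nhdsSet (s := Set.Ioi 0) _ ?_ (by fun_prop) ?_ ?_
  · apply isOpen_Ioi.mem_nhdsSet.mpr
    intro t ht
    simp only [Set.mem_iUnion] at ht
    obtain ⟨X, hX, ht⟩ := ht
    exact spec_pos hX t ht
  · intro X _
    exact IsSelfAdjoint.star_mul_self X
  · refine ContinuousOn.inv₀ (by fun_prop) ?_
    intro t ht
    exact (Real.sqrt_pos.mpr ht).ne'

lemma polH_contOn {X : Matrix n n ℝ} (hX : IsUnit X) :
    ContinuousOn (fun t : ℝ => (√t)⁻¹) (spectrum ℝ (star X * X)) := by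
  refine ContinuousOn.inv₀ (by fun_prop) ?_
  intro t ht
  exact (Real.sqrt_pos.mpr (spec_pos hX t ht)).ne'

lemma polH_sa (X : Matrix n n ℝ) : star (polH X) = polH X :=
  (cfc_predicate (R := ℝ) (fun t : ℝ => (√t)⁻¹) (star X * X) : IsSelfAdjoint _)

lemma polH_comm {X T : Matrix n n ℝ} (h : Commute (star X * X) T) : Commute (polH X) T :=
  ((IsSelfAdjoint.star_mul_self X).commute_cfc h _)

lemma polH_sq {X : Matrix n n ℝ} (hX : IsUnit X) : polH X * (star X * X) * polH X = 1 := by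
  have hsa : IsSelfAdjoint (star X * X) := IsSelfAdjoint.star_mul_self X
  have hc := polH_contOn hX
  have e1 : (star X * X) = cfc (fun t : ℝ => t) (star X * X) := (cfc_id' ℝ _).symm
  unfold polH
  conv_lhs => enter [1, 2]; rw [e1]
  rw [← cfc_mul (fun t : ℝ => (√t)⁻¹) (fun t : ℝ => t) _ hc (by fun_prop),
    ← cfc_mul (fun t : ℝ => (√t)⁻¹ * t) (fun t : ℝ => (√t)⁻¹) _ (hc.mul continuousOn_id) hc]
  rw [show (1 : Matrix n n ℝ) = cfc (fun _ : ℝ => (1 : ℝ)) (star X * X) from (cfc_const_one ℝ _).symm]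
  apply cfc_congr
  intro t ht
  have := spec_pos hX t ht
  have h2 := (Real.sqrt_pos.mpr this).ne'
  simp only
  field_simp
  rw [Real.sq_sqrt this.le]

lemma polH_mix {X : Matrix n n ℝ} (hX : IsUnit X) (s : ℝ) (h0 : 0 ≤ s) (h1 : s ≤ 1) :
    IsUnit ((1 - s) • (1 : Matrix n n ℝ) + s • polH X) := by
  have hsa : IsSelfAdjoint (star X * X) := IsSelfAdjoint.star_mul_self X
  have hc := polH_contOn hX
  have : (1 - s) • (1 : Matrix n n ℝ) + s • polH X
      = cfc (fun t : ℝ => (1 - s) + s * (√t)⁻¹) (star X * X) := by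
    unfold polH
    rw [cfc_add (a := star X * X) (fun _ => 1 - s) (fun t => s * (√t)⁻¹) (by fun_prop) (by fun_prop),
      cfc_const_mul (a := star X * X) s _ hc, cfc_const (1 - s) (star X * X), Algebra.algebraMap_eq_smul_one]
  rw [this]
  rw [isUnit_cfc_iff _ _ (by fun_prop)]
  intro t ht
  have := Real.sqrt_pos.mpr (spec_pos hX t ht)
  have h2 := inv_pos.mpr this
  rcases h0.lt_or_eq with h | h
  · have := mul_pos h h2
    linarith
  · subst h; simp

lemma polH_one {X : Matrix n n ℝ} (hX : star X * X = 1) : polH X = 1 := by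
  unfold polH
  rw [hX, cfc_apply_one]
  simp
end polar

abbrev MB (m ι : Type) := Matrix m m (Matrix ι ι ℝ)

section rho
variable {m ι : Type} [Fintype m] [DecidableEq m] [Fintype ι] [DecidableEq ι]

def dg (m : Type) [DecidableEq m] (g : Matrix ι ι ℝ) : MB m ι := Matrix.diagonal fun _ => g

lemma dg_mul (g h : Matrix ι ι ℝ) : dg m (g * h) = dg m g * dg m h := by
  simp [dg]
lemma dg_star (g : Matrix ι ι ℝ) : star (dg m g) = dg m (star g) := by
  simp [dg, star_eq_conjTranspose, diagonal_conjTranspose]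
lemma dg_neg (g : Matrix ι ι ℝ) : dg m (-g) = - dg m g := by
  simp [dg]
lemma dg_one : dg m (1 : Matrix ι ι ℝ) = 1 := by
  simp [dg]

abbrev fl : MB m ι ≃+* Matrix (m × ι) (m × ι) ℝ := Matrix.compRingEquiv m ι ℝ

lemma fl_star (X : MB m ι) : fl (star X) = star (fl X) := by
  ext ⟨i, a⟩ ⟨j, b⟩
  rfl
lemma fl_smul (s : ℝ) (X : MB m ι) : fl (s • X) = s • (fl X) := by
  ext ⟨i, a⟩ ⟨j, b⟩
  rfl
lemma fl_cont : Continuous (fl (m := m) (ι := ι)) := by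
  refine continuous_matrix ?_
  rintro ⟨i, a⟩ ⟨j, b⟩
  exact ((continuous_id.matrix_elem i j).matrix_elem a b)
lemma fl_symm_cont : Continuous (fl (m := m) (ι := ι)).symm := by
  refine continuous_matrix fun i j => continuous_matrix fun a b => ?_
  exact (continuous_id.matrix_elem (i, a) (j, b))

def hh (X : MB m ι) : MB m ι := fl.symm (polH (fl X))
def rho (X : MB m ι) : MB m ι := X * hh X

lemma fl_hh (X : MB m ι) : fl (hh X) = polH (fl X) := by simp [hh]

lemma hh_cont : ContinuousOn (hh (m := m) (ι := ι)) {X | IsUnit X} := by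
  unfold hh
  refine fl_symm_cont.comp_continuousOn (polH_cont.comp fl_cont.continuousOn ?_)
  intro X hX
  exact IsUnit.map fl hX

lemma rho_cont : ContinuousOn (rho (m := m) (ι := ι)) {X | IsUnit X} :=
  continuousOn_id.mul hh_cont

lemma hh_sa (X : MB m ι) : star (hh X) = hh X := by
  apply fl.injective
  rw [fl_star, fl_hh, polH_sa]

lemma hh_comm {X T : MB m ι} (h : Commute (star X * X) T) : Commute (hh X) T := by
  have h2 : Commute (star (fl X) * fl X) (fl T) := by
    have := h.map (fl (m := m) (ι := ι))
    rwa [map_mul, fl_star] at this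
  have h3 := polH_comm h2
  show _ = _
  apply fl.injective
  rw [map_mul, map_mul, fl_hh]
  exact h3

lemma hh_sq {X : MB m ι} (hX : IsUnit X) : hh X * (star X * X) * hh X = 1 := by
  apply fl.injective
  rw [map_mul, map_mul, map_mul, fl_hh, map_one, fl_star]
  exact polH_sq (hX.map fl)

lemma hh_mix {X : MB m ι} (hX : IsUnit X) (s : ℝ) (h0 : 0 ≤ s) (h1 : s ≤ 1) :
    IsUnit ((1 - s) • (1 : MB m ι) + s • hh X) := by
  have := polH_mix (hX.map fl) s h0 h1
  rw [← isUnit_map_iff (fl (m := m) (ι := ι))]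
  rwa [map_add, fl_smul, fl_smul, fl_hh, map_one]

lemma hh_one {X : MB m ι} (hX : star X * X = 1) : hh X = 1 := by
  apply fl.injective
  rw [fl_hh, map_one]
  apply polH_one
  rw [← fl_star, ← map_mul, hX, map_one]

/-- skew-adjoint matrices anticommuting with `G` -/
structure Sk (G : Set (Matrix ι ι ℝ)) (X : MB m ι) : Prop where
  skew : star X = -X
  anti : ∀ g ∈ G, X * dg m g = -(dg m g * X)

structure Os (G : Set (Matrix ι ι ℝ)) (X : MB m ι) : Prop extends Sk G X where
  sq : X * X = -1

structure GLs (G : Set (Matrix ι ι ℝ)) (X : MB m ι) : Prop extends Sk G X where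
  unit : IsUnit X

variable {G : Set (Matrix ι ι ℝ)}

lemma Os.gls {X : MB m ι} (h : Os G X) : GLs G X :=
  ⟨h.toSk, ⟨⟨X, -X, by simp [h.sq], by simp [h.sq]⟩, rfl⟩⟩

lemma skew_ss {X : MB m ι} (h : star X = -X) : star X * X = - (X * X) := by rw [h, neg_mul]

lemma hh_comm_anti {X T : MB m ι} (h : star X = -X) (ht : X * T = -(T * X)) :
    Commute (hh X) T := by
  apply hh_comm
  rw [skew_ss h]
  show _ = _
  have : X * X * T = T * (X * X) := by
    rw [mul_assoc, ht, mul_neg, ← mul_assoc, ht, neg_mul, neg_neg, mul_assoc]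
  rw [neg_mul, this, mul_neg]

lemma hh_comm_self {X : MB m ι} (h : star X = -X) : Commute (hh X) X := by
  apply hh_comm
  rw [skew_ss h]
  exact (Commute.mul_left (Commute.refl X) (Commute.refl X)).neg_left

lemma rho_anti {X T : MB m ι} (h : star X = -X) (ht : X * T = -(T * X)) :
    rho X * T = -(T * rho X) := by
  unfold rho
  rw [mul_assoc, (hh_comm_anti h ht).eq, ← mul_assoc, ht, neg_mul, mul_assoc]

lemma rho_skew {X : MB m ι} (h : star X = -X) : star (rho X) = - rho X := by
  unfold rho
  rw [star_mul, hh_sa, h, mul_neg, (hh_comm_self h).eq]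

lemma rho_sq {X : MB m ι} (h : star X = -X) (hu : IsUnit X) : rho X * rho X = -1 := by
  unfold rho
  have e := hh_sq hu
  rw [skew_ss h] at e
  have : X * hh X * (X * hh X) = - (hh X * (-(X * X)) * hh X) := by
    have c := (hh_comm_self h).eq
    rw [← mul_assoc, mul_assoc X, c, mul_neg, neg_mul, neg_neg]
    simp only [← mul_assoc]
    rw [c, mul_assoc X (hh X) X, c, ← mul_assoc]
  rw [this, e]

lemma rho_os {X : MB m ι} (h : GLs G X) : Os G (rho X) where
  skew := rho_skew h.skew
  anti g hg := rho_anti h.skew (h.anti g hg)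
  sq := rho_sq h.skew h.unit

lemma rho_id {X : MB m ι} (h : Os G X) : rho X = X := by
  unfold rho
  rw [hh_one, mul_one]
  rw [skew_ss h.skew, h.sq, neg_neg]

lemma Sk.add {X Y : MB m ι} (h : Sk G X) (h' : Sk G Y) : Sk G (X + Y) where
  skew := by rw [star_add, h.skew, h'.skew]; abel
  anti g hg := by rw [add_mul, h.anti g hg, h'.anti g hg, mul_add]; abel
lemma Sk.smul {X : MB m ι} (h : Sk G X) (s : ℝ) : Sk G (s • X) where
  skew := by rw [star_smul, h.skew]; simp
  anti g hg := by rw [smul_mul_assoc, h.anti g hg, mul_smul_comm, smul_neg]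
lemma Sk.neg {X : MB m ι} (h : Sk G X) : Sk G (-X) where
  skew := by rw [star_neg, h.skew]
  anti g hg := by rw [neg_mul, h.anti g hg, mul_neg]
lemma Os.neg {X : MB m ι} (h : Os G X) : Os G (-X) :=
  { h.toSk.neg with sq := by simp [h.sq] }

lemma rho_path {X : MB m ι} (h : GLs G X) (s : ℝ) (h0 : 0 ≤ s) (h1 : s ≤ 1) :
    GLs G ((1 - s) • X + s • rho X) :=
  { (h.toSk.smul (1 - s)).add ((rho_os h).toSk.smul s) with
    unit := by
      have : (1 - s) • X + s • rho X = X * ((1 - s) • (1 : MB m ι) + s • hh X) := by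
        unfold rho
        rw [mul_add, mul_smul_comm, mul_smul_comm, mul_one]
      rw [this]
      exact h.unit.mul (hh_mix h.unit s h0 h1) }

end rho
end BottP

set_option linter.all false
set_option linter.unusedSectionVars false
set_option linter.unusedSimpArgs false
namespace BottP
open Matrix Topology

section blocks
variable {ι m a b m' : Type} [Fintype m] [DecidableEq m] [Fintype ι] [DecidableEq ι]
  [Fintype a] [DecidableEq a] [Fintype b] [DecidableEq b] [Fintype m'] [DecidableEq m']

def dsum (X : MB m ι) (Y : MB a ι) : MB (m ⊕ a) ι := fromBlocks X 0 0 Y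
def rx (e : m ≃ m') (X : MB m ι) : MB m' ι := X.submatrix e.symm e.symm

lemma dsum_mul (X X' : MB m ι) (Y Y' : MB a ι) :
    dsum X Y * dsum X' Y' = dsum (X * X') (Y * Y') := by
  simp [dsum, fromBlocks_multiply]
lemma dsum_add (X X' : MB m ι) (Y Y' : MB a ι) :
    dsum X Y + dsum X' Y' = dsum (X + X') (Y + Y') := by
  simp [dsum, fromBlocks_add]
lemma dsum_smul (s : ℝ) (X : MB m ι) (Y : MB a ι) :
    s • dsum X Y = dsum (s • X) (s • Y) := by
  simp [dsum, fromBlocks_smul]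
lemma dsum_neg (X : MB m ι) (Y : MB a ι) : - dsum X Y = dsum (-X) (-Y) := by
  simp [dsum, fromBlocks_neg]
lemma dsum_star (X : MB m ι) (Y : MB a ι) : star (dsum X Y) = dsum (star X) (star Y) := by
  simp [dsum, star_eq_conjTranspose, fromBlocks_conjTranspose]
lemma dsum_one : dsum (1 : MB m ι) (1 : MB a ι) = 1 := by
  simp [dsum]
lemma dsum_dg (g : Matrix ι ι ℝ) : dsum (dg m g) (dg a g) = dg (m ⊕ a) g := by
  ext i j : 1
  rcases i with i | i <;> rcases j with j | j <;> simp [dsum, dg, diagonal_apply]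
lemma dsum_cont : Continuous fun p : MB m ι × MB a ι => dsum p.1 p.2 := by
  unfold dsum
  exact Continuous.matrix_fromBlocks continuous_fst continuous_const continuous_const continuous_snd

lemma dsumC {Q : Type} [TopologicalSpace Q] {f : Q → MB m ι} {g : Q → MB a ι} (hf : Continuous f)
    (hg : Continuous g) : Continuous fun q => dsum (f q) (g q) :=
  Continuous.matrix_fromBlocks hf continuous_const continuous_const hg

lemma rx_mul (e : m ≃ m') (X Y : MB m ι) : rx e (X * Y) = rx e X * rx e Y := by
  simp [rx, submatrix_mul_equiv]
lemma rx_add (e : m ≃ m') (X Y : MB m ι) : rx e (X + Y) = rx e X + rx e Y := rfl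
lemma rx_sub (e : m ≃ m') (X Y : MB m ι) : rx e (X - Y) = rx e X - rx e Y := rfl
lemma rx_neg (e : m ≃ m') (X : MB m ι) : rx e (-X) = - rx e X := rfl
lemma rx_smul (e : m ≃ m') (s : ℝ) (X : MB m ι) : rx e (s • X) = s • rx e X := rfl
lemma rx_one (e : m ≃ m') : rx e (1 : MB m ι) = 1 := by simp [rx]
lemma rx_star (e : m ≃ m') (X : MB m ι) : rx e (star X) = star (rx e X) := rfl
lemma rx_dg (e : m ≃ m') (g : Matrix ι ι ℝ) : rx e (dg m g) = dg m' g := by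
  ext i j : 1
  simp [rx, dg, diagonal_apply]
lemma rx_cont (e : m ≃ m') : Continuous (rx (ι := ι) e) :=
  continuous_id.matrix_submatrix _ _
lemma rx_rx {m'' : Type} [Fintype m''] [DecidableEq m''] (e : m ≃ m') (e' : m' ≃ m'') (X : MB m ι) :
    rx e' (rx e X) = rx (e.trans e') X := rfl
lemma rx_refl (X : MB m ι) : rx (Equiv.refl m) X = X := rfl
lemma rx_symm (e : m ≃ m') (X : MB m ι) : rx e.symm (rx e X) = X := by
  ext i j : 1; simp [rx]
lemma rx_unit (e : m ≃ m') {X : MB m ι} (h : IsUnit X) : IsUnit (rx e X) := by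
  obtain ⟨⟨x, y, h1, h2⟩, rfl⟩ := h
  exact ⟨⟨rx e x, rx e y, by rw [← rx_mul, h1, rx_one], by rw [← rx_mul, h2, rx_one]⟩, rfl⟩

lemma dsum_rx (e : m ≃ m') (X : MB m ι) (Y : MB a ι) :
    dsum (rx e X) Y = rx (Equiv.sumCongr e (Equiv.refl a)) (dsum X Y) := by
  ext i j : 1
  rcases i with i | i <;> rcases j with j | j <;> simp [dsum, rx]
lemma dsum_assoc (X : MB m ι) (Y : MB a ι) (Z : MB b ι) :
    dsum X (dsum Y Z) = rx (Equiv.sumAssoc m a b) (dsum (dsum X Y) Z) := by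
  ext i j : 1
  rcases i with i | i | i <;> rcases j with j | j | j <;> simp [dsum, rx]
lemma dsum_comm (X : MB m ι) (Y : MB a ι) :
    dsum X Y = rx (Equiv.sumComm a m) (dsum Y X) := by
  ext i j : 1
  rcases i with i | i <;> rcases j with j | j <;> simp [dsum, rx]
def swapR (m a b : Type) : (m ⊕ a) ⊕ b ≃ (m ⊕ b) ⊕ a :=
  (Equiv.sumAssoc m a b).trans ((Equiv.sumCongr (Equiv.refl m) (Equiv.sumComm a b)).trans
    (Equiv.sumAssoc m b a).symm)
lemma dsum_swapR (X : MB m ι) (Y : MB a ι) (Z : MB b ι) :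
    dsum (dsum X Z) Y = rx (swapR m a b) (dsum (dsum X Y) Z) := by
  ext i j : 1
  rcases i with (i | i) | i <;> rcases j with (j | j) | j <;> simp [dsum, rx, swapR]

variable {G : Set (Matrix ι ι ℝ)}
lemma Sk.dsum {X : MB m ι} {Y : MB a ι} (h : Sk G X) (h' : Sk G Y) : Sk G (dsum X Y) where
  skew := by rw [dsum_star, h.skew, h'.skew, dsum_neg]
  anti g hg := by rw [← dsum_dg, dsum_mul, dsum_mul, h.anti g hg, h'.anti g hg, dsum_neg]
lemma Os.dsum {X : MB m ι} {Y : MB a ι} (h : Os G X) (h' : Os G Y) : Os G (dsum X Y) :=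
  ⟨h.toSk.dsum h'.toSk, by rw [dsum_mul, h.sq, h'.sq, ← dsum_neg, dsum_one]⟩
lemma dsum_unit {X : MB m ι} {Y : MB a ι} (h : IsUnit X) (h' : IsUnit Y) : IsUnit (dsum X Y) := by
  obtain ⟨⟨x, y, h1, h2⟩, rfl⟩ := h
  obtain ⟨⟨x', y', h1', h2'⟩, rfl⟩ := h'
  exact ⟨⟨BottP.dsum x x', BottP.dsum y y', by rw [dsum_mul, h1, h1', dsum_one],
    by rw [dsum_mul, h2, h2', dsum_one]⟩, rfl⟩
lemma GLs.dsum {X : MB m ι} {Y : MB a ι} (h : GLs G X) (h' : GLs G Y) : GLs G (dsum X Y) :=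
  ⟨h.toSk.dsum h'.toSk, dsum_unit h.unit h'.unit⟩
lemma Sk.rx (e : m ≃ m') {X : MB m ι} (h : Sk G X) : Sk G (rx e X) where
  skew := by rw [← rx_star, h.skew, rx_neg]
  anti g hg := by rw [← rx_dg e, ← rx_mul, ← rx_mul, h.anti g hg, rx_neg]
lemma Os.rx (e : m ≃ m') {X : MB m ι} (h : Os G X) : Os G (rx e X) :=
  ⟨h.toSk.rx e, by rw [← rx_mul, h.sq, rx_neg, rx_one]⟩
lemma GLs.rx (e : m ≃ m') {X : MB m ι} (h : GLs G X) : GLs G (rx e X) :=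
  ⟨h.toSk.rx e, rx_unit e h.unit⟩
lemma Os.of_rx {e : m ≃ m'} {X : MB m ι} (h : Os G (BottP.rx e X)) : Os G X := by
  have := h.rx e.symm
  rwa [rx_symm] at this

/-- a skew complex structure in `B` anticommuting with `G` -/
structure Cx (G : Set (Matrix ι ι ℝ)) (J : Matrix ι ι ℝ) : Prop where
  skew : star J = -J
  sq : J * J = -1
  anti : ∀ g ∈ G, J * g = -(g * J)

lemma Cx.os {J : Matrix ι ι ℝ} (h : Cx G J) : Os G (dg m J) where
  skew := by rw [dg_star, h.skew, dg_neg]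
  sq := by rw [← dg_mul, h.sq, dg_neg, dg_one]
  anti g hg := by rw [← dg_mul, ← dg_mul, h.anti g hg, dg_neg]
end blocks

section relh
variable {Q : Type} [TopologicalSpace Q] {ι m a m' : Type} [Fintype m] [DecidableEq m]
  [Fintype ι] [DecidableEq ι]
  [Fintype a] [DecidableEq a] [Fintype m'] [DecidableEq m'] {G : Set (Matrix ι ι ℝ)} {bd : Set Q}

def RelH (bd : Set Q) (G : Set (Matrix ι ι ℝ)) (F F' : Q → MB m ι) : Prop :=
  ∃ H : unitInterval × Q → MB m ι, Continuous H ∧ (∀ q, H (0, q) = F q) ∧ (∀ q, H (1, q) = F' q) ∧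
    (∀ p, Os G (H p)) ∧ ∀ t, ∀ q ∈ bd, H (t, q) = F q

structure Fam (G : Set (Matrix ι ι ℝ)) (F : Q → MB m ι) : Prop where
  cont : Continuous F
  os : ∀ q, Os G (F q)

def Fam.cm {F : Q → MB m ι} (h : Fam G F) : C(Q, {X : MB m ι // Os G X}) :=
  ⟨fun q => ⟨F q, h.os q⟩, h.cont.subtype_mk _⟩

lemma RelH.fam_left {F F' : Q → MB m ι} (h : RelH bd G F F') : Fam G F := by
  obtain ⟨H, hc, h0, h1, ho, hb⟩ := h
  have : F = fun q => H (0, q) := funext fun q => (h0 q).symm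
  subst this
  exact ⟨by fun_prop, fun q => ho _⟩
lemma RelH.fam_right {F F' : Q → MB m ι} (h : RelH bd G F F') : Fam G F' := by
  obtain ⟨H, hc, h0, h1, ho, hb⟩ := h
  have : F' = fun q => H (1, q) := funext fun q => (h1 q).symm
  subst this
  exact ⟨by fun_prop, fun q => ho _⟩

lemma relH_iff {F F' : Q → MB m ι} (hF : Fam G F) (hF' : Fam G F') :
    RelH bd G F F' ↔ ContinuousMap.HomotopicRel hF.cm hF'.cm bd := by
  constructor
  · rintro ⟨H, hc, h0, h1, ho, hb⟩
    exact ⟨{ toFun := fun p => ⟨H p, ho p⟩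
             continuous_toFun := hc.subtype_mk _
             map_zero_left := fun q => Subtype.ext (h0 q)
             map_one_left := fun q => Subtype.ext (h1 q)
             prop' := fun t q hq => Subtype.ext (hb t q hq) }⟩
  · rintro ⟨H⟩
    refine ⟨fun p => (H p).1, continuous_subtype_val.comp H.continuous, fun q => ?_, fun q => ?_,
      fun p => (H p).2, fun t q hq => ?_⟩
    · exact congrArg Subtype.val (H.apply_zero q)
    · exact congrArg Subtype.val (H.apply_one q)
    · exact congrArg Subtype.val (H.eq_fst t hq)

lemma RelH.refl {F : Q → MB m ι} (h : Fam G F) : RelH bd G F F :=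
  ⟨fun p => F p.2, h.cont.comp continuous_snd, fun _ => rfl, fun _ => rfl, fun p => h.os p.2,
    fun _ _ _ => rfl⟩
lemma RelH.symm {F F' : Q → MB m ι} (h : RelH bd G F F') : RelH bd G F' F := by
  have h1 := h.fam_left
  have h2 := h.fam_right
  rw [relH_iff h1 h2] at h
  rw [relH_iff h2 h1]
  exact ContinuousMap.HomotopicRel.symm h
lemma RelH.trans {F F' F'' : Q → MB m ι} (h : RelH bd G F F') (h' : RelH bd G F' F'') :
    RelH bd G F F'' := by
  have h1 := h.fam_left
  have h2 := h.fam_right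
  have h3 := h'.fam_right
  rw [relH_iff h1 h2] at h
  rw [relH_iff h2 h3] at h'
  rw [relH_iff h1 h3]
  exact ContinuousMap.HomotopicRel.trans h h'
lemma RelH.map {F F' : Q → MB m ι} (h : RelH bd G F F') {Φ : MB m ι → MB a ι}
    (hc : Continuous Φ) (ho : ∀ X, Os G X → Os G (Φ X)) :
    RelH bd G (fun q => Φ (F q)) (fun q => Φ (F' q)) := by
  obtain ⟨H, hHc, h0, h1, hHo, hb⟩ := h
  exact ⟨fun p => Φ (H p), hc.comp hHc, fun q => congrArg Φ (h0 q), fun q => congrArg Φ (h1 q),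
    fun p => ho _ (hHo p), fun t q hq => congrArg Φ (hb t q hq)⟩

/-- stable relative homotopy -/
def SEq (bd : Set Q) (G : Set (Matrix ι ι ℝ)) (J : Matrix ι ι ℝ)
    (F : Q → MB m ι) (F' : Q → MB m' ι) : Prop :=
  ∃ (a a' : Type) (_ : Fintype a) (_ : DecidableEq a) (_ : Fintype a') (_ : DecidableEq a')
    (e : m ⊕ a ≃ m' ⊕ a'),
    RelH bd G (fun q => rx e (dsum (F q) (dg a J))) (fun q => dsum (F' q) (dg a' J))

variable {J : Matrix ι ι ℝ}

lemma RelH.congr {F F' F₁ F₁' : Q → MB m ι} (h : RelH bd G F F') (e : ∀ q, F q = F₁ q)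
    (e' : ∀ q, F' q = F₁' q) : RelH bd G F₁ F₁' := by
  obtain rfl : F = F₁ := funext e
  obtain rfl : F' = F₁' := funext e'
  exact h

lemma RelH.dsumJ (hJ : Cx G J) {F F' : Q → MB m ι} (h : RelH bd G F F') (a : Type) [Fintype a]
    [DecidableEq a] :
    RelH bd G (fun q => dsum (F q) (dg a J)) (fun q => dsum (F' q) (dg a J)) :=
  h.map (Φ := fun X => dsum X (dg a J)) (dsumC continuous_id continuous_const) fun X hX => hX.dsum hJ.os
lemma RelH.rx (e : m ≃ m') {F F' : Q → MB m ι} (h : RelH bd G F F') :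
    RelH bd G (fun q => rx e (F q)) (fun q => BottP.rx e (F' q)) :=
  h.map (Φ := BottP.rx e) (rx_cont e) fun X hX => hX.rx e

lemma SEq.of_eq_rx (hJ : Cx G J) {F : Q → MB m ι} {F' : Q → MB m' ι} (hF : Fam G F) (e : m ≃ m')
    (h : ∀ q, F' q = rx e (F q)) : SEq bd G J F F' := by
  refine ⟨Empty, Empty, inferInstance, inferInstance, inferInstance, inferInstance,
    Equiv.sumCongr e (Equiv.refl _), ?_⟩
  have h1 := ((RelH.refl (bd := bd) hF).rx e).dsumJ hJ Empty
  refine h1.congr (fun q => ?_) (fun q => ?_)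
  · rw [dsum_rx]
  · rw [h]

lemma SEq.of_relH (hJ : Cx G J) {F F' : Q → MB m ι} (h : RelH bd G F F') : SEq bd G J F F' :=
  ⟨Empty, Empty, inferInstance, inferInstance, inferInstance, inferInstance,
    Equiv.refl _, h.dsumJ hJ Empty⟩

lemma SEq.refl (hJ : Cx G J) {F : Q → MB m ι} (h : Fam G F) : SEq bd G J F F :=
  SEq.of_relH hJ (RelH.refl h)

lemma SEq.stab (hJ : Cx G J) {F : Q → MB m ι} (h : Fam G F) (a : Type) [Fintype a] [DecidableEq a] :
    SEq bd G J F (fun q => dsum (F q) (dg a J)) := by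
  refine ⟨a, Empty, inferInstance, inferInstance, inferInstance, inferInstance,
    (Equiv.sumEmpty _ _).symm, ?_⟩
  have h1 := (((RelH.refl (bd := bd) h).dsumJ hJ a)).dsumJ hJ Empty
  refine h1.congr (fun q => ?_) (fun q => rfl)
  ext i j : 1
  rcases i with i | i
  · rcases j with j | j
    · rfl
    · exact j.elim
  · exact i.elim

lemma SEq.symm {F : Q → MB m ι} {F' : Q → MB m' ι} (h : SEq bd G J F F') :
    SEq bd G J F' F := by
  obtain ⟨a, a', i1, i2, i3, i4, e, h⟩ := h
  refine ⟨a', a, i3, i4, i1, i2, e.symm, ?_⟩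
  refine (h.rx e.symm).symm.congr (fun q => rfl) (fun q => ?_)
  rw [rx_symm]

lemma SEq.trans (hJ : Cx G J) {m'' : Type} [Fintype m''] [DecidableEq m''] {F : Q → MB m ι}
    {F' : Q → MB m' ι} {F'' : Q → MB m'' ι}
    (h : SEq bd G J F F') (h' : SEq bd G J F' F'') : SEq bd G J F F'' := by
  obtain ⟨a, a', i1, i2, i3, i4, e, h⟩ := h
  obtain ⟨b, b', j1, j2, j3, j4, f, h'⟩ := h'
  let E1 : m ⊕ (a ⊕ b) ≃ (m ⊕ a) ⊕ b := (Equiv.sumAssoc m a b).symm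
  let E2 := E1.trans (Equiv.sumCongr e (Equiv.refl b))
  let E3 := E2.trans (swapR m' a' b)
  let E4 := E3.trans (Equiv.sumCongr f (Equiv.refl a'))
  let E5 := E4.trans (Equiv.sumAssoc m'' b' a')
  refine ⟨a ⊕ b, b' ⊕ a', inferInstance, inferInstance, inferInstance, inferInstance, E5, ?_⟩
  have k1 := (((((h.dsumJ hJ b).rx (swapR m' a' b))).rx
    (Equiv.sumCongr f (Equiv.refl a')))).rx (Equiv.sumAssoc m'' b' a')
  have k2 := (h'.dsumJ hJ a').rx (Equiv.sumAssoc m'' b' a')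
  have k1' := k1.congr (F₁ := fun q => BottP.rx E5 (dsum (F q) (dg (a ⊕ b) J)))
    (F₁' := fun q => BottP.rx (Equiv.sumAssoc m'' b' a')
      (dsum (BottP.rx f (dsum (F' q) (dg b J))) (dg a' J))) (fun q => ?_) (fun q => ?_)
  · refine (k1'.trans k2).congr (fun q => rfl) (fun q => ?_)
    rw [← dsum_assoc, dsum_dg]
  · rw [← dsum_dg, dsum_assoc, rx_rx, dsum_rx]
    simp only [rx_rx]
    congr 1
    simp only [E5, E4, E3, E2, E1, ← Equiv.trans_assoc]
    simp
  · rw [← dsum_swapR, dsum_rx]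

structure Based (bd : Set Q) (G : Set (Matrix ι ι ℝ)) (J : Matrix ι ι ℝ) (F : Q → MB m ι) : Prop
    extends Fam G F where
  base : ∀ q ∈ bd, F q = dg m J

/-- unitary commuting with `G` -/
structure Un (G : Set (Matrix ι ι ℝ)) (U : MB m ι) : Prop where
  l : star U * U = 1
  r : U * star U = 1
  comm : ∀ g ∈ G, U * dg m g = dg m g * U

lemma Un.comm' {U : MB m ι} (h : Un G U) {T : MB m ι} (hc : U * T = T * U) :
    star U * T = T * star U := by
  calc star U * T = star U * T * (U * star U) := by rw [h.r, mul_one]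
    _ = star U * (U * T) * star U := by rw [hc]; simp only [mul_assoc]
    _ = T * star U := by rw [← mul_assoc, h.l, one_mul]

lemma Un.conj {U X : MB m ι} (h : Un G U) (hX : Os G X) : Os G (U * X * star U) where
  skew := by simp [star_mul, hX.skew, mul_assoc]
  sq := by
    calc U * X * star U * (U * X * star U) = U * X * (star U * U) * X * star U := by
          simp only [mul_assoc]
      _ = U * (X * X) * star U := by rw [h.l, mul_one, mul_assoc U]
      _ = -1 := by rw [hX.sq, mul_neg, mul_one, neg_mul, h.r]
  anti g hg := by
    have h1 := h.comm' (h.comm g hg)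
    rw [mul_assoc, h1, ← mul_assoc, mul_assoc U, hX.anti g hg, mul_neg, neg_mul, ← mul_assoc U,
      h.comm g hg]
    simp only [mul_assoc]

lemma Un.mul {U V : MB m ι} (h : Un G U) (h' : Un G V) : Un G (U * V) where
  l := by rw [star_mul, mul_assoc, ← mul_assoc (star U), h.l, one_mul, h'.l]
  r := by rw [star_mul, mul_assoc, ← mul_assoc V, h'.r, one_mul, h.r]
  comm g hg := by rw [mul_assoc, h'.comm g hg, ← mul_assoc, h.comm g hg, mul_assoc]
lemma Un.star {U : MB m ι} (h : Un G U) : Un G (star U) where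
  l := by rw [star_star, h.r]
  r := by rw [star_star, h.l]
  comm g hg := h.comm' (h.comm g hg)
lemma Un.dsum {U : MB m ι} {V : MB a ι} (h : Un G U) (h' : Un G V) : Un G (dsum U V) where
  l := by rw [dsum_star, dsum_mul, h.l, h'.l, dsum_one]
  r := by rw [dsum_star, dsum_mul, h.r, h'.r, dsum_one]
  comm g hg := by rw [← dsum_dg, dsum_mul, dsum_mul, h.comm g hg, h'.comm g hg]
lemma Un.one : Un G (1 : MB m ι) := ⟨by simp, by simp, by simp⟩

/-- rotation -/
def rot (m : Type) [DecidableEq m] (ι : Type) [DecidableEq ι] (θ : ℝ) : MB (m ⊕ m) ι :=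
  fromBlocks (Real.cos θ • 1) (-(Real.sin θ) • 1) (Real.sin θ • 1) (Real.cos θ • 1)

lemma cs1 (θ : ℝ) : (Real.cos θ * Real.cos θ) • (1 : MB m ι) + (Real.sin θ * Real.sin θ) • (1 : MB m ι) = 1 := by
  rw [← add_smul, ← sq, ← sq, Real.cos_sq_add_sin_sq, one_smul]

lemma rot_un (θ : ℝ) (G : Set (Matrix ι ι ℝ)) : Un G (rot m ι θ) where
  l := by
    rw [rot, star_eq_conjTranspose, fromBlocks_conjTranspose, fromBlocks_multiply, ← fromBlocks_one]
    have h1 := cs1 (m := m) (ι := ι) θ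
    have h2 := h1
    rw [add_comm] at h2
    congr 1 <;> simp [smul_smul, mul_comm, h1, h2]
  r := by
    rw [rot, star_eq_conjTranspose, fromBlocks_conjTranspose, fromBlocks_multiply, ← fromBlocks_one]
    have h1 := cs1 (m := m) (ι := ι) θ
    have h2 := h1
    rw [add_comm] at h2
    congr 1 <;> simp [smul_smul, mul_comm, h1, h2]
  comm g hg := by
    rw [← dsum_dg, rot, BottP.dsum, fromBlocks_multiply, fromBlocks_multiply]
    congr 1 <;> simp
lemma rot_cont : Continuous (rot m ι) := by
  unfold rot
  apply Continuous.matrix_fromBlocks <;> fun_prop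

lemma SEq.conj (hJ : Cx G J) {F P : Q → MB m ι} (hF : Based bd G J F) (hP : Continuous P)
    (hU : ∀ q, Un (insert J G) (P q)) : SEq bd G J F (fun q => P q * F q * star (P q)) := by
  refine ⟨m, m, inferInstance, inferInstance, inferInstance, inferInstance, Equiv.refl _, ?_⟩
  let W : unitInterval × Q → MB (m ⊕ m) ι := fun p =>
    dsum (P p.2) 1 * rot m ι ((p.1 : ℝ) * (Real.pi / 2)) * dsum (star (P p.2)) 1 *
      star (rot m ι ((p.1 : ℝ) * (Real.pi / 2)))
  have hW : ∀ p, Un (insert J G) (W p) := fun p =>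
    ((((hU p.2).dsum Un.one).mul (rot_un _ _)).mul ((hU p.2).star.dsum Un.one)).mul (rot_un _ _).star
  have hWc : Continuous W := by
    have r1 : Continuous fun p : unitInterval × Q => rot m ι ((p.1 : ℝ) * (Real.pi / 2)) :=
      rot_cont.comp (by fun_prop)
    have r2 : Continuous fun p : unitInterval × Q => dsum (P p.2) (1 : MB m ι) :=
      dsumC (by fun_prop) continuous_const
    have r3 : Continuous fun p : unitInterval × Q => dsum (star (P p.2)) (1 : MB m ι) :=
      dsumC (by fun_prop) continuous_const
    exact ((r2.mul r1).mul r3).mul r1.star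
  have hd : Continuous fun p : unitInterval × Q => dsum (F p.2) (dg m J) :=
    dsumC (hF.cont.comp continuous_snd) continuous_const
  have r0 : rot m ι 0 = 1 := by simp [rot]
  have hG : ∀ p, Un G (W p) := fun p => ⟨(hW p).l, (hW p).r, fun g hg => (hW p).comm g (by simp [hg])⟩
  refine ⟨fun p => W p * dsum (F p.2) (dg m J) * star (W p), (hWc.mul hd).mul hWc.star,
    fun q => ?_, fun q => ?_, fun p => (hG p).conj ((hF.os p.2).dsum hJ.os), fun t q hq => ?_⟩
  · have : W (0, q) = 1 := by
      simp only [W, Set.Icc.coe_zero, zero_mul, r0, mul_one, star_one, dsum_mul, (hU q).r, dsum_one]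
    simp only [this, one_mul, star_one, mul_one]
    rfl
  · have : W (1, q) = dsum (P q) (star (P q)) := by
      simp only [W, Set.Icc.coe_one, one_mul, rot, Real.cos_pi_div_two, Real.sin_pi_div_two,
        star_eq_conjTranspose, fromBlocks_conjTranspose, dsum, fromBlocks_multiply]
      simp
    simp only [this, dsum_star, dsum_mul, star_star]
    congr 1
    rw [(hU q).comm' ((hU q).comm J (by simp)), mul_assoc, (hU q).l, mul_one]
  · simp only [hF.base q hq, dsum_dg]
    rw [(hW (t, q)).comm J (by simp), mul_assoc, (hW (t, q)).r, mul_one]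
    rw [rx_refl]

end relh
end BottP

set_option linter.all false
set_option autoImplicit false
set_option linter.unusedSectionVars false
set_option linter.unusedSimpArgs false
namespace BottP
open Matrix Topology

section walg
variable {n ι : Type} [Fintype n] [DecidableEq n] [Fintype ι] [DecidableEq ι]

def wm (K S : MB n ι) : MB n ι := (√2)⁻¹ • (1 - K * S)

lemma half_sq (X : MB n ι) : (√2)⁻¹ • (√2)⁻¹ • X = (2⁻¹ : ℝ) • X := by
  rw [smul_smul]; congr 1
  rw [← mul_inv, Real.mul_self_sqrt (by norm_num)]

lemma half_two (X : MB n ι) : (2⁻¹ : ℝ) • (X + X) = X := by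
  rw [← two_smul ℝ X, smul_smul]; norm_num

structure KS (K S : MB n ι) : Prop where
  ks : star K = -K
  ss : star S = -S
  kk : K * K = -1
  sq : S * S = -1
  anti : S * K = -(K * S)

variable {K S : MB n ι}
lemma KS.st (h : KS K S) : star (wm K S) = (√2)⁻¹ • (1 + K * S) := by
  simp only [wm, star_smul, star_sub, star_one, star_mul, h.ks, h.ss, star_trivial]
  rw [neg_mul_neg, h.anti, sub_neg_eq_add]
lemma KS.tt (h : KS K S) : K * S * (K * S) = -1 := by
  rw [mul_assoc, ← mul_assoc S, h.anti, neg_mul, mul_neg, mul_assoc K S S, ← mul_assoc K K, h.kk, h.sq]; simp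
lemma KS.l (h : KS K S) : star (wm K S) * wm K S = 1 := by
  rw [h.st, wm, smul_mul_smul_comm, ← smul_smul, half_sq]
  have : (1 + K * S) * (1 - K * S) = 1 + 1 := by
    rw [add_mul, mul_sub, one_mul, mul_sub, h.tt]; simp; abel
  rw [this, half_two]
lemma KS.r (h : KS K S) : wm K S * star (wm K S) = 1 := by
  rw [h.st, wm, smul_mul_smul_comm, ← smul_smul, half_sq]
  have : (1 - K * S) * (1 + K * S) = 1 + 1 := by
    rw [sub_mul, mul_add, one_mul, mul_add, h.tt]; simp; abel
  rw [this, half_two]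
lemma KS.int (h : KS K S) : wm K S * S = K * wm K S := by
  simp only [wm, smul_mul_assoc, mul_smul_comm, sub_mul, mul_sub, one_mul, mul_one]
  rw [mul_assoc, h.sq, ← mul_assoc, h.kk]; simp [add_comm]
lemma KS.int' (h : KS K S) : star (wm K S) * K = S * star (wm K S) := by
  calc star (wm K S) * K = star (wm K S) * (K * wm K S) * star (wm K S) := by
        rw [mul_assoc, mul_assoc, h.r, mul_one]
    _ = _ := by rw [← h.int, ← mul_assoc, h.l, one_mul]
end walg

section pair
variable {ι m a : Type} [Fintype m] [DecidableEq m] [Fintype ι] [DecidableEq ι]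
  [Fintype a] [DecidableEq a] {G : Set (Matrix ι ι ℝ)} {J κ : Matrix ι ι ℝ}

def Kb (m : Type) [DecidableEq m] (κ : Matrix ι ι ℝ) : MB (m ⊕ m) ι := fromBlocks 0 (dg m κ) (dg m κ) 0
def kc (κ : Matrix ι ι ℝ) (X : MB m ι) : MB m ι := dg m κ * X * dg m κ
def Sb (κ : Matrix ι ι ℝ) (X : MB m ι) : MB (m ⊕ m) ι := dsum X (kc κ X)
def Wb (κ : Matrix ι ι ℝ) (X : MB m ι) : MB (m ⊕ m) ι := wm (Kb m κ) (Sb κ X)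
def Zb (κ J : Matrix ι ι ℝ) (X : MB m ι) : MB (m ⊕ m) ι := star (Wb κ (dg m J)) * Wb κ X
/-- difference of two structures -/
def Nb (κ J : Matrix ι ι ℝ) (F F₀ : MB m ι) : MB (m ⊕ m) ι :=
  Zb κ J F₀ * dsum F (kc κ F₀) * star (Zb κ J F₀)

lemma dgk (hκ : Cx G κ) : dg m κ * dg m κ = -1 := by rw [← dg_mul, hκ.sq, dg_neg, dg_one]
lemma dgk' (hκ : Cx G κ) (X : MB m ι) : dg m κ * (dg m κ * X) = -X := by
  rw [← mul_assoc, dgk hκ, neg_one_mul]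
lemma dgs (hκ : Cx G κ) : star (dg m κ) = - dg m κ := by rw [dg_star, hκ.skew, dg_neg]
lemma dga (hκ : Cx G κ) {g} (hg : g ∈ G) : dg m κ * dg m g = - (dg m g * dg m κ) := by
  rw [← dg_mul, ← dg_mul, hκ.anti g hg, dg_neg]

lemma Os.kc (hκ : Cx G κ) {X : MB m ι} (h : Os G X) : Os G (kc κ X) where
  skew := by simp only [BottP.kc, star_mul, dgs hκ, h.skew]; simp [mul_assoc]
  sq := by
    simp only [BottP.kc, mul_assoc, dgk' hκ]
    rw [mul_neg, ← mul_assoc X X, h.sq]; simp [dgk hκ]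
  anti g hg := by
    simp only [BottP.kc, mul_assoc]
    rw [dga hκ hg, mul_neg, ← mul_assoc X, h.anti g hg, neg_mul, mul_neg, mul_neg, neg_neg,
      ← mul_assoc, ← mul_assoc, dga hκ hg]
    simp [mul_assoc]

lemma kc_J (hκ : Cx G κ) (hJ : κ * J = -(J * κ)) : kc κ (dg m J) = dg m J := by
  rw [kc, ← dg_mul, hJ, dg_neg, dg_mul, neg_mul, mul_assoc, dgk hκ]; simp

lemma Kb_os (hκ : Cx G κ) : Os G (Kb m κ) where
  skew := by
    rw [Kb, star_eq_conjTranspose, fromBlocks_conjTranspose, fromBlocks_neg]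
    have := dgs (m := m) hκ
    rw [star_eq_conjTranspose] at this
    simp [this]
  sq := by
    rw [Kb, fromBlocks_multiply, ← fromBlocks_one, fromBlocks_neg]
    simp [dgk hκ]
  anti g hg := by
    rw [Kb, ← dsum_dg, dsum, fromBlocks_multiply, fromBlocks_multiply, fromBlocks_neg]
    simp [dga hκ hg]

lemma KS_of (hκ : Cx G κ) {X : MB m ι} (h : Os G X) : KS (Kb m κ) (Sb κ X) where
  ks := (Kb_os hκ).skew
  ss := (h.dsum (h.kc hκ)).skew
  kk := (Kb_os hκ).sq
  sq := (h.dsum (h.kc hκ)).sq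
  anti := by
    rw [Kb, Sb, dsum, fromBlocks_multiply, fromBlocks_multiply, fromBlocks_neg]
    simp [kc, mul_assoc, dgk hκ, dgk' hκ]

lemma Wb_un (hκ : Cx G κ) {X : MB m ι} (h : Os G X) : Un G (Wb κ X) where
  l := (KS_of hκ h).l
  r := (KS_of hκ h).r
  comm g hg := by
    rw [Wb, wm, smul_mul_assoc, mul_smul_comm, sub_mul, mul_sub, one_mul, mul_one, mul_assoc]
    have : Sb κ X * dg _ g = -(dg _ g * Sb κ X) := (h.dsum (h.kc hκ)).anti g hg
    rw [this, mul_neg, ← mul_assoc, (Kb_os hκ).anti g hg, neg_mul, neg_neg, mul_assoc]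

structure Ctx (G : Set (Matrix ι ι ℝ)) (J κ : Matrix ι ι ℝ) : Prop where
  k : Cx G κ
  kJ : κ * J = -(J * κ)
  J : Cx G J

lemma Zb_un (c : Ctx G J κ) {X : MB m ι} (h : Os G X) : Un G (Zb κ J X) :=
  (Wb_un c.k c.J.os).star.mul (Wb_un c.k h)

lemma Sb_J (c : Ctx G J κ) : Sb κ (dg m J) = dg (m ⊕ m) J := by
  rw [Sb, kc_J c.k c.kJ, dsum_dg]

lemma Zb_conj (c : Ctx G J κ) {X : MB m ι} (h : Os G X) :
    Zb κ J X * Sb κ X * star (Zb κ J X) = dg _ J := by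
  have h1 : Wb κ X * Sb κ X = Kb m κ * Wb κ X := (KS_of c.k h).int
  have h2 : star (Wb κ (dg m J)) * Kb m κ = Sb κ (dg m J) * star (Wb κ (dg m J)) :=
    (KS_of c.k c.J.os).int'
  have h3 := (Wb_un c.k h).r
  have h4 := (Wb_un (m := m) c.k c.J.os).l
  rw [Zb, star_mul, star_star, mul_assoc (star _), h1]
  simp only [← mul_assoc]
  rw [h2, mul_assoc _ (Wb κ X), h3, mul_one, mul_assoc, h4, mul_one, Sb_J c]

lemma Nb_self (c : Ctx G J κ) {X : MB m ι} (h : Os G X) : Nb κ J X X = dg _ J := Zb_conj c h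

lemma Nb_J (c : Ctx G J κ) (F : MB m ι) : Nb κ J F (dg m J) = dsum F (dg m J) := by
  rw [Nb, Zb, (Wb_un c.k c.J.os).l, one_mul, star_one, mul_one, kc_J c.k c.kJ]

lemma Nb_os (c : Ctx G J κ) {F F₀ : MB m ι} (h : Os G F) (h₀ : Os G F₀) : Os G (Nb κ J F F₀) :=
  (Zb_un c h₀).conj (h.dsum (h₀.kc c.k))

lemma kc_cont (κ : Matrix ι ι ℝ) : Continuous (kc (m := m) κ) := by unfold kc; fun_prop
lemma Wb_cont (κ : Matrix ι ι ℝ) : Continuous (Wb (m := m) κ) := by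
  unfold Wb wm Sb
  have := dsumC (continuous_id (X := MB m ι)) (kc_cont (m := m) κ)
  exact (continuous_const.sub (continuous_const.mul this)).const_smul (√2)⁻¹
lemma Zb_cont (κ J : Matrix ι ι ℝ) : Continuous (Zb (m := m) κ J) :=
  continuous_const.mul (Wb_cont κ)
lemma Nb_cont {Q : Type} [TopologicalSpace Q] {F F₀ : Q → MB m ι} (h : Continuous F)
    (h₀ : Continuous F₀) : Continuous fun q => Nb κ J (F q) (F₀ q) :=
  ((((Zb_cont κ J).comp h₀).mul (dsumC h ((kc_cont κ).comp h₀))).mul ((Zb_cont κ J).comp h₀).star)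

/-! shuffles -/
def shf (m a : Type) : (m ⊕ a) ⊕ (m ⊕ a) ≃ (m ⊕ m) ⊕ (a ⊕ a) := Equiv.sumSumSumComm m a m a
lemma shf_dsum (X X' : MB m ι) (Y Y' : MB a ι) :
    rx (shf m a) (dsum (dsum X Y) (dsum X' Y')) = dsum (dsum X X') (dsum Y Y') := by
  ext i j : 1
  rcases i with (i | i) | (i | i) <;> rcases j with (j | j) | (j | j) <;> simp [dsum, rx, shf]
lemma shf_Kb : rx (shf m a) (Kb (m ⊕ a) κ) = dsum (Kb m κ) (Kb a κ) := by
  ext i j : 1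
  rcases i with (i | i) | (i | i) <;> rcases j with (j | j) | (j | j) <;>
    simp [dsum, rx, shf, Kb, dg, diagonal_apply]
lemma dsum_sub (X X' : MB m ι) (Y Y' : MB a ι) :
    dsum X Y - dsum X' Y' = dsum (X - X') (Y - Y') := by
  simp [sub_eq_add_neg, dsum_neg, dsum_add]
lemma kc_dsum (X : MB m ι) (Y : MB a ι) : kc κ (dsum X Y) = dsum (kc κ X) (kc κ Y) := by
  simp only [kc, ← dsum_dg, dsum_mul]
lemma shf_Wb (X : MB m ι) (Y : MB a ι) :
    rx (shf m a) (Wb κ (dsum X Y)) = dsum (Wb κ X) (Wb κ Y) := by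
  simp only [Wb, wm, rx_smul, rx_sub, rx_mul, shf_Kb, Sb, kc_dsum, shf_dsum, rx_one, dsum_mul,
    ← dsum_one, dsum_sub, dsum_smul]
lemma shf_Zb (X : MB m ι) (Y : MB a ι) :
    rx (shf m a) (Zb κ J (dsum X Y)) = dsum (Zb κ J X) (Zb κ J Y) := by
  simp only [Zb, rx_mul, rx_star, ← dsum_dg, shf_Wb, dsum_star, dsum_mul]
lemma shf_Nb (F F₀ : MB m ι) (Y Y₀ : MB a ι) :
    rx (shf m a) (Nb κ J (dsum F Y) (dsum F₀ Y₀)) = dsum (Nb κ J F F₀) (Nb κ J Y Y₀) := by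
  simp only [Nb, rx_mul, rx_star, shf_Zb, kc_dsum, shf_dsum, dsum_star, dsum_mul]

lemma rx2_dsum {m' : Type} [Fintype m'] [DecidableEq m'] (e : m ≃ m') (X Y : MB m ι) :
    rx (Equiv.sumCongr e e) (dsum X Y) = dsum (rx e X) (rx e Y) := by
  ext i j : 1
  rcases i with i | i <;> rcases j with j | j <;> simp [dsum, rx]
lemma rx2_Kb {m' : Type} [Fintype m'] [DecidableEq m'] (e : m ≃ m') :
    rx (Equiv.sumCongr e e) (Kb m κ) = Kb m' κ := by
  ext i j : 1
  rcases i with i | i <;> rcases j with j | j <;> simp [Kb, rx, dg, diagonal_apply]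
lemma rx_Nb {m' : Type} [Fintype m'] [DecidableEq m'] (e : m ≃ m') (F F₀ : MB m ι) :
    rx (Equiv.sumCongr e e) (Nb κ J F F₀) = Nb κ J (rx e F) (rx e F₀) := by
  have hk : ∀ X : MB m ι, rx e (kc κ X) = kc κ (rx e X) := fun X => by
    simp only [kc, rx_mul, rx_dg]
  have hW : ∀ X : MB m ι, rx (Equiv.sumCongr e e) (Wb κ X) = Wb κ (rx e X) := fun X => by
    simp only [Wb, wm, rx_smul, rx_sub, rx_mul, rx2_Kb, Sb, hk, rx2_dsum, rx_one]
  simp only [Nb, Zb, rx_mul, rx_star, hW, rx2_dsum, rx_dg, hk]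

/-! conjugation -/
lemma Nb_conj (c : Ctx G J κ) {U : MB m ι} (hU : Un G U) :
    ∃ V : MB (m ⊕ m) ι, V = star (Wb κ (dg m J)) * dsum U (-(kc κ U)) * Wb κ (dg m J) ∧
      Un (insert J G) V ∧ ∀ F F₀ : MB m ι,
      Nb κ J (U * F * star U) (U * F₀ * star U) = V * Nb κ J F F₀ * star V := by
  have hk := c.k
  set Uh : MB (m ⊕ m) ι := dsum U (-(kc κ U)) with hUh
  have e1 : star (-(kc κ U)) = -(kc κ (star U)) := by
    simp only [kc, star_neg, star_mul, dgs hk]; simp [mul_assoc]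
  have hu2 : Un G (-(kc κ U)) := by
    refine ⟨?_, ?_, fun g hg => ?_⟩
    · rw [e1]; simp only [kc, mul_assoc, neg_mul_neg, dgk' hk]
      rw [mul_neg, ← mul_assoc (star U), hU.l]; simp [dgk hk]
    · rw [e1]; simp only [kc, mul_assoc, neg_mul_neg, dgk' hk]
      rw [mul_neg, ← mul_assoc U, hU.r]; simp [dgk hk]
    · simp only [kc, mul_assoc, neg_mul, mul_neg]
      rw [dga hk hg, mul_neg, ← mul_assoc U, hU.comm g hg, mul_neg, ← mul_assoc, ← mul_assoc, dga hk hg]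
      simp [mul_assoc]
  have hUU : Un G Uh := hU.dsum hu2
  have hK : Uh * Kb m κ = Kb m κ * Uh := by
    rw [hUh, Kb, dsum, fromBlocks_multiply, fromBlocks_multiply]
    simp [kc, mul_assoc, dgk hk, dgk' hk]
  have hS : ∀ X Y : MB m ι, dsum (U * X * star U) (kc κ (U * Y * star U)) =
      Uh * dsum X (kc κ Y) * star Uh := fun X Y => by
    rw [hUh, dsum_star, dsum_mul, dsum_mul, e1]
    congr 1
    simp [kc, mul_assoc, dgk hk, dgk' hk]
  have hW : ∀ X : MB m ι, Wb κ (U * X * star U) = Uh * Wb κ X * star Uh := fun X => by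
    simp only [Wb, wm, Sb, hS, mul_smul_comm, smul_mul_assoc, mul_sub, sub_mul, mul_one, hUU.r]
    congr 2
    simp only [← mul_assoc]
    rw [hK]
  have hWJ := Wb_un (m := m) hk c.J.os
  have hV := (hWJ.star.mul hUU).mul hWJ
  refine ⟨_, rfl, ⟨hV.l, hV.r, ?_⟩, fun F F₀ => ?_⟩
  · intro g hg
    rcases hg with rfl | hg
    · have h1 : Wb κ (dg m g) * dg (m ⊕ m) g = Kb m κ * Wb κ (dg m g) := by
        rw [← Sb_J c]; exact (KS_of hk c.J.os).int
      have h2 : star (Wb κ (dg m g)) * Kb m κ = dg (m ⊕ m) g * star (Wb κ (dg m g)) := by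
        rw [← Sb_J c]; exact (KS_of hk c.J.os).int'
      rw [mul_assoc, h1, ← mul_assoc, mul_assoc _ Uh, hK, ← mul_assoc, h2]
      simp only [mul_assoc]
    · exact hV.comm g hg
  · have hZ : Zb κ J (U * F₀ * star U) = star (Wb κ (dg m J)) * Uh * Wb κ (dg m J) * Zb κ J F₀ * star Uh := by
      rw [Zb, hW, Zb]
      have : ∀ A B : MB (m ⊕ m) ι, A * Wb κ (dg m J) * (star (Wb κ (dg m J)) * B) = A * B := fun A B => by
        rw [mul_assoc, ← mul_assoc (Wb κ (dg m J)), hWJ.r, one_mul]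
      rw [this]
      simp only [mul_assoc]
    have hl : ∀ A : MB (m ⊕ m) ι, star Uh * (Uh * A) = A := fun A => by
      rw [← mul_assoc, hUU.l, one_mul]
    rw [Nb, hZ, hS, Nb]
    simp only [star_mul, star_star, mul_assoc, hl]

end pair

section peq
variable {Q : Type} [TopologicalSpace Q] {ι m a m' m'' : Type} [Fintype m] [DecidableEq m]
  [Fintype ι] [DecidableEq ι]
  [Fintype a] [DecidableEq a] [Fintype m'] [DecidableEq m'] [Fintype m''] [DecidableEq m'']
  {G : Set (Matrix ι ι ℝ)} {bd : Set Q} {J κ : Matrix ι ι ℝ}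

structure GFam (G : Set (Matrix ι ι ℝ)) (X : Q → MB m ι) : Prop where
  cont : Continuous X
  gls : ∀ q, GLs G (X q)

lemma GFam.rho {X : Q → MB m ι} (h : GFam G X) : Fam G (fun q => rho (X q)) :=
  ⟨rho_cont.comp_continuous h.cont fun q => (h.gls q).unit, fun q => rho_os (h.gls q)⟩
lemma Fam.gfam {X : Q → MB m ι} (h : Fam G X) : GFam G X := ⟨h.cont, fun q => (h.os q).gls⟩
lemma GFam.dsum {X : Q → MB m ι} {Y : Q → MB a ι} (h : GFam G X) (h' : GFam G Y) :
    GFam G (fun q => dsum (X q) (Y q)) := ⟨dsumC h.cont h'.cont, fun q => (h.gls q).dsum (h'.gls q)⟩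
lemma GFam.rx {X : Q → MB m ι} (e : m ≃ m') (h : GFam G X) : GFam G (fun q => rx e (X q)) :=
  ⟨(rx_cont e).comp h.cont, fun q => (h.gls q).rx e⟩

/-- relative pair -/
structure PF (bd : Set Q) (G : Set (Matrix ι ι ℝ)) (X X₀ : Q → MB m ι) : Prop where
  l : GFam G X
  r : GFam G X₀
  eq : ∀ q ∈ bd, X q = X₀ q

def NN (κ J : Matrix ι ι ℝ) (X X₀ : Q → MB m ι) : Q → MB (m ⊕ m) ι :=
  fun q => Nb κ J (rho (X q)) (rho (X₀ q))

lemma PF.based (c : Ctx G J κ) {X X₀ : Q → MB m ι} (h : PF bd G X X₀) :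
    Based bd G J (NN κ J X X₀) where
  cont := Nb_cont h.l.rho.cont h.r.rho.cont
  os q := Nb_os c (h.l.rho.os q) (h.r.rho.os q)
  base q hq := by
    rw [NN, h.eq q hq]; exact Nb_self c (h.r.rho.os q)

def PEq (bd : Set Q) (G : Set (Matrix ι ι ℝ)) (J κ : Matrix ι ι ℝ)
    (X X₀ : Q → MB m ι) (Y Y₀ : Q → MB m' ι) : Prop := SEq bd G J (NN κ J X X₀) (NN κ J Y Y₀)

lemma PEq.symm {X X₀ : Q → MB m ι} {Y Y₀ : Q → MB m' ι} (h : PEq bd G J κ X X₀ Y Y₀) :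
    PEq bd G J κ Y Y₀ X X₀ := SEq.symm h
lemma PEq.trans (c : Ctx G J κ) {X X₀ : Q → MB m ι} {Y Y₀ : Q → MB m' ι} {Z Z₀ : Q → MB m'' ι}
    (h : PEq bd G J κ X X₀ Y Y₀) (h' : PEq bd G J κ Y Y₀ Z Z₀) : PEq bd G J κ X X₀ Z Z₀ :=
  SEq.trans c.J h h'

lemma PEq.hom (c : Ctx G J κ) {X X₀ Y Y₀ : Q → MB m ι} (H H₀ : unitInterval × Q → MB m ι)
    (h : GFam G H) (h₀ : GFam G H₀) (hb : ∀ t, ∀ q ∈ bd, H (t, q) = H₀ (t, q))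
    (e1 : ∀ q, H (0, q) = X q) (e2 : ∀ q, H₀ (0, q) = X₀ q) (e3 : ∀ q, H (1, q) = Y q)
    (e4 : ∀ q, H₀ (1, q) = Y₀ q) : PEq bd G J κ X X₀ Y Y₀ := by
  have hf : PF (Set.univ ×ˢ bd) G H H₀ := ⟨h, h₀, fun p hp => hb p.1 p.2 hp.2⟩
  have hB := hf.based c
  refine SEq.of_relH c.J ⟨NN κ J H H₀, hB.cont, fun q => ?_, fun q => ?_, hB.os, fun t q hq => ?_⟩
  · simp only [NN, e1, e2]
  · simp only [NN, e3, e4]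
  · rw [hB.base (t, q) ⟨trivial, hq⟩]
    have := hB.base (0, q) ⟨trivial, hq⟩
    rw [← this]
    simp only [NN, e1, e2]

lemma PEq.refl (c : Ctx G J κ) {X X₀ : Q → MB m ι} (h : PF bd G X X₀) : PEq bd G J κ X X₀ X X₀ :=
  SEq.refl c.J (h.based c).toFam

lemma rho_rho {X : MB m ι} (h : GLs G X) : rho (rho X) = rho X := rho_id (rho_os h)

lemma PF.rho {X X₀ : Q → MB m ι} (h : PF bd G X X₀) :
    PF bd G (fun q => rho (X q)) (fun q => BottP.rho (X₀ q)) :=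
  ⟨h.l.rho.gfam, h.r.rho.gfam, fun q hq => by rw [h.eq q hq]⟩

/-- linear path to the polar part -/
def pth (X : Q → MB m ι) : unitInterval × Q → MB m ι :=
  fun p => (1 - (p.1 : ℝ)) • X p.2 + (p.1 : ℝ) • rho (X p.2)
lemma pth_g {X : Q → MB m ι} (h : GFam G X) : GFam G (pth X) := by
  refine ⟨?_, fun p => rho_path (h.gls p.2) _ p.1.2.1 p.1.2.2⟩
  have h1 := h.cont
  have h2 := h.rho.cont
  have h3 : Continuous fun p : unitInterval × Q => rho (X p.2) := h2.comp continuous_snd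
  unfold pth
  fun_prop

lemma PEq.rx (c : Ctx G J κ) {X X₀ : Q → MB m ι} (h : PF bd G X X₀) (e : m ≃ m') :
    PEq bd G J κ X X₀ (fun q => rx e (X q)) (fun q => BottP.rx e (X₀ q)) := by
  have h1 : PEq bd G J κ X X₀ (fun q => BottP.rx e (BottP.rho (X q)))
      (fun q => BottP.rx e (BottP.rho (X₀ q))) := by
    refine SEq.of_eq_rx c.J (h.based c).toFam (Equiv.sumCongr e e) fun q => ?_
    simp only [NN, rx_Nb, rho_id ((h.l.rho.os q).rx e), rho_id ((h.r.rho.os q).rx e)]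
  refine h1.trans c (PEq.symm ?_)
  refine PEq.hom c (fun p => BottP.rx e (pth X p)) (fun p => BottP.rx e (pth X₀ p)) ((pth_g h.l).rx e)
    ((pth_g h.r).rx e) ?_ ?_ ?_ ?_ ?_
  · intro t q hq; simp only [pth, h.eq q hq]
  all_goals intro q; simp [pth]

lemma PEq.add (c : Ctx G J κ) {X X₀ : Q → MB m ι} (h : PF bd G X X₀) {Y : Q → MB a ι}
    (hY : GFam G Y) :
    PEq bd G J κ (fun q => dsum (X q) (Y q)) (fun q => dsum (X₀ q) (Y q)) X X₀ := by
  have h1 : PEq bd G J κ (fun q => dsum (rho (X q)) (rho (Y q)))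
      (fun q => dsum (rho (X₀ q)) (rho (Y q))) X X₀ := by
    refine SEq.trans c.J ?_ (SEq.stab c.J (h.based c).toFam (a ⊕ a)).symm
    refine SEq.of_eq_rx c.J ?_ (shf m a) fun q => ?_
    · have : PF bd G (fun q => dsum (rho (X q)) (rho (Y q))) (fun q => dsum (rho (X₀ q)) (rho (Y q))) :=
        ⟨h.l.rho.gfam.dsum hY.rho.gfam, h.r.rho.gfam.dsum hY.rho.gfam, fun q hq => by rw [h.eq q hq]⟩
      exact (this.based c).toFam
    · simp only [NN, rho_id ((h.l.rho.os q).dsum (hY.rho.os q)),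
        rho_id ((h.r.rho.os q).dsum (hY.rho.os q)), shf_Nb, Nb_self c (hY.rho.os q)]
  refine PEq.trans c ?_ h1
  refine PEq.hom c (fun p => dsum (pth X p) (pth Y p)) (fun p => dsum (pth X₀ p) (pth Y p))
    ((pth_g h.l).dsum (pth_g hY)) ((pth_g h.r).dsum (pth_g hY)) ?_ ?_ ?_ ?_ ?_
  · intro t q hq; simp only [pth, h.eq q hq]
  all_goals intro q; simp [pth]

lemma Un.conjG {U X : MB m ι} (h : Un G U) (hX : GLs G X) : GLs G (U * X * Star.star U) where
  skew := by simp [star_mul, hX.skew, mul_assoc]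
  unit := ((IsUnit.mul ⟨⟨U, Star.star U, h.r, h.l⟩, rfl⟩ hX.unit).mul ⟨⟨Star.star U, U, h.l, h.r⟩, rfl⟩)
  anti g hg := by
    have h1 := h.comm' (h.comm g hg)
    rw [mul_assoc, h1, ← mul_assoc, mul_assoc U, hX.anti g hg, mul_neg, neg_mul, ← mul_assoc U,
      h.comm g hg]
    simp only [mul_assoc]

lemma PF.conj {X X₀ : Q → MB m ι} (h : PF bd G X X₀) {U : Q → MB m ι}
    (hUc : Continuous U) (hU : ∀ q, Un G (U q)) :
    PF bd G (fun q => U q * X q * star (U q)) (fun q => U q * X₀ q * star (U q)) :=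
  ⟨⟨(hUc.mul h.l.cont).mul hUc.star, fun q => (hU q).conjG (h.l.gls q)⟩,
   ⟨(hUc.mul h.r.cont).mul hUc.star, fun q => (hU q).conjG (h.r.gls q)⟩, fun q hq => by
    simp only [h.eq q hq]⟩

lemma PEq.conj (c : Ctx G J κ) {X X₀ : Q → MB m ι} (h : PF bd G X X₀) {U : Q → MB m ι}
    (hUc : Continuous U) (hU : ∀ q, Un G (U q)) :
    PEq bd G J κ X X₀ (fun q => U q * X q * star (U q)) (fun q => U q * X₀ q * star (U q)) := by
  have h1 : PEq bd G J κ X X₀ (fun q => U q * rho (X q) * star (U q))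
      (fun q => U q * rho (X₀ q) * star (U q)) := by
    let V : Q → MB (m ⊕ m) ι := fun q =>
      star (Wb κ (dg m J)) * dsum (U q) (-(kc κ (U q))) * Wb κ (dg m J)
    have hV : Continuous V :=
      (continuous_const.mul (dsumC hUc ((kc_cont κ).comp hUc).neg)).mul continuous_const
    have hVu : ∀ q, Un (insert J G) (V q) := fun q => by
      obtain ⟨V', e, h1, h2⟩ := Nb_conj c (hU q)
      subst e; exact h1
    have := SEq.conj c.J (h.based c) hV hVu
    have e : NN κ J (fun q => U q * rho (X q) * star (U q)) (fun q => U q * rho (X₀ q) * star (U q))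
        = fun q => V q * NN κ J X X₀ q * star (V q) := by
      funext q
      obtain ⟨V', e, h1, h2⟩ := Nb_conj c (hU q)
      subst e
      rw [NN, rho_id ((hU q).conj (h.l.rho.os q)), rho_id ((hU q).conj (h.r.rho.os q)), h2]
      rfl
    rw [PEq, e]; exact this
  refine PEq.trans c h1 (PEq.symm ?_)
  have hp := PF.conj (bd := Set.univ ×ˢ bd) (X := pth X) (X₀ := pth X₀)
    ⟨pth_g h.l, pth_g h.r, fun p hp => by simp only [pth, h.eq p.2 hp.2]⟩
    (U := fun p => U p.2) (hUc.comp continuous_snd) (fun p => hU p.2)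
  refine PEq.hom c _ _ hp.l hp.r (fun t q hq => hp.eq (t, q) ⟨trivial, hq⟩) ?_ ?_ ?_ ?_
  all_goals intro q; simp [pth]

lemma NN_J (c : Ctx G J κ) {F : Q → MB m ι} (h : Based bd G J F) :
    SEq bd G J (NN κ J F (fun _ => dg m J)) F := by
  have : NN κ J F (fun _ => dg m J) = fun q => dsum (F q) (dg m J) := by
    funext q
    rw [NN, rho_id (h.os q), rho_id c.J.os, Nb_J c]
  rw [this]
  exact (SEq.stab c.J h.toFam m).symm

lemma PEq.out (c : Ctx G J κ) {F : Q → MB m ι} {F' : Q → MB m' ι} (h : Based bd G J F)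
    (h' : Based bd G J F') (hp : PEq bd G J κ F (fun _ => dg m J) F' (fun _ => dg m' J)) :
    SEq bd G J F F' :=
  ((NN_J c h).symm.trans c.J hp).trans c.J (NN_J c h')

lemma Based.pf (c : Ctx G J κ) {F : Q → MB m ι} (h : Based bd G J F) :
    PF bd G F (fun _ => dg m J) :=
  ⟨h.toFam.gfam, ⟨continuous_const, fun _ => c.J.os.gls⟩, h.base⟩

end peq
end BottP

set_option linter.all false
set_option autoImplicit false
set_option linter.unusedSectionVars false
set_option linter.unusedSimpArgs false
namespace BottP
open Matrix Topology

section act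
variable {n ι : Type} [Fintype n] [DecidableEq n] [Fintype ι] [DecidableEq ι]

def act (X : MB n ι) (v : n × ι → ℝ) : n × ι → ℝ := fl X *ᵥ v

lemma act_mul (X Y : MB n ι) (v : n × ι → ℝ) : act (X * Y) v = act X (act Y v) := by
  simp only [act, map_mul, mulVec_mulVec]
lemma act_add (X Y : MB n ι) (v : n × ι → ℝ) : act (X + Y) v = act X v + act Y v := by
  simp only [act, map_add, add_mulVec]
lemma act_sub (X Y : MB n ι) (v : n × ι → ℝ) : act (X - Y) v = act X v - act Y v := by
  simp only [act, map_sub, sub_mulVec]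
lemma act_neg (X : MB n ι) (v : n × ι → ℝ) : act (-X) v = - act X v := by
  simp only [act, map_neg, neg_mulVec]
lemma act_one (v : n × ι → ℝ) : act (1 : MB n ι) v = v := by
  simp only [act, map_one, one_mulVec]
lemma act_zero (v : n × ι → ℝ) : act (0 : MB n ι) v = 0 := by
  simp only [act, map_zero, zero_mulVec]
lemma act_smul (s : ℝ) (X : MB n ι) (v : n × ι → ℝ) : act (s • X) v = s • act X v := by
  simp only [act, fl_smul, smul_mulVec]
lemma act_vadd (X : MB n ι) (u v : n × ι → ℝ) : act X (u + v) = act X u + act X v := by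
  simp only [act, mulVec_add]
lemma act_vsub (X : MB n ι) (u v : n × ι → ℝ) : act X (u - v) = act X u - act X v := by
  simp only [act, mulVec_sub]
lemma act_vneg (X : MB n ι) (u : n × ι → ℝ) : act X (-u) = - act X u := by
  simp only [act, mulVec_neg]
lemma act_vsmul (X : MB n ι) (s : ℝ) (u : n × ι → ℝ) : act X (s • u) = s • act X u := by
  simp only [act, mulVec_smul]
lemma act_vzero (X : MB n ι) : act X 0 = 0 := by
  simp only [act, mulVec_zero]
lemma act_adj (X : MB n ι) (u v : n × ι → ℝ) : act X u ⬝ᵥ v = u ⬝ᵥ act (star X) v := by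
  rw [act, act, fl_star, star_eq_conjTranspose, conjTranspose_eq_transpose_of_trivial,
    dotProduct_comm, dotProduct_mulVec, dotProduct_comm, mulVec_transpose]
lemma nn (u : n × ι → ℝ) : 0 ≤ u ⬝ᵥ u := Finset.sum_nonneg fun i _ => mul_self_nonneg _
lemma nn0 {u : n × ι → ℝ} (h : u ⬝ᵥ u = 0) : u = 0 := dotProduct_self_eq_zero.mp h

lemma unit_of_act {X : MB n ι} (h : ∀ v, act X v = 0 → v = 0) : IsUnit X := by
  have : IsUnit (fl X) := by
    rw [← mulVec_injective_iff_isUnit]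
    intro u v huv
    have : act X (u - v) = 0 := by rw [act_vsub]; simp only [act]; rw [sub_eq_zero]; exact huv
    exact sub_eq_zero.mp (h _ this)
  have := this.map (fl (m := n) (ι := ι)).symm
  simpa using this
lemma act_unit {X : MB n ι} (h : IsUnit X) {v : n × ι → ℝ} (hv : act X v = 0) : v = 0 := by
  obtain ⟨⟨X, Y, h1, h2⟩, rfl⟩ := h
  have : act (Y * X) v = 0 := by rw [act_mul]; simp only at hv; rw [hv, act_vzero]
  rwa [h2, act_one] at this

lemma iso {U : MB n ι} (h : star U * U = 1) (u v : n × ι → ℝ) : act U u ⬝ᵥ act U v = u ⬝ᵥ v := by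
  rw [act_adj, ← act_mul, h, act_one]

/-- small operators -/
def Sm (η : ℝ) (X : MB n ι) : Prop :=
  ∀ u v : n × ι → ℝ, 2 * (u ⬝ᵥ act X v) ≤ η * (u ⬝ᵥ u + v ⬝ᵥ v)

lemma Sm.add {η η' : ℝ} {X Y : MB n ι} (h : Sm η X) (h' : Sm η' Y) : Sm (η + η') (X + Y) := by
  intro u v
  rw [act_add, dotProduct_add]
  have := h u v
  have := h' u v
  linarith
lemma Sm.neg {η : ℝ} {X : MB n ι} (h : Sm η X) : Sm η (-X) := by
  intro u v
  have := h (-u) v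
  rw [act_neg, dotProduct_neg]
  simpa using this
lemma Sm.sub {η η' : ℝ} {X Y : MB n ι} (h : Sm η X) (h' : Sm η' Y) : Sm (η + η') (X - Y) := by
  rw [sub_eq_add_neg]; exact h.add h'.neg
lemma Sm.smul {η : ℝ} {X : MB n ι} (h : Sm η X) {s : ℝ} (hs : 0 ≤ s) : Sm (s * η) (s • X) := by
  intro u v
  rw [act_smul, dotProduct_smul, smul_eq_mul]
  have := mul_le_mul_of_nonneg_left (h u v) hs
  linarith
lemma Sm.abs {η : ℝ} {X : MB n ι} (h : Sm η X) {s : ℝ} : Sm (|s| * η) (s • X) := by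
  rcases abs_cases s with ⟨e, hs⟩ | ⟨e, hs⟩
  · rw [e]; exact h.smul hs
  · rw [e]
    have := (h.neg).smul (s := -s) (by linarith)
    rwa [smul_neg, neg_smul, neg_neg] at this
lemma Sm.ml {η : ℝ} {X U : MB n ι} (h : Sm η X) (hU : U * star U = 1) : Sm η (U * X) := by
  intro u v
  have := h (act (star U) u) v
  rw [iso (by rw [star_star, hU])] at this
  rw [act_mul]
  rw [act_adj, star_star] at this
  exact this
lemma Sm.mr {η : ℝ} {X U : MB n ι} (h : Sm η X) (hU : star U * U = 1) : Sm η (X * U) := by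
  intro u v
  have := h u (act U v)
  rw [iso hU] at this
  rw [act_mul]
  exact this
lemma Sm.mono {η η' : ℝ} {X : MB n ι} (h : Sm η X) (hh : η ≤ η') : Sm η' X := by
  intro u v
  have := h u v
  have := mul_le_mul_of_nonneg_right hh (add_nonneg (nn u) (nn v))
  linarith
lemma Sm.mc {η : ℝ} (h0 : 0 ≤ η) {X Ω : MB n ι} (h : Sm η X)
    (hΩ : ∀ v, act Ω v ⬝ᵥ act Ω v ≤ v ⬝ᵥ v) : Sm η (X * Ω) := by
  intro u v
  have := h u (act Ω v)
  rw [act_mul]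
  have := mul_le_mul_of_nonneg_left (hΩ v) h0
  linarith

lemma Sm_entries {ε : ℝ} {X : MB n ι} (h : ∀ i j, |fl X i j| ≤ ε) :
    Sm (ε * Fintype.card (n × ι)) X := by
  intro u v
  have : 2 * (u ⬝ᵥ act X v) = ∑ i, ∑ j, 2 * (u i * (fl X i j * v j)) := by
    simp only [dotProduct, act, mulVec, Finset.mul_sum]
  rw [this]
  calc ∑ i, ∑ j, 2 * (u i * (fl X i j * v j)) ≤ ∑ i, ∑ j, ε * (u i * u i + v j * v j) := by
        refine Finset.sum_le_sum fun i _ => Finset.sum_le_sum fun j _ => ?_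
        have h1 := abs_le.mp (h i j)
        nlinarith [sq_nonneg (u i + v j), sq_nonneg (u i - v j)]
    _ = _ := by
        simp only [← Finset.mul_sum, Finset.sum_add_distrib, dotProduct, Finset.sum_const,
          Finset.card_univ, nsmul_eq_mul]
        rw [mul_add, mul_add, mul_assoc, mul_assoc]
        congr 2
        rw [Finset.mul_sum]; exact Finset.sum_congr rfl (fun _ _ => by ring)
end act

section est
variable {n ι : Type} [Fintype n] [DecidableEq n] [Fintype ι] [DecidableEq ι]

/-- skew complex structure in `MB` -/
structure Sc (F : MB n ι) : Prop where
  skew : star F = -F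
  sq : F * F = -1

lemma Sc.iso {F : MB n ι} (h : Sc F) : star F * F = 1 := by rw [h.skew, neg_mul, h.sq, neg_neg]
lemma Sc.iso' {F : MB n ι} (h : Sc F) : F * star F = 1 := by rw [h.skew, mul_neg, h.sq, neg_neg]

def aM (F J : MB n ι) : MB n ι := (1/2 : ℝ) • (F + J * F * J)
def dM (F J : MB n ι) : MB n ι := 1 - (1/2 : ℝ) • (F * J + J * F)

variable {F J U Ω : MB n ι}
lemma aM_skew (hF : Sc F) (hJ : Sc J) : star (aM F J) = - aM F J := by
  simp only [aM, star_smul, star_add, star_mul, hF.skew, hJ.skew, star_trivial]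
  simp [mul_assoc]; abel
lemma dM_sa (hF : Sc F) (hJ : Sc J) : star (dM F J) = dM F J := by
  simp only [dM, star_smul, star_sub, star_one, star_add, star_mul, hF.skew, hJ.skew, star_trivial]
  simp [add_comm]

lemma Sc.c (h : Sc F) (X : MB n ι) : F * (F * X) = -X := by rw [← mul_assoc, h.sq, neg_one_mul]

lemma ad_comm (hF : Sc F) (hJ : Sc J) : aM F J * dM F J = dM F J * aM F J := by
  simp only [aM, dM, mul_sub, sub_mul, mul_one, one_mul, smul_mul_smul_comm]
  congr 2
  simp only [add_mul, mul_add, mul_assoc, hF.c, hJ.c, hF.sq, hJ.sq, mul_neg, mul_one]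
  abel
lemma ad_rel (hF : Sc F) (hJ : Sc J) : dM F J * dM F J = (2:ℝ) • dM F J + aM F J * aM F J := by
  have h1 : (F * J + J * F) * (F * J + J * F) = (4:ℝ) • 1 + (F + J * F * J) * (F + J * F * J) := by
    simp only [add_mul, mul_add, mul_assoc, hF.c, hJ.c, hF.sq, hJ.sq, mul_neg, mul_one, neg_neg]
    have : (4:ℝ) • (1 : MB n ι) = 1 + 1 + 1 + 1 := by
      rw [show (4:ℝ) = 1 + 1 + 1 + 1 by norm_num]; simp only [add_smul, one_smul]
    rw [this]; abel
  simp only [aM, dM, mul_sub, sub_mul, mul_one, one_mul, smul_mul_smul_comm, h1]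
  module

lemma d_form (hF : Sc F) (hJ : Sc J) (u : n × ι → ℝ) :
    u ⬝ᵥ act (dM F J) u = (1/2) * (act (F + J) u ⬝ᵥ act (F + J) u) := by
  rw [act_adj, ← act_mul]
  have : star (F + J) * (F + J) = (2:ℝ) • dM F J := by
    simp only [star_add, hF.skew, hJ.skew, dM, add_mul, mul_add, neg_mul, hF.sq, hJ.sq]
    module
  rw [this, act_smul, dotProduct_smul, smul_eq_mul]; ring
lemma d_psd (hF : Sc F) (hJ : Sc J) (u : n × ι → ℝ) : 0 ≤ u ⬝ᵥ act (dM F J) u := by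
  rw [d_form hF hJ]; have := nn (act (F + J) u); linarith

lemma E1core {a d V : MB n ι} (ha : star a = -a) (hd : star d = d) (hc : a * d = d * a)
    (hr : d * d = (2:ℝ) • d + a * a) (hp : ∀ u, 0 ≤ u ⬝ᵥ act d u)
    (h1 : ∀ x, (3/4) * (x ⬝ᵥ x) ≤ x ⬝ᵥ act d x + act V x ⬝ᵥ act V x - act V x ⬝ᵥ act d (act V x))
    (h2 : ∀ y, (3/4) * (y ⬝ᵥ y) ≤ y ⬝ᵥ act d y + act (star V) y ⬝ᵥ act (star V) y
      - act (star V) y ⬝ᵥ act d (act (star V) y))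
    (h3 : Sm (1/4) (star V * a - a * star V)) {x y : n × ι → ℝ}
    (e1 : act a x = act (star (d - V)) y) (e2 : act (d - V) x = act a y) : x = 0 ∧ y = 0 := by
  rw [star_sub, hd, act_sub] at e1
  rw [act_sub] at e2
  have dd : ∀ u v, act d u ⬝ᵥ v = u ⬝ᵥ act d v := fun u v => by rw [act_adj, hd]
  have aa : ∀ u v, act a u ⬝ᵥ v = - (u ⬝ᵥ act a v) := fun u v => by
    rw [act_adj, ha, act_neg, dotProduct_neg]
  have vv : ∀ u v, act V u ⬝ᵥ v = u ⬝ᵥ act (star V) v := fun u v => by rw [act_adj]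
  have r : ∀ u, act d (act d u) = (2:ℝ) • act d u + act a (act a u) := fun u => by
    rw [← act_mul, hr, act_add, act_smul, act_mul]
  have cc : ∀ u, act a (act d u) = act d (act a u) := fun u => by rw [← act_mul, hc, act_mul]
  have z1 : act a x - act d y + act (star V) y = 0 := by rw [e1]; abel
  have z2 : act d x - act V x - act a y = 0 := by rw [e2]; abel
  have s1 : (act a x - act d y + act (star V) y) ⬝ᵥ (act a x - act d y + act (star V) y) = 0 := by
    rw [z1]; simp
  have s2 : (act d x - act V x - act a y) ⬝ᵥ (act d x - act V x - act a y) = 0 := by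
    rw [z2]; simp
  have t1 : act a x ⬝ᵥ act a x + act d x ⬝ᵥ act d x = 2 * (x ⬝ᵥ act d x) := by
    rw [aa, dd, r, dotProduct_add, dotProduct_smul, smul_eq_mul]; ring
  have t2 : act a y ⬝ᵥ act a y + act d y ⬝ᵥ act d y = 2 * (y ⬝ᵥ act d y) := by
    rw [aa, dd, r, dotProduct_add, dotProduct_smul, smul_eq_mul]; ring
  have t3 : act a x ⬝ᵥ act d y + act d x ⬝ᵥ act a y = 0 := by
    rw [aa, dd, cc]; ring
  have t4 : act a x ⬝ᵥ act (star V) y + act V x ⬝ᵥ act a y = x ⬝ᵥ act (star V * a - a * star V) y := by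
    rw [aa, vv, act_sub, dotProduct_sub, act_mul, act_mul]; ring
  have p1 := hp (x - act V x)
  have p2 := hp (y - act (star V) y)
  have q1 := h1 x
  have q2 := h2 y
  have q3 := h3 (-x) y
  have c1 : act V x ⬝ᵥ act d x = act d x ⬝ᵥ act V x := dotProduct_comm _ _
  have c2 : act (star V) y ⬝ᵥ act d y = act d y ⬝ᵥ act (star V) y := dotProduct_comm _ _
  simp only [act_vsub, sub_dotProduct, dotProduct_sub, add_dotProduct, dotProduct_add] at s1 s2 p1 p2
  simp only [neg_dotProduct, dotProduct_neg, neg_neg] at q3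
  have c3 := dotProduct_comm (act d y) (act a x)
  have c4 := dotProduct_comm (act (star V) y) (act a x)
  have c5 := dotProduct_comm (act (star V) y) (act d y)
  have c6 := dotProduct_comm (act V x) (act d x)
  have c7 := dotProduct_comm (act a y) (act d x)
  have c8 := dotProduct_comm (act a y) (act V x)
  have c9 := dd x (act V x)
  have c10 := dd y (act (star V) y)
  have f1 : (1/2) * (x ⬝ᵥ x) + (1/2) * (y ⬝ᵥ y) ≤ 0 := by linarith
  have := nn x
  have := nn y
  exact ⟨nn0 (by linarith), nn0 (by linarith)⟩

lemma comm_small {η : ℝ} (hJ : Sc J) (hUJ : U * J = J * U) (h : Sm η (U * F - F * U)) :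
    Sm η (U * aM F J - aM F J * U) ∧ Sm η (U * dM F J - dM F J * U) := by
  set δ := U * F - F * U with hδ
  have e1 : U * aM F J - aM F J * U = (1/2 : ℝ) • (δ + J * δ * J) := by
    simp only [aM, mul_smul_comm, smul_mul_assoc, ← smul_sub]
    congr 1
    simp only [hδ, mul_add, add_mul, mul_sub, sub_mul]
    have : U * (J * F * J) = J * (U * F) * J := by simp only [← mul_assoc, hUJ]
    have h2 : J * F * J * U = J * (F * U) * J := by simp only [mul_assoc, hUJ]
    rw [this, h2]; abel
  have e2 : U * dM F J - dM F J * U = -((1/2 : ℝ) • (δ * J + J * δ)) := by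
    simp only [dM, mul_sub, sub_mul, mul_one, one_mul, mul_smul_comm, smul_mul_assoc]
    have : U * (F * J + J * F) - (F * J + J * F) * U = δ * J + J * δ := by
      simp only [hδ, mul_add, add_mul, mul_sub, sub_mul]
      have h1 : U * (J * F) = J * (U * F) := by simp only [← mul_assoc, hUJ]
      have h2 : F * J * U = F * U * J := by simp only [mul_assoc, hUJ]
      rw [h1, h2]; simp only [mul_assoc]; abel
    rw [← this]; module
  have s1 := ((h.ml hJ.iso').mr hJ.iso)
  constructor
  · rw [e1]; exact ((h.add s1).smul (s := 1/2) (by norm_num)).mono (by linarith)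
  · rw [e2]; exact (((h.mr hJ.iso).add (h.ml hJ.iso')).smul (s := 1/2) (by norm_num)).neg.mono (by linarith)

lemma star_comm_small {η : ℝ} (hU : star U * U = 1) (hU' : U * star U = 1) {T : MB n ι}
    (h : Sm η (U * T - T * U)) : Sm η (star U * T - T * star U) := by
  have : star U * T - T * star U = star U * (-(U * T - T * U)) * star U := by
    simp only [mul_neg, neg_mul, mul_sub, sub_mul, mul_assoc, hU']
    rw [← mul_assoc (star U) U, hU]; simp
  rw [this]
  exact (h.neg.ml (by rw [star_star, hU])).mr (by rw [star_star, hU'])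

lemma E1 (hF : Sc F) (hJ : Sc J) (hU : star U * U = 1) (hU' : U * star U = 1) (hUJ : U * J = J * U)
    (hΩ : star Ω = Ω) (hΩF : Ω * F = F * Ω) (hΩJ : Ω * J = J * Ω)
    (hΩ1 : ∀ v, act Ω v ⬝ᵥ act Ω v ≤ v ⬝ᵥ v)
    (hΩd : Ω * Ω * (dM F J - (2:ℝ) • 1) = dM F J - (2:ℝ) • 1)
    (hs : Sm (1/4) (U * F - F * U)) {x y : n × ι → ℝ}
    (e1 : act (aM F J) x = act (star (dM F J - Ω * U)) y)
    (e2 : act (dM F J - Ω * U) x = act (aM F J) y) : x = 0 ∧ y = 0 := by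
  obtain ⟨sa, sd⟩ := comm_small hJ hUJ hs
  have hΩa : Ω * aM F J = aM F J * Ω := by
    simp only [aM, mul_smul_comm, smul_mul_assoc, mul_add, add_mul]
    have : Ω * (J * F * J) = J * F * J * Ω := by
      simp only [mul_assoc, ← hΩJ]; simp only [← mul_assoc, hΩJ, hΩF]; simp only [mul_assoc, hΩF]
      simp only [← mul_assoc, mul_assoc J Ω F, hΩF]
      rw [mul_assoc (J * F) Ω J, hΩJ, ← mul_assoc]
    rw [this, hΩF]
  have hΩdd : Ω * dM F J = dM F J * Ω := by
    simp only [dM, mul_sub, sub_mul, mul_one, one_mul, mul_smul_comm, smul_mul_assoc, mul_add, add_mul]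
    have h1 : Ω * (F * J) = F * J * Ω := by rw [← mul_assoc, hΩF, mul_assoc, hΩJ, mul_assoc]
    have h2 : Ω * (J * F) = J * F * Ω := by rw [← mul_assoc, hΩJ, mul_assoc, hΩF, mul_assoc]
    rw [h1, h2]
  have hd := dM_sa hF hJ
  have key : ∀ v, act Ω v ⬝ᵥ act Ω v - act Ω v ⬝ᵥ act (dM F J) (act Ω v) =
      2 * (v ⬝ᵥ v) - act Ω v ⬝ᵥ act Ω v - v ⬝ᵥ act (dM F J) v := fun v => by
    have e : Ω * dM F J * Ω = (2:ℝ) • (Ω * Ω) + dM F J - (2:ℝ) • 1 := by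
      have := hΩd
      rw [mul_sub, mul_assoc, hΩdd, ← mul_assoc] at this
      rw [sub_eq_iff_eq_add] at this
      rw [this]
      simp only [mul_smul_comm, mul_one]; abel
    have : act Ω v ⬝ᵥ act (dM F J) (act Ω v) = v ⬝ᵥ act (Ω * dM F J * Ω) v := by
      rw [act_adj, hΩ, act_mul, act_mul]
    have h2 : act Ω v ⬝ᵥ act Ω v = v ⬝ᵥ act (Ω * Ω) v := by rw [act_adj, hΩ, act_mul]
    rw [this, e, act_sub, act_add, act_smul, act_smul, act_one, dotProduct_sub, dotProduct_add,
      dotProduct_smul, dotProduct_smul, smul_eq_mul, smul_eq_mul, h2]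
    ring
  refine E1core (aM_skew hF hJ) hd (ad_comm hF hJ) (ad_rel hF hJ) (d_psd hF hJ) ?_ ?_ ?_ e1 e2
  · intro x
    have k := key (act U x)
    have s := sd.neg (act U x) x
    rw [act_neg, dotProduct_neg, act_sub, dotProduct_sub, act_mul, act_mul, iso hU, iso hU] at s
    rw [act_mul]
    have := hΩ1 (act U x)
    rw [iso hU] at k this
    linarith
  · intro y
    have k := key y
    have hU2 : star (star U) * star U = 1 := by rw [star_star, hU']
    have s := (star_comm_small hU hU' sd).neg (act (star U) (act Ω y)) (act Ω y)
    rw [act_neg, dotProduct_neg, act_sub, dotProduct_sub, act_mul, act_mul, iso hU2, iso hU2] at s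
    rw [star_mul, hΩ, act_mul, iso hU2]
    have := hΩ1 y
    linarith
  · have e : star (Ω * U) * aM F J - aM F J * star (Ω * U) =
        (star U * aM F J - aM F J * star U) * Ω := by
      rw [star_mul, hΩ, sub_mul, mul_assoc, hΩa]; simp only [mul_assoc]
    rw [e]
    exact (star_comm_small hU hU' sa).mc (by norm_num) hΩ1


section E2
variable {φ : MB n ι}
def wU (U : MB n ι) : MB n ι := 1 - (1/2 : ℝ) • (U + star U)
def AU (U : MB n ι) : MB n ι := (1/2 : ℝ) • (star U - U)
lemma wU_sa : star (wU U) = wU U := by simp [wU, add_comm]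
lemma AU_sk : star (AU U) = -AU U := by
  simp only [AU, star_smul, star_sub, star_star, star_trivial, ← smul_neg, neg_sub]
lemma wA_comm (hU : star U * U = 1) (hU' : U * star U = 1) : wU U * AU U = AU U * wU U := by
  simp only [wU, AU, mul_sub, sub_mul, mul_one, one_mul, smul_mul_smul_comm, mul_add, add_mul, hU, hU', mul_smul_comm,
    smul_mul_assoc]
  module
lemma wA_rel (hU : star U * U = 1) (hU' : U * star U = 1) :
    wU U * wU U - AU U * AU U = (2:ℝ) • wU U := by
  simp only [wU, AU, mul_sub, sub_mul, mul_one, one_mul, smul_mul_smul_comm, mul_add, add_mul, hU, hU', mul_smul_comm,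
    smul_mul_assoc]
  module
lemma w_form (hU : star U * U = 1) (u : n × ι → ℝ) :
    u ⬝ᵥ act (wU U) u = u ⬝ᵥ u - u ⬝ᵥ act U u := by
  have : u ⬝ᵥ act (star U) u = u ⬝ᵥ act U u := by rw [← act_adj, dotProduct_comm]
  simp only [wU, act_sub, act_smul, act_add, act_one, dotProduct_sub, dotProduct_smul, dotProduct_add, this,
    smul_eq_mul]
  ring
lemma w_psd (hU : star U * U = 1) (u : n × ι → ℝ) : 0 ≤ u ⬝ᵥ act (wU U) u := by
  rw [w_form hU]
  have := nn (u - act U u)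
  simp only [sub_dotProduct, dotProduct_sub, iso hU, dotProduct_comm (act U u) u] at this
  linarith

lemma E2q (hU : star U * U = 1) (hU' : U * star U = 1) (hJ : Sc J) (hφ : Sc φ) (hUJ : wU U * J = J * wU U)
    (hs : Sm (1/4) (U * φ - φ * U)) {s b c μ a : ℝ} (h1 : c * c + s * s = 1) (h2 : a * a = μ * μ + b * b)
    (s0 : 0 ≤ s) (b0 : 0 ≤ b) (s1 : s ≤ 1) (b1 : b ≤ 1) (h3 : 0 ≤ c * μ - s * b + a * a) (x : n × ι → ℝ) :
    (3/4) * (x ⬝ᵥ x) ≤ act (s • φ + b • (wU U * J)) x ⬝ᵥ act (s • φ + b • (wU U * J)) x +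
      act (c • 1 + μ • wU U + a • AU U) x ⬝ᵥ act (c • 1 + μ • wU U + a • AU U) x := by
  have ww : ∀ u v, act (wU U) u ⬝ᵥ v = u ⬝ᵥ act (wU U) v := fun u v => by rw [act_adj, wU_sa]
  have AA : ∀ u v, act (AU U) u ⬝ᵥ v = -(u ⬝ᵥ act (AU U) v) := fun u v => by
    rw [act_adj, AU_sk, act_neg, dotProduct_neg]
  have i1 := iso hφ.iso x x
  have i2 : act (wU U) (act J x) ⬝ᵥ act (wU U) (act J x) = act (wU U) x ⬝ᵥ act (wU U) x := by
    rw [← act_mul, hUJ, act_mul, iso hJ.iso]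
  have i3 : act J x ⬝ᵥ act (wU U) (act J x) = x ⬝ᵥ act (wU U) x := by
    rw [← act_mul, hUJ, act_mul, iso hJ.iso]
  have i4 : act (wU U) x ⬝ᵥ act (wU U) x + act (AU U) x ⬝ᵥ act (AU U) x = 2 * (x ⬝ᵥ act (wU U) x) := by
    have := congrArg (fun T => x ⬝ᵥ act T x) (wA_rel hU hU')
    simp only [act_sub, act_smul, dotProduct_sub, dotProduct_smul, act_mul, smul_eq_mul] at this
    rw [ww, AA]; linarith
  have i5 : x ⬝ᵥ act (AU U) x = 0 := by
    have := AA x x; rw [dotProduct_comm] at this; linarith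
  have i6 : act (wU U) x ⬝ᵥ act (AU U) x = 0 := by
    have h := AA x (act (wU U) x)
    rw [← act_mul, ← wA_comm hU hU', act_mul] at h
    rw [dotProduct_comm, ww] at h; rw [ww]; linarith
  have i7 := w_psd hU (act φ x + act J x)
  have i8 : act φ x ⬝ᵥ act (wU U) (act φ x) ≤ x ⬝ᵥ act (wU U) x + (1/4) * (x ⬝ᵥ x) := by
    have := hs.neg (act φ x) x
    rw [act_neg, dotProduct_neg, act_sub, dotProduct_sub, act_mul, act_mul, iso hφ.iso, iso hφ.iso] at this
    rw [w_form hU, w_form hU, iso hφ.iso]; linarith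
  have i9 : act J x ⬝ᵥ act (wU U) (act φ x) = act φ x ⬝ᵥ act (wU U) (act J x) := by
    rw [← ww, dotProduct_comm]
  have p := w_psd hU x
  simp only [act_vadd, dotProduct_add, add_dotProduct, i3, i9] at i7
  have e1 : act (s • φ + b • (wU U * J)) x ⬝ᵥ act (s • φ + b • (wU U * J)) x =
      s * s * (x ⬝ᵥ x) + 2 * (s * b) * (act φ x ⬝ᵥ act (wU U) (act J x)) + b * b * (act (wU U) x ⬝ᵥ act (wU U) x) := by
    simp only [act_add, act_smul, act_mul, dotProduct_add, add_dotProduct, dotProduct_smul, smul_dotProduct,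
      smul_eq_mul, i1, i2, dotProduct_comm (act (wU U) (act J x)) (act φ x)]
    ring
  have e2 : act (c • 1 + μ • wU U + a • AU U) x ⬝ᵥ act (c • 1 + μ • wU U + a • AU U) x =
      c * c * (x ⬝ᵥ x) + μ * μ * (act (wU U) x ⬝ᵥ act (wU U) x) + a * a * (act (AU U) x ⬝ᵥ act (AU U) x)
        + 2 * (c * μ) * (x ⬝ᵥ act (wU U) x) := by
    simp only [act_add, act_smul, act_one, dotProduct_add, add_dotProduct, dotProduct_smul, smul_dotProduct,
      smul_eq_mul, i5, i6, dotProduct_comm (act (AU U) x) x, dotProduct_comm (act (wU U) x) x,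
      dotProduct_comm (act (AU U) x) (act (wU U) x)]
    ring
  rw [e1, e2]
  have hsb : 0 ≤ s * b := mul_nonneg s0 b0
  have hsb1 : s * b ≤ 1 := by nlinarith
  have f1 : -(2 * (x ⬝ᵥ act (wU U) x) + (1/4) * (x ⬝ᵥ x)) ≤ 2 * (act φ x ⬝ᵥ act (wU U) (act J x)) := by linarith
  have f2 := mul_le_mul_of_nonneg_left f1 hsb
  have f3 := mul_nonneg h3 p
  have f4 := mul_le_mul_of_nonneg_right hsb1 (nn x)
  have f5 : b * b * (act (wU U) x ⬝ᵥ act (wU U) x) + μ * μ * (act (wU U) x ⬝ᵥ act (wU U) x) +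
      a * a * (act (AU U) x ⬝ᵥ act (AU U) x) = a * a * (2 * (x ⬝ᵥ act (wU U) x)) := by rw [← i4, h2]; ring
  have f6 : c * c * (x ⬝ᵥ x) + s * s * (x ⬝ᵥ x) = x ⬝ᵥ x := by rw [← add_mul, h1, one_mul]
  linarith

lemma E2 (hU : star U * U = 1) (hU' : U * star U = 1) (hJ : Sc J) (hφ : Sc φ) (hUJ : U * J = J * U)
    (hs : Sm (1/4) (U * φ - φ * U)) {s b c μ a : ℝ} (h1 : c * c + s * s = 1) (h2 : a * a = μ * μ + b * b)
    (s0 : 0 ≤ s) (b0 : 0 ≤ b) (a1 : |a| ≤ 1) (h3 : 0 ≤ c * μ - s * b + a * a) {x y : n × ι → ℝ}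
    (e1 : act (s • φ + b • (wU U * J)) x = act (star (c • 1 + μ • wU U + a • AU U)) y)
    (e2 : act (c • 1 + μ • wU U + a • AU U) x = act (s • φ + b • (wU U * J)) y) : x = 0 ∧ y = 0 := by
  have hUJ' : star U * J = J * star U := by
    have := congrArg star hUJ
    rw [star_mul, star_mul, hJ.skew, neg_mul, mul_neg, neg_inj] at this
    exact this.symm
  have hw : wU U * J = J * wU U := by
    simp only [wU, sub_mul, mul_sub, one_mul, mul_one, smul_mul_assoc, mul_smul_comm, add_mul, mul_add, hUJ, hUJ']
  have hA : AU U * J = J * AU U := by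
    simp only [AU, sub_mul, mul_sub, one_mul, mul_one, smul_mul_assoc, mul_smul_comm, add_mul, mul_add, hUJ, hUJ']
  have a2 : a * a ≤ 1 := by nlinarith [abs_nonneg a, abs_mul_abs_self a]
  have s1 : s ≤ 1 := by nlinarith [mul_self_nonneg c]
  have b1 : b ≤ 1 := by nlinarith [mul_self_nonneg μ]
  have m1 : |μ| ≤ 1 := by
    rw [abs_le]; constructor <;> nlinarith [mul_self_nonneg b]
  have q1 := E2q hU hU' hJ hφ hw hs h1 h2 s0 b0 s1 b1 h3 x
  have q2 := E2q hU hU' hJ hφ hw hs (a := -a) (μ := μ) h1 (by rw [neg_mul_neg]; exact h2) s0 b0 s1 b1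
    (by rw [neg_mul_neg]; exact h3) y
  have hk : star (c • 1 + μ • wU U + a • AU U) = c • 1 + μ • wU U + (-a) • AU U := by
    simp only [star_add, star_smul, star_one, wU_sa, AU_sk, star_trivial]; module
  set k := c • 1 + μ • wU U + a • AU U with hkd
  set R := s • φ + b • (wU U * J) with hRd
  rw [hk] at e1
  set k' := c • 1 + μ • wU U + (-a) • AU U with hk'
  have Rs : ∀ u v, act R u ⬝ᵥ v = -(u ⬝ᵥ act R v) := fun u v => by
    have : star R = -R := by
      rw [hRd]; simp only [star_add, star_smul, star_mul, hφ.skew, hJ.skew, wU_sa, star_trivial, neg_mul]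
      rw [hw]; module
    rw [act_adj, this, act_neg, dotProduct_neg]
  have ks : ∀ u v, act k u ⬝ᵥ v = u ⬝ᵥ act k' v := fun u v => by rw [act_adj, hk]
  have sm : Sm (1/2) (s • (k' * φ - φ * k')) := by
    have hs' := star_comm_small hU hU' hs
    have t1 : Sm (1/4) (wU U * φ - φ * wU U) := by
      have : wU U * φ - φ * wU U = -((1/2 : ℝ) • ((U * φ - φ * U) + (star U * φ - φ * star U))) := by
        simp only [wU, sub_mul, mul_sub, one_mul, mul_one, smul_mul_assoc, mul_smul_comm, add_mul, mul_add]; module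
      rw [this]; exact ((hs.add hs').smul (by norm_num)).neg.mono (by linarith)
    have t2 : Sm (1/4) (AU U * φ - φ * AU U) := by
      have : AU U * φ - φ * AU U = ((1/2 : ℝ) • ((star U * φ - φ * star U) - (U * φ - φ * U))) := by
        simp only [AU, sub_mul, mul_sub, one_mul, mul_one, smul_mul_assoc, mul_smul_comm, add_mul, mul_add]; module
      rw [this]; exact ((hs'.sub hs).smul (by norm_num)).mono (by linarith)
    have : k' * φ - φ * k' = μ • (wU U * φ - φ * wU U) + (-a) • (AU U * φ - φ * AU U) := by
      simp only [hk', add_mul, mul_add, smul_mul_assoc, mul_smul_comm, one_mul, mul_one]; module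
    rw [this]
    refine ((t1.abs.add t2.abs).smul s0).mono ?_
    rw [abs_neg]
    nlinarith [abs_nonneg μ, abs_nonneg a]
  have comm : k' * R - R * k' = s • (k' * φ - φ * k') := by
    have : k' * (wU U * J) = wU U * J * k' := by
      simp only [hk', add_mul, mul_add, smul_mul_assoc, mul_smul_comm, one_mul, mul_one]
      rw [← mul_assoc (AU U), ← wA_comm hU hU', mul_assoc (wU U) (AU U) J, hA, mul_assoc (wU U) J (wU U), ← hw]
      simp only [mul_assoc]
    clear_value k'
    rw [hRd, mul_add, add_mul, mul_smul_comm, smul_mul_assoc, mul_smul_comm, smul_mul_assoc, this]; module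
  rw [← comm] at sm
  have z1 : (act R x - act k' y) ⬝ᵥ (act R x - act k' y) = 0 := by rw [e1]; simp
  have z2 : (act k x - act R y) ⬝ᵥ (act k x - act R y) = 0 := by rw [e2]; simp
  simp only [sub_dotProduct, dotProduct_sub] at z1 z2
  have c1 := dotProduct_comm (act k' y) (act R x)
  have c2 := dotProduct_comm (act R y) (act k x)
  have c3 := sm x y
  rw [act_sub, dotProduct_sub, act_mul, act_mul] at c3
  have c4 := Rs x (act k' y)
  have c5 := ks x (act R y)
  have := nn x
  have := nn y
  have f : (1/4) * (x ⬝ᵥ x) + (1/4) * (y ⬝ᵥ y) ≤ 0 := by linarith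
  exact ⟨nn0 (by linarith), nn0 (by linarith)⟩

lemma Ker {S S' Jx Jy k : MB n ι} (hS : ∀ u, 0 ≤ u ⬝ᵥ act S u) (hS0 : ∀ u, u ⬝ᵥ act S u = 0 → act S u = 0)
    (hS' : ∀ u, 0 ≤ u ⬝ᵥ act S' u) (hS0' : ∀ u, u ⬝ᵥ act S' u = 0 → act S' u = 0)
    (hx : Sc Jx) (hy : Sc Jy) (cx : S * Jx = Jx * S) (cy : S' * Jy = Jy * S') (hk : Jy * k = k * Jx)
    {x y : n × ι → ℝ} (e1 : act (S * Jx) x = act (star k) y) (e2 : act k x = act (S' * Jy) y) :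
    act S x = 0 ∧ act S' y = 0 ∧ act k x = 0 ∧ act (star k) y = 0 := by
  have h1 : act Jx x ⬝ᵥ act S (act Jx x) = - (act Jy y ⬝ᵥ act S' (act Jy y)) := by
    have a1 : act Jx x ⬝ᵥ act S (act Jx x) = act (k * Jx) x ⬝ᵥ y := by
      rw [← act_mul, e1, ← act_adj, act_mul]
    rw [a1, ← hk, act_mul, act_adj, hy.skew, act_neg, dotProduct_neg, e2, act_mul, dotProduct_comm]
  have p1 := hS (act Jx x)
  have p2 := hS' (act Jy y)
  have z1 := hS0 _ (by linarith : act Jx x ⬝ᵥ act S (act Jx x) = 0)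
  have z2 := hS0' _ (by linarith : act Jy y ⬝ᵥ act S' (act Jy y) = 0)
  have inv : ∀ {T : MB n ι}, Sc T → ∀ {v}, act T v = 0 → v = 0 := fun hT v hv => by
    apply nn0; rw [← iso hT.iso, hv]; simp
  refine ⟨inv hx (by rw [← act_mul, ← cx, act_mul, z1]), inv hy (by rw [← act_mul, ← cy, act_mul, z2]), ?_, ?_⟩
  · rw [e2, act_mul, z2]
  · rw [← e1, act_mul, z1]
end E2

section Dop
/-- the doubling builder -/
def Dop (J : Matrix ι ι ℝ) (X k Y : MB n ι) : MB (n ⊕ n) ι :=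
  fromBlocks X (star k * dg n J) (dg n J * k) (dg n J * Y * dg n J)
variable {G : Set (Matrix ι ι ℝ)} {J : Matrix ι ι ℝ} {X Y k : MB n ι}
lemma Dop_sk (hJ : Cx G J) (hX : Sk G X) (hY : Sk G Y) (hk : ∀ g ∈ G, k * dg n g = dg n g * k)
    (hks : ∀ g ∈ G, star k * dg n g = dg n g * star k) :
    Sk G (Dop J X k Y) where
  skew := by
    rw [Dop, star_eq_conjTranspose, fromBlocks_conjTranspose, fromBlocks_neg]
    simp only [← star_eq_conjTranspose, star_mul, star_star, dgs hJ, hX.skew, hY.skew, mul_neg, neg_mul, neg_neg]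
    simp only [mul_assoc]
  anti g hg := by
    have hk' := hks g hg
    rw [← dsum_dg, BottP.dsum, Dop, fromBlocks_multiply, fromBlocks_multiply, fromBlocks_neg]
    have a := dga (m := n) hJ hg
    simp only [mul_zero, zero_mul, add_zero, zero_add, hX.anti g hg, mul_assoc, a, hk g hg, mul_neg]
    congr 1
    · rw [← mul_assoc, hk', mul_assoc]
    · rw [← mul_assoc, a, neg_mul, mul_assoc]
    · rw [← mul_assoc Y, hY.anti g hg, neg_mul, mul_neg, neg_neg, ← mul_assoc, ← mul_assoc, a]; simp [mul_assoc]
lemma act_blocks (A B C D : MB n ι) (v : (n ⊕ n) × ι → ℝ) :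
    (∀ p : n × ι, act (fromBlocks A B C D) v (Sum.inl p.1, p.2) =
      (act A (fun p => v (Sum.inl p.1, p.2)) + act B (fun p => v (Sum.inr p.1, p.2))) p) ∧
    (∀ p : n × ι, act (fromBlocks A B C D) v (Sum.inr p.1, p.2) =
      (act C (fun p => v (Sum.inl p.1, p.2)) + act D (fun p => v (Sum.inr p.1, p.2))) p) := by
  constructor <;> rintro ⟨i, a⟩ <;>
  simp [act, mulVec, dotProduct, Fintype.sum_prod_type, comp_apply]
lemma Dop_unit (hJ : Cx G J)
    (h : ∀ x y : n × ι → ℝ, act X x = act (star k) y → act k x = act Y y → x = 0 ∧ y = 0) :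
    IsUnit (Dop J X k Y) := by
  apply unit_of_act
  intro v hv
  obtain ⟨b1, b2⟩ := act_blocks X (star k * dg n J) (dg n J * k) (dg n J * Y * dg n J) v
  set x : n × ι → ℝ := fun p => v (Sum.inl p.1, p.2) with hx
  set y : n × ι → ℝ := fun p => v (Sum.inr p.1, p.2) with hy
  have jj : ∀ u : n × ι → ℝ, act (dg n J) (act (dg n J) u) = -u := fun u => by
    rw [← act_mul, dgk hJ, act_neg, act_one]
  have c1 : act X x + act (star k * dg n J) y = 0 := by
    funext p; rw [← b1 p]; exact congrFun hv _
  have c2 : act (dg n J * k) x + act (dg n J * Y * dg n J) y = 0 := by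
    funext p; rw [← b2 p]; exact congrFun hv _
  have := h x (-(act (dg n J) y)) (by
    rw [act_vneg, ← act_mul]; exact eq_neg_of_add_eq_zero_left c1) (by
    have := congrArg (act (dg n J)) c2
    rw [act_vadd, act_vzero, act_mul, jj, act_mul, act_mul, jj] at this
    rw [act_vneg]
    have h2 := eq_neg_of_add_eq_zero_left this
    rw [neg_neg] at h2
    rw [← h2, neg_neg])
  obtain ⟨hx0, hy0⟩ := this
  have hy1 : y = 0 := by
    have h3 := congrArg (act (dg n J)) (neg_eq_zero.mp hy0)
    rw [jj, act_vzero] at h3; exact neg_eq_zero.mp h3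
  funext ⟨i, a⟩
  rcases i with i | i
  · exact congrFun hx0 (i, a)
  · exact congrFun hy1 (i, a)
end Dop
end est
end BottP

set_option linter.all false
set_option autoImplicit false
set_option linter.unusedSectionVars false
set_option linter.unusedSimpArgs false
namespace BottP
open Matrix Topology

section lattice
variable {m ι L : Type} [Fintype m] [DecidableEq m] [Fintype ι] [DecidableEq ι] [Fintype L] [DecidableEq L]

def bdg (f : L → MB m ι) : MB (m × L) ι := blockDiagonal f
def shU (m ι : Type) [DecidableEq m] [DecidableEq ι] (σ : Equiv.Perm L) : MB (m × L) ι :=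
  (Equiv.prodCongr (Equiv.refl m) σ).toPEquiv.toMatrix

lemma bdg_mul (f g : L → MB m ι) : bdg f * bdg g = bdg fun j => f j * g j := (blockDiagonal_mul f g).symm
lemma bdg_add (f g : L → MB m ι) : bdg f + bdg g = bdg fun j => f j + g j := (blockDiagonal_add f g).symm
lemma bdg_sub (f g : L → MB m ι) : bdg f - bdg g = bdg fun j => f j - g j := (blockDiagonal_sub f g).symm
lemma bdg_neg (f : L → MB m ι) : - bdg f = bdg fun j => - f j := (blockDiagonal_neg f).symm
lemma bdg_smul (s : ℝ) (f : L → MB m ι) : s • bdg f = bdg fun j => s • f j := (blockDiagonal_smul s f).symm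
lemma bdg_star (f : L → MB m ι) : star (bdg f) = bdg fun j => star (f j) := blockDiagonal_conjTranspose f
lemma bdg_one : bdg (fun _ : L => (1 : MB m ι)) = 1 := blockDiagonal_one
lemma bdg_zero : bdg (fun _ : L => (0 : MB m ι)) = 0 := blockDiagonal_zero
lemma bdg_dg (J : Matrix ι ι ℝ) : bdg (fun _ : L => dg m J) = dg (m × L) J := by
  ext ⟨i, k⟩ ⟨j, l⟩ : 1
  simp only [bdg, blockDiagonal_apply, dg, diagonal_apply, Prod.mk.injEq]
  by_cases h1 : k = l <;> by_cases h2 : i = j <;> simp [h1, h2]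
lemma bdg_cont {Q : Type} [TopologicalSpace Q] {f : Q → L → MB m ι} (hf : ∀ j, Continuous fun q => f q j) :
    Continuous fun q => bdg (f q) := Continuous.matrix_blockDiagonal (continuous_pi hf)

variable (σ : Equiv.Perm L)
lemma shU_mul (X : MB (m × L) ι) : shU m ι σ * X = X.submatrix (Prod.map id σ) id := by
  rw [shU, PEquiv.toMatrix_toPEquiv_mul]; rfl
lemma mul_shU (X : MB (m × L) ι) : X * shU m ι σ = X.submatrix id (Prod.map id σ.symm) := by
  rw [shU, PEquiv.mul_toMatrix_toPEquiv]; rfl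
lemma shU_star : star (shU m ι σ) = shU m ι σ.symm := by
  ext ⟨i, k⟩ ⟨j, l⟩ : 1
  simp only [star_apply, shU, PEquiv.toMatrix_apply, Equiv.toPEquiv_apply, Option.mem_def, Equiv.prodCongr_apply,
    Prod.map_apply, Option.some.injEq, Prod.mk.injEq, Equiv.refl_apply]
  by_cases h : j = i ∧ σ l = k
  · rw [if_pos h, if_pos ⟨h.1.symm, by rw [← h.2]; simp⟩, star_one]
  · rw [if_neg h, if_neg, star_zero]
    rintro ⟨rfl, h2⟩
    exact h ⟨rfl, by rw [← h2]; simp⟩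
lemma shU_l : star (shU m ι σ) * shU m ι σ = 1 := by
  rw [shU_star, shU_mul]
  ext ⟨i, k⟩ ⟨j, l⟩ : 1
  simp only [submatrix_apply, shU, PEquiv.toMatrix_apply, Equiv.toPEquiv_apply, Option.mem_def, Equiv.prodCongr_apply,
    Prod.map_apply, Option.some.injEq, Equiv.refl_apply, id, Equiv.apply_symm_apply]
  simp only [one_apply]
lemma shU_r : shU m ι σ * star (shU m ι σ) = 1 := by
  rw [shU_star, shU_mul]
  ext ⟨i, k⟩ ⟨j, l⟩ : 1
  simp only [submatrix_apply, shU, PEquiv.toMatrix_apply, Equiv.toPEquiv_apply, Option.mem_def, Equiv.prodCongr_apply,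
    Prod.map_apply, Option.some.injEq, Equiv.refl_apply, id, Equiv.symm_apply_apply]
  simp only [one_apply]
lemma shU_bdg (f : L → MB m ι) : shU m ι σ * bdg f = bdg (fun j => f (σ j)) * shU m ι σ := by
  rw [shU_mul, mul_shU]
  ext ⟨i, k⟩ ⟨j, l⟩ : 1
  simp only [submatrix_apply, bdg, blockDiagonal_apply, Prod.map_apply, id, Equiv.eq_symm_apply]
lemma shU_dg (J : Matrix ι ι ℝ) : shU m ι σ * dg (m × L) J = dg (m × L) J * shU m ι σ := by
  rw [← bdg_dg, shU_bdg]

def comp (v : (m × L) × ι → ℝ) (j : L) : m × ι → ℝ := fun p => v ((p.1, j), p.2)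
lemma comp_ext {v w : (m × L) × ι → ℝ} (h : ∀ j, comp v j = comp w j) : v = w := by
  funext ⟨⟨a, j⟩, i⟩; exact congrFun (h j) (a, i)
lemma comp_zero (j : L) : comp (0 : (m × L) × ι → ℝ) j = 0 := rfl
lemma comp_sub (v w : (m × L) × ι → ℝ) (j : L) : comp (v - w) j = comp v j - comp w j := rfl
lemma comp_bdg (f : L → MB m ι) (v : (m × L) × ι → ℝ) (j : L) :
    comp (act (bdg f) v) j = act (f j) (comp v j) := by
  funext ⟨a, i⟩
  simp only [comp, act, mulVec, dotProduct, Fintype.sum_prod_type, compRingEquiv_apply, comp_apply, bdg,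
    blockDiagonal_apply]
  refine Finset.sum_congr rfl fun b _ => ?_
  rw [Finset.sum_eq_single j]
  · simp
  · intro l _ hl; simp [hl.symm]
  · simp
lemma comp_shU (v : (m × L) × ι → ℝ) (j : L) : comp (act (shU m ι σ) v) j = comp v (σ j) := by
  funext ⟨a, i⟩
  simp only [comp, act, mulVec, dotProduct, Fintype.sum_prod_type, compRingEquiv_apply, comp_apply, shU,
    PEquiv.toMatrix_apply, Equiv.toPEquiv_apply, Option.mem_def, Equiv.prodCongr_apply,
    Prod.map_apply, Option.some.injEq, Prod.mk.injEq, Equiv.refl_apply]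
  rw [Finset.sum_eq_single a, Finset.sum_eq_single (σ j), Finset.sum_eq_single i]
  · simp
  · intro b _ hb; simp [hb.symm]
  · simp
  · intro b _ hb; simp [hb.symm]
  · simp
  · intro b _ hb; simp [hb.symm]
  · simp
lemma dot_comp (u v : (m × L) × ι → ℝ) : u ⬝ᵥ v = ∑ j, comp u j ⬝ᵥ comp v j := by
  simp only [dotProduct, Fintype.sum_prod_type, comp]
  rw [Finset.sum_comm]
lemma Sm_bdg {η : ℝ} {f : L → MB m ι} (h : ∀ j, Sm η (f j)) : Sm η (bdg f) := by
  intro u v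
  rw [dot_comp u, dot_comp u u, dot_comp v v, Finset.mul_sum, ← Finset.sum_add_distrib, Finset.mul_sum]
  refine Finset.sum_le_sum fun j _ => ?_
  rw [comp_bdg]; exact h j _ _
lemma Sc_bdg {f : L → MB m ι} (h : ∀ j, Sc (f j)) : Sc (bdg f) where
  skew := by rw [bdg_star, bdg_neg]; congr 1; funext j; exact (h j).skew
  sq := by rw [bdg_mul, ← bdg_one, bdg_neg]; congr 1; funext j; exact (h j).sq
lemma Os_bdg {G : Set (Matrix ι ι ℝ)} {f : L → MB m ι} (h : ∀ j, Os G (f j)) : Os G (bdg f) where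
  skew := (Sc_bdg fun j => ⟨(h j).skew, (h j).sq⟩).skew
  sq := (Sc_bdg fun j => ⟨(h j).skew, (h j).sq⟩).sq
  anti g hg := by
    rw [← bdg_dg, bdg_mul, bdg_mul, bdg_neg]; congr 1; funext j; exact (h j).anti g hg
lemma Sk_bdg {G : Set (Matrix ι ι ℝ)} {f : L → MB m ι} (h : ∀ j, Sk G (f j)) : Sk G (bdg f) where
  skew := by rw [bdg_star, bdg_neg]; congr 1; funext j; exact (h j).skew
  anti g hg := by
    rw [← bdg_dg, bdg_mul, bdg_mul, bdg_neg]; congr 1; funext j; exact (h j).anti g hg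
lemma aM_bdg (f : L → MB m ι) (J : Matrix ι ι ℝ) :
    aM (bdg f) (dg _ J) = bdg fun j => aM (f j) (dg m J) := by
  simp only [aM, ← bdg_dg, bdg_mul, bdg_add, bdg_smul]
lemma dM_bdg (f : L → MB m ι) (J : Matrix ι ι ℝ) :
    dM (bdg f) (dg _ J) = bdg fun j => dM (f j) (dg m J) := by
  simp only [dM, ← bdg_dg, ← bdg_one, bdg_mul, bdg_add, bdg_smul, bdg_sub]

/-- scalar weights -/
def om (m ι : Type) [DecidableEq m] [DecidableEq ι] (ω : L → ℝ) : MB (m × L) ι := bdg fun j => ω j • (1 : MB m ι)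
lemma om_star (ω : L → ℝ) : star (om m ι ω) = om m ι ω := by
  simp only [om, bdg_star, star_smul, star_one, star_trivial]
lemma om_comm (ω : L → ℝ) (f : L → MB m ι) : om m ι ω * bdg f = bdg f * om m ι ω := by
  simp only [om, bdg_mul, smul_mul_assoc, mul_smul_comm, one_mul, mul_one]
lemma om_dg (ω : L → ℝ) (J : Matrix ι ι ℝ) : om m ι ω * dg _ J = dg _ J * om m ι ω := by
  rw [← bdg_dg, om_comm]
lemma comp_om (ω : L → ℝ) (v : (m × L) × ι → ℝ) (j : L) : comp (act (om m ι ω) v) j = ω j • comp v j := by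
  rw [om, comp_bdg, act_smul, act_one]
lemma om_le {ω : L → ℝ} (h : ∀ j, |ω j| ≤ 1) (v : (m × L) × ι → ℝ) :
    act (om m ι ω) v ⬝ᵥ act (om m ι ω) v ≤ v ⬝ᵥ v := by
  rw [dot_comp, dot_comp v]
  refine Finset.sum_le_sum fun j _ => ?_
  rw [comp_om, smul_dotProduct, dotProduct_smul, smul_eq_mul, smul_eq_mul, ← mul_assoc]
  have : ω j * ω j ≤ 1 := by nlinarith [h j, abs_nonneg (ω j), abs_mul_abs_self (ω j)]
  nlinarith [nn (comp v j)]
lemma om_psd {ω : L → ℝ} (h : ∀ j, 0 ≤ ω j) (u : (m × L) × ι → ℝ) : 0 ≤ u ⬝ᵥ act (om m ι ω) u := by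
  rw [dot_comp]
  refine Finset.sum_nonneg fun j _ => ?_
  rw [comp_om, dotProduct_smul, smul_eq_mul]
  exact mul_nonneg (h j) (nn _)
lemma om_psd0 {ω : L → ℝ} (h : ∀ j, 0 ≤ ω j) (u : (m × L) × ι → ℝ) (h0 : u ⬝ᵥ act (om m ι ω) u = 0) :
    act (om m ι ω) u = 0 := by
  rw [dot_comp, Finset.sum_eq_zero_iff_of_nonneg] at h0
  · apply comp_ext; intro j
    have := h0 j (Finset.mem_univ _)
    rw [comp_om, dotProduct_smul, smul_eq_mul] at this
    rw [comp_om, comp_zero]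
    rcases mul_eq_zero.mp this with e | e
    · rw [e, zero_smul]
    · rw [nn0 e, smul_zero]
  · intro j _
    rw [comp_om, dotProduct_smul, smul_eq_mul]
    exact mul_nonneg (h j) (nn _)
end lattice
end BottP

set_option linter.all false
set_option autoImplicit false
set_option linter.unusedSectionVars false
set_option linter.unusedSimpArgs false
namespace BottP
open Matrix Topology

section alp
variable {m ι L : Type} [Fintype m] [DecidableEq m] [Fintype ι] [DecidableEq ι] [Fintype L] [DecidableEq L]
  {G : Set (Matrix ι ι ℝ)} {J J' J₀ J₁ J₂ : Matrix ι ι ℝ}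

lemma Cx.mono {G' : Set (Matrix ι ι ℝ)} (h : Cx G' J) (hG : G ⊆ G') : Cx G J :=
  ⟨h.skew, h.sq, fun g hg => h.anti g (hG hg)⟩
lemma Os.sc {X : MB m ι} (h : Os G X) : Sc X := ⟨h.skew, h.sq⟩
lemma Os.mono {G' : Set (Matrix ι ι ℝ)} {X : MB m ι} (h : Os G' X) (hG : G ⊆ G') : Os G X :=
  ⟨⟨h.skew, fun g hg => h.anti g (hG hg)⟩, h.sq⟩
lemma Sk.mono {G' : Set (Matrix ι ι ℝ)} {X : MB m ι} (h : Sk G' X) (hG : G ⊆ G') : Sk G X :=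
  ⟨h.skew, fun g hg => h.anti g (hG hg)⟩
lemma GLs.mono {G' : Set (Matrix ι ι ℝ)} {X : MB m ι} (h : GLs G' X) (hG : G ⊆ G') : GLs G X :=
  ⟨h.toSk.mono hG, h.unit⟩

lemma anti3 {X J g : MB m ι} (hX : X * g = -(g * X)) (hJ : J * g = -(g * J)) :
    J * X * J * g = -(g * (J * X * J)) := by
  rw [mul_assoc, hJ, mul_neg, ← mul_assoc, mul_assoc J X g, hX, mul_neg, ← mul_assoc, hJ]
  simp [mul_assoc]
lemma comm2 {X J g : MB m ι} (hX : X * g = -(g * X)) (hJ : J * g = -(g * J)) :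
    X * J * g = g * (X * J) := by
  rw [mul_assoc, hJ, mul_neg, ← mul_assoc, hX]; simp [mul_assoc]

lemma aM_sk {F : MB m ι} (c : Cx G J) (hF : Os G F) : Sk (insert J G) (aM F (dg m J)) where
  skew := aM_skew hF.sc (c.os.sc)
  anti g hg := by
    rcases hg with rfl | hg
    · simp only [aM, smul_mul_assoc, mul_smul_comm, ← smul_neg, add_mul, mul_add]
      rw [mul_assoc _ _ (dg m g), dgk c, ← mul_assoc (dg m g), ← mul_assoc (dg m g), dgk c]
      congr 1; simp
    · simp only [aM, smul_mul_assoc, mul_smul_comm, ← smul_neg, add_mul, mul_add, hF.anti g hg,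
        anti3 (hF.anti g hg) (c.os.anti g hg)]
      congr 1; abel
lemma dM_comm {F : MB m ι} (c : Cx G J) (hF : Os G F) {g : Matrix ι ι ℝ} (hg : g ∈ insert J G) :
    dM F (dg m J) * dg m g = dg m g * dM F (dg m J) := by
  rcases hg with rfl | hg
  · simp only [dM, sub_mul, mul_sub, one_mul, mul_one, smul_mul_assoc, mul_smul_comm, add_mul, mul_add]
    congr 2
    rw [mul_assoc F, dgk c, ← mul_assoc (dg m g) (dg m g), dgk c, mul_assoc]; simp [add_comm]
  · simp only [dM, sub_mul, mul_sub, one_mul, mul_one, smul_mul_assoc, mul_smul_comm, add_mul, mul_add,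
        comm2 (hF.anti g hg) (c.os.anti g hg), comm2 (c.os.anti g hg) (hF.anti g hg)]

/-- the lattice map -/
def alp (σ : Equiv.Perm L) (J₀ J₁ : Matrix ι ι ℝ) (ω : L → ℝ) (f : L → MB m ι) : MB ((m × L) ⊕ (m × L)) ι :=
  Dop J₁ (aM (bdg f) (dg _ J₀)) (dM (bdg f) (dg _ J₀) - om m ι ω * shU m ι σ) (aM (bdg f) (dg _ J₀))

lemma omU_comm (σ : Equiv.Perm L) (ω : L → ℝ) (g : Matrix ι ι ℝ) :
    om m ι ω * shU m ι σ * dg _ g = dg _ g * (om m ι ω * shU m ι σ) := by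
  rw [mul_assoc, shU_dg, ← mul_assoc, om_dg, mul_assoc]
lemma omU_comm' (σ : Equiv.Perm L) (ω : L → ℝ) (g : Matrix ι ι ℝ) :
    star (om m ι ω * shU m ι σ) * dg _ g = dg _ g * star (om m ι ω * shU m ι σ) := by
  rw [star_mul, om_star, shU_star, mul_assoc, om_dg, ← mul_assoc, shU_dg, mul_assoc]

lemma alp_sk (σ : Equiv.Perm L) (ω : L → ℝ) (c : Cx G J₀) (c1 : Cx (insert J₀ G) J₁) {f : L → MB m ι}
    (hf : ∀ j, Os G (f j)) : Sk (insert J₀ G) (alp σ J₀ J₁ ω f) := by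
  have hF := Os_bdg hf
  refine Dop_sk c1 (aM_sk c hF) (aM_sk c hF) ?_ ?_
  · intro g hg
    rw [sub_mul, mul_sub, dM_comm c hF hg, omU_comm]
  · intro g hg
    rw [star_sub, sub_mul, mul_sub, dM_sa hF.sc c.os.sc, dM_comm c hF hg, omU_comm']

lemma alp_gls (σ : Equiv.Perm L) {ω : L → ℝ} (c : Cx G J₀) (c1 : Cx (insert J₀ G) J₁) {f : L → MB m ι}
    (hf : ∀ j, Os G (f j)) (hω : ∀ j, |ω j| ≤ 1) (hd : ∀ j, ω j = 1 ∨ dM (f j) (dg m J₀) = (2:ℝ) • 1)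
    (hs : ∀ j, Sm (1/4) (f (σ j) - f j)) : GLs (insert J₀ G) (alp σ J₀ J₁ ω f) := by
  refine ⟨alp_sk σ ω c c1 hf, Dop_unit c1 fun x y e1 e2 => ?_⟩
  refine E1 (Os_bdg hf).sc (Cx.os c).sc (shU_l σ) (shU_r σ) (shU_dg σ _) (om_star ω) (om_comm ω f) (om_dg ω _)
    (om_le hω) ?_ ?_ e1 e2
  · rw [dM_bdg, ← bdg_one, bdg_smul, bdg_sub, om, bdg_mul, bdg_mul]
    congr 1; funext j
    rcases hd j with h | h
    · rw [h]; simp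
    · rw [h]; simp
  · rw [shU_bdg, ← sub_mul, bdg_sub]
    exact (Sm_bdg hs).mr (shU_l σ)

lemma Dop_cont {n : Type} [Fintype n] [DecidableEq n] {Q : Type} [TopologicalSpace Q] {X k Y : Q → MB n ι}
    (hX : Continuous X) (hk : Continuous k) (hY : Continuous Y) : Continuous fun q => Dop J (X q) (k q) (Y q) := by
  refine Continuous.matrix_fromBlocks hX ?_ ?_ ?_
  · exact hk.star.mul continuous_const
  · exact continuous_const.mul hk
  · exact (continuous_const.mul hY).mul continuous_const
lemma om_cont {Q : Type} [TopologicalSpace Q] {ω : Q → L → ℝ} (hω : ∀ j, Continuous fun q => ω q j) :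
    Continuous fun q => om m ι (ω q) :=
  bdg_cont fun j => (hω j).smul continuous_const
lemma alp_cont (σ : Equiv.Perm L) {Q : Type} [TopologicalSpace Q] {ω : Q → L → ℝ} {f : Q → L → MB m ι}
    (hω : ∀ j, Continuous fun q => ω q j) (hf : ∀ j, Continuous fun q => f q j) :
    Continuous fun q => alp σ J₀ J₁ (ω q) (f q) := by
  have h := bdg_cont hf
  have ha : Continuous fun q => aM (bdg (f q)) (dg _ J₀) := by
    unfold aM; exact (h.add ((continuous_const.mul h).mul continuous_const)).const_smul (1/2 : ℝ)
  have hU : Continuous fun q => om m ι (ω q) * shU m ι σ := (om_cont (m := m) (ι := ι) hω).mul continuous_const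
  refine Dop_cont ha (Continuous.sub ?_ hU) ha
  unfold dM; exact continuous_const.sub (((h.mul continuous_const).add (continuous_const.mul h)).const_smul (1/2 : ℝ))
end alp

section fine
variable {m ι : Type} [Fintype m] [DecidableEq m] [Fintype ι] [DecidableEq ι]
def pt (N : ℕ) [NeZero N] (j : Fin N) : unitInterval := ⟨(j : ℝ) / N, by positivity, by
  rw [div_le_one (by exact_mod_cast Nat.pos_of_ne_zero (NeZero.ne N))]; exact_mod_cast j.2.le⟩
def cyc (N : ℕ) [NeZero N] : Equiv.Perm (Fin N) := Equiv.addRight 1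
lemma cyc_val (N : ℕ) [NeZero N] (j : Fin N) (h : j.val + 1 < N) : (cyc N j).val = j.val + 1 := by
  simp [cyc, Fin.val_add, Nat.mod_eq_of_lt h]
lemma cyc_last (N : ℕ) [NeZero N] (j : Fin N) (h : j.val + 1 = N) : cyc N j = 0 := by
  apply Fin.ext; simp [cyc, Fin.val_add, h]
lemma fine {Q : Type} [PseudoMetricSpace Q] [CompactSpace Q] {f : Q × unitInterval → MB m ι} (hf : Continuous f)
    (hp : ∀ q, f (q, 0) = f (q, 1)) {η : ℝ} (hη : 0 < η) :
    ∃ N₀ : ℕ, ∀ N [NeZero N], N₀ ≤ N → ∀ q (j : Fin N), Sm η (f (q, pt N (cyc N j)) - f (q, pt N j)) := by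
  let φ : Q × unitInterval → (m × ι) → (m × ι) → ℝ := fun z => fl (f z)
  have hφ : Continuous φ := fl_cont.comp hf
  have hu := CompactSpace.uniformContinuous_of_continuous hφ
  obtain ⟨δ, hδ, H⟩ := Metric.uniformContinuous_iff.mp hu (η / (Fintype.card (m × ι) + 1)) (by positivity)
  obtain ⟨N₀, hN₀⟩ := exists_nat_gt (1 / δ)
  refine ⟨N₀, fun N _ hN q j => ?_⟩
  have Npos : (0:ℝ) < N := by exact_mod_cast Nat.pos_of_ne_zero (NeZero.ne N)
  have hN' : (1:ℝ) / N < δ := by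
    rw [div_lt_iff₀ Npos]; rw [div_lt_iff₀ hδ] at hN₀
    have : (N₀ : ℝ) ≤ N := by exact_mod_cast hN
    nlinarith
  have main : ∀ y : unitInterval, |(y : ℝ) - pt N j| = 1 / N → Sm η (f (q, y) - f (q, pt N j)) := by
    intro y hy
    have h1 : dist (φ (q, y)) (φ (q, pt N j)) < η / (Fintype.card (m × ι) + 1) := by
      apply H
      rw [Prod.dist_eq, dist_self, max_lt_iff]
      refine ⟨hδ, ?_⟩
      rw [Subtype.dist_eq, Real.dist_eq, hy]; exact hN'
    refine (Sm_entries (ε := η / (Fintype.card (m × ι) + 1)) ?_).mono ?_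
    · intro i k
      have : |φ (q, y) i k - φ (q, pt N j) i k| ≤ dist (φ (q, y)) (φ (q, pt N j)) := by
        rw [← Real.dist_eq]
        exact (dist_le_pi_dist _ _ k).trans (dist_le_pi_dist (φ (q, y)) _ i)
      rw [map_sub]
      exact this.trans h1.le
    · rw [div_mul_eq_mul_div, div_le_iff₀ (by positivity)]
      nlinarith
  rcases Nat.lt_or_ge (j.val + 1) N with h | h
  · apply main
    simp only [pt, cyc_val N j h]
    rw [← sub_div]; push_cast; rw [add_sub_cancel_left, abs_of_pos (by positivity)]
  · have h2 : j.val + 1 = N := le_antisymm j.2 h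
    have h3 : pt N (cyc N j) = 0 := by rw [cyc_last N j h2]; apply Subtype.ext; simp [pt]
    rw [h3, hp]
    apply main
    simp only [pt, Set.Icc.coe_one]
    have : (N:ℝ) = j.val + 1 := by exact_mod_cast h2.symm
    rw [one_sub_div Npos.ne', this, add_sub_cancel_left, abs_of_pos (by positivity)]
end fine
end BottP

set_option linter.all false
set_option autoImplicit false
set_option linter.unusedSectionVars false
set_option linter.unusedSimpArgs false
namespace BottP
open Matrix Topology

section scal
def psi (x : ℝ) : ℝ := 2 * Real.pi * max 0 (min 1 (2 * x - 1/2))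
def cC (x : ℝ) : ℝ := Real.cos (psi x)
def sP (x : ℝ) : ℝ := max (Real.sin (psi x)) 0
def sM (x : ℝ) : ℝ := max (-Real.sin (psi x)) 0
def th (x : ℝ) : ℝ := min (psi x) (2 * Real.pi - psi x)
lemma psi_cont : Continuous psi := by unfold psi; fun_prop
lemma cC_cont : Continuous cC := Real.continuous_cos.comp psi_cont
lemma sP_cont : Continuous sP := (Real.continuous_sin.comp psi_cont).max continuous_const
lemma sM_cont : Continuous sM := (Real.continuous_sin.comp psi_cont).neg.max continuous_const
lemma th_cont : Continuous th := by unfold th; exact psi_cont.min (continuous_const.sub psi_cont)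
lemma sP0 (x : ℝ) : 0 ≤ sP x := le_max_right _ _
lemma sM0 (x : ℝ) : 0 ≤ sM x := le_max_right _ _
lemma sPM (x : ℝ) : sP x * sM x = 0 := by
  rcases le_total 0 (Real.sin (psi x)) with h | h
  · rw [show sM x = 0 from max_eq_right (by linarith)]; simp
  · rw [show sP x = 0 from max_eq_right (by linarith)]; simp
lemma sAbs (x : ℝ) : sP x + sM x = |Real.sin (psi x)| := by
  rcases le_total 0 (Real.sin (psi x)) with h | h
  · rw [show sM x = 0 from max_eq_right (by linarith), show sP x = _ from max_eq_left h, abs_of_nonneg h]; simp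
  · rw [show sP x = 0 from max_eq_right (by linarith), show sM x = _ from max_eq_left (by linarith), abs_of_nonpos h]; simp
lemma cs2 (x : ℝ) : cC x * cC x + sP x * sP x + sM x * sM x = 1 := by
  have h1 := sPM x
  have h2 := sAbs x
  have h3 := Real.sin_sq_add_cos_sq (psi x)
  have h4 : (sP x + sM x)^2 = Real.sin (psi x)^2 := by rw [h2, sq_abs]
  unfold cC; nlinarith
lemma psi_rng (x : ℝ) : 0 ≤ psi x ∧ psi x ≤ 2 * Real.pi := by
  have := Real.pi_pos
  have h1 : 0 ≤ max 0 (min 1 (2 * x - 1/2)) := le_max_left _ _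
  have h2 : max 0 (min 1 (2 * x - 1/2)) ≤ 1 := max_le zero_le_one (min_le_left _ _)
  unfold psi
  constructor
  · positivity
  · nlinarith
lemma th_cos (x : ℝ) : Real.cos (th x) = cC x := by
  unfold th cC
  rcases min_choice (psi x) (2 * Real.pi - psi x) with h | h <;> rw [h]
  rw [Real.cos_two_pi_sub]
lemma th_sin (x : ℝ) : Real.sin (th x) = sP x + sM x := by
  rw [sAbs]
  have h0 : 0 ≤ Real.sin (th x) := by
    have := psi_rng x
    apply Real.sin_nonneg_of_nonneg_of_le_pi
    · exact le_min this.1 (by linarith)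
    · unfold th
      rcases le_total (psi x) Real.pi with h | h
      · exact (min_le_left _ _).trans h
      · exact (min_le_right _ _).trans (by linarith)
  rw [← abs_of_nonneg h0]
  unfold th
  rcases min_choice (psi x) (2 * Real.pi - psi x) with h | h <;> rw [h]
  rw [Real.sin_two_pi_sub, abs_neg]
lemma psi_lo {x : ℝ} (h : x ≤ 1/4) : psi x = 0 := by
  unfold psi
  rw [max_eq_left]; · simp
  exact (min_le_right _ _).trans (by linarith)
lemma psi_hi {x : ℝ} (h : 3/4 ≤ x) : psi x = 2 * Real.pi := by
  unfold psi
  rw [min_eq_left (by linarith), max_eq_right zero_le_one, mul_one]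
lemma psi_mid {x : ℝ} (h : 1/4 ≤ x) (h' : x ≤ 3/4) : psi x = 2 * Real.pi * (2 * x - 1/2) := by
  unfold psi
  rw [min_eq_right (by linarith), max_eq_right (by linarith)]
lemma end_vals {x : ℝ} (h : x ≤ 1/4 ∨ 3/4 ≤ x) : cC x = 1 ∧ sP x = 0 ∧ sM x = 0 ∧ th x = 0 := by
  have hp := Real.pi_pos
  rcases h with h | h
  · unfold cC sP sM th; rw [psi_lo h]; simp [hp.le]
  · unfold cC sP sM th; rw [psi_hi h]; simp [hp.le]
lemma d_ne {x : ℝ} (h : x ≠ 1/2) : 1 + cC x ≠ 0 := by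
  have hp := Real.pi_pos
  intro h0
  have h1 : Real.cos (psi x) = -1 := by unfold cC at h0; linarith
  have h2 : Real.cos (psi x - Real.pi) = 1 := by rw [Real.cos_sub_pi, h1, neg_neg]
  have h3 := psi_rng x
  rw [Real.cos_eq_one_iff_of_lt_of_lt (by linarith) (by linarith)] at h2
  rcases le_total x (1/4) with h4 | h4
  · rw [psi_lo h4] at h2; linarith
  rcases le_total (3/4) x with h5 | h5
  · rw [psi_hi h5] at h2; linarith
  rw [psi_mid h4 h5] at h2
  apply h; nlinarith
lemma sP_pos {x : ℝ} (h : 1/4 < x) (h' : x < 1/2) : 0 < sP x := by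
  have hp := Real.pi_pos
  refine lt_max_of_lt_left ?_
  rw [psi_mid h.le (by linarith)]
  apply Real.sin_pos_of_pos_of_lt_pi <;> nlinarith
lemma sM_pos {x : ℝ} (h : 1/2 < x) (h' : x < 3/4) : 0 < sM x := by
  have hp := Real.pi_pos
  refine lt_max_of_lt_left ?_
  rw [psi_mid (by linarith) h'.le, ← Real.sin_sub_pi]
  rw [show 2 * Real.pi * (2 * x - 1/2) - Real.pi = Real.pi * (4 * x - 2) by ring]
  apply Real.sin_pos_of_pos_of_lt_pi <;> nlinarith
lemma sM_zero {x : ℝ} (h' : x ≤ 1/2) : sM x = 0 := by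
  have hp := Real.pi_pos
  rcases le_total x (1/4) with h4 | h4
  · exact (end_vals (Or.inl h4)).2.2.1
  apply max_eq_right
  rw [psi_mid h4 (by linarith)]
  have : 0 ≤ Real.sin (2 * Real.pi * (2 * x - 1/2)) := by
    apply Real.sin_nonneg_of_nonneg_of_le_pi <;> nlinarith
  linarith
lemma sP_zero {x : ℝ} (h : 1/2 ≤ x) : sP x = 0 := by
  have hp := Real.pi_pos
  rcases le_total (3/4) x with h4 | h4
  · exact (end_vals (Or.inr h4)).2.1
  apply max_eq_right
  rw [psi_mid (by linarith) h4]
  have : 0 ≤ Real.sin (2 * Real.pi * (2 * x - 1/2) - Real.pi) := by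
    apply Real.sin_nonneg_of_nonneg_of_le_pi <;> nlinarith
  rw [Real.sin_sub_pi] at this
  linarith
end scal

section bet
variable {m m' a ι : Type} [Fintype m] [DecidableEq m] [Fintype ι] [DecidableEq ι] [Fintype m'] [DecidableEq m']
  [Fintype a] [DecidableEq a]
  {G : Set (Matrix ι ι ℝ)} {J₀ J₁ J₂ : Matrix ι ι ℝ}

def bcl (J₀ J₁ : Matrix ι ι ℝ) (g : MB m ι) (x : ℝ) : MB m ι := cC x • dg m J₀ + sP x • g + sM x • dg m J₁
def Gr (m : Type) [DecidableEq m] (J₀ J₁ : Matrix ι ι ℝ) (θ : ℝ) : MB m ι :=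
  Real.cos (θ/2) • 1 + Real.sin (θ/2) • dg m (J₁ * J₀)
def bb (J₀ J₁ : Matrix ι ι ℝ) (l : ℝ) (g : MB m ι) (x : ℝ) : MB m ι :=
  Gr m J₀ J₁ (l * th x) * bcl J₀ J₁ g x * star (Gr m J₀ J₁ (l * th x))

lemma bcl_os (c0 : Cx G J₀) (c1 : Cx (insert J₀ G) J₁) {g : MB m ι} (hg : Os (insert J₀ G) g) (x : ℝ) :
    Os G (bcl J₀ J₁ g x) where
  skew := by
    simp only [bcl, star_add, star_smul, star_trivial, c0.os.skew, hg.skew, c1.os.skew]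
    module
  anti b hb := by
    simp only [bcl, add_mul, mul_add, smul_mul_assoc, mul_smul_comm, (c0.os (m := m)).anti b hb,
      hg.anti b (by simp [hb]), (c1.os (m := m)).anti b (by simp [hb])]
    module
  sq := by
    have h1 : dg m J₁ * dg m J₀ = -(dg m J₀ * dg m J₁) := (c1.os (m := m)).anti J₀ (by simp)
    have h2 := hg.anti J₀ (by simp)
    have h3 : sP x * sM x = 0 := sPM x
    have h3' : sM x * sP x = 0 := by rw [mul_comm]; exact h3
    simp only [bcl, add_mul, mul_add, smul_mul_assoc, mul_smul_comm, smul_smul, h1, h2, hg.sq,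
      (c0.os (m := m)).sq, (c1.os (m := m)).sq, h3, h3', zero_smul]
    have := cs2 x
    calc _ = -(cC x * cC x + sP x * sP x + sM x * sM x) • (1 : MB m ι) := by
          rcases mul_eq_zero.mp h3 with h | h
          · simp only [h]; module
          · simp only [h]; module
      _ = -1 := by rw [this]; simp

lemma bcl_aM (c0 : Cx G J₀) (c1 : Cx (insert J₀ G) J₁) {g : MB m ι} (hg : Os (insert J₀ G) g) (x : ℝ) :
    aM (bcl J₀ J₁ g x) (dg m J₀) = sP x • g + sM x • dg m J₁ := by
  have h1 : dg m J₁ * dg m J₀ = -(dg m J₀ * dg m J₁) := (c1.os (m := m)).anti J₀ (by simp)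
  have h2 := hg.anti J₀ (by simp)
  have h0 := (c0.os (m := m)).sq
  simp only [aM, bcl, add_mul, mul_add, smul_mul_assoc, mul_smul_comm, mul_assoc, h1, h2, h0, mul_neg]
  simp only [← mul_assoc, h0]
  simp
  module
lemma bcl_dM (c0 : Cx G J₀) (c1 : Cx (insert J₀ G) J₁) {g : MB m ι} (hg : Os (insert J₀ G) g) (x : ℝ) :
    dM (bcl J₀ J₁ g x) (dg m J₀) = (1 + cC x) • 1 := by
  have h1 : dg m J₁ * dg m J₀ = -(dg m J₀ * dg m J₁) := (c1.os (m := m)).anti J₀ (by simp)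
  have h2 := hg.anti J₀ (by simp)
  have h0 := (c0.os (m := m)).sq
  simp only [dM, bcl, add_mul, mul_add, smul_mul_assoc, mul_smul_comm, mul_assoc, h1, h2, h0, mul_neg]
  module

lemma Krel (c0 : Cx G J₀) (c1 : Cx (insert J₀ G) J₁) :
    star (J₁ * J₀) = -(J₁ * J₀) ∧ (J₁ * J₀) * (J₁ * J₀) = -1 ∧ J₀ * (J₁ * J₀) = J₁ ∧ (J₁ * J₀) * J₀ = -J₁ ∧
    J₁ * (J₁ * J₀) = -J₀ ∧ (J₁ * J₀) * J₁ = J₀ := by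
  have h1 := c1.anti J₀ (by simp)
  have h1' : J₀ * J₁ = -(J₁ * J₀) := by rw [h1, neg_neg]
  refine ⟨?_, ?_, ?_, ?_, ?_, ?_⟩
  · rw [star_mul, c0.skew, c1.skew, neg_mul_neg, h1']
  · rw [mul_assoc, ← mul_assoc J₀, h1', neg_mul, mul_assoc, c0.sq]; simp [c1.sq]
  · rw [← mul_assoc, h1', neg_mul, mul_assoc, c0.sq]; simp
  · rw [mul_assoc, c0.sq]; simp
  · rw [← mul_assoc, c1.sq]; simp
  · rw [mul_assoc, h1', mul_neg, ← mul_assoc, c1.sq]; simp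
lemma Gr_un (c0 : Cx G J₀) (c1 : Cx (insert J₀ G) J₁) (θ : ℝ) : Un G (Gr m J₀ J₁ θ) := by
  obtain ⟨k1, k2, -⟩ := Krel c0 c1
  have K1 : star (dg m (J₁ * J₀)) = - dg m (J₁ * J₀) := by rw [dg_star, k1, dg_neg]
  have K2 : dg m (J₁ * J₀) * dg m (J₁ * J₀) = -1 := by rw [← dg_mul, k2, dg_neg, dg_one]
  have h := cs1 (m := m) (ι := ι) (θ/2)
  refine ⟨?_, ?_, fun g hg => ?_⟩
  · simp only [Gr, star_add, star_smul, star_trivial, star_one, K1, add_mul, mul_add, smul_mul_assoc, mul_smul_comm,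
      neg_mul, K2, one_mul, mul_one]
    refine Eq.trans ?_ h; module
  · simp only [Gr, star_add, star_smul, star_trivial, star_one, K1, add_mul, mul_add, smul_mul_assoc, mul_smul_comm,
      neg_mul, mul_neg, K2, one_mul, mul_one]
    refine Eq.trans ?_ h; module
  · simp only [Gr, add_mul, mul_add, smul_mul_assoc, mul_smul_comm, one_mul, mul_one]
    rw [dg_mul, comm2 ((c1.os (m := m)).anti g (by simp [hg])) ((c0.os (m := m)).anti g hg)]
lemma Gr_cont : Continuous (Gr m J₀ J₁) := by unfold Gr; fun_prop
lemma Gr_zero : Gr m J₀ J₁ 0 = 1 := by simp [Gr]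
lemma bb_os (c0 : Cx G J₀) (c1 : Cx (insert J₀ G) J₁) {g : MB m ι} (hg : Os (insert J₀ G) g) (l x : ℝ) :
    Os G (bb J₀ J₁ l g x) := (Gr_un c0 c1 _).conj (bcl_os c0 c1 hg x)
lemma bb_zero (g : MB m ι) (x : ℝ) : bb J₀ J₁ 0 g x = bcl J₀ J₁ g x := by simp [bb, Gr_zero]
lemma bb_end (l : ℝ) (g : MB m ι) {x : ℝ} (h : x ≤ 1/4 ∨ 3/4 ≤ x) : bb J₀ J₁ l g x = dg m J₀ := by
  obtain ⟨h1, h2, h3, h4⟩ := end_vals h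
  simp [bb, bcl, h1, h2, h3, h4, Gr_zero]
lemma bb_J (c0 : Cx G J₀) (c1 : Cx (insert J₀ G) J₁) (x : ℝ) : bb J₀ J₁ 1 (dg m J₁) x = dg m J₀ := by
  obtain ⟨k1, k2, k3, k4, k5, k6⟩ := Krel c0 c1
  have hb : bcl J₀ J₁ (dg m J₁) x = Real.cos (th x) • dg m J₀ + Real.sin (th x) • dg m J₁ := by
    rw [th_cos, th_sin, bcl, add_smul, add_assoc]
  rw [bb, hb, one_mul]
  simp only [Gr, star_add, star_smul, star_trivial, star_one, dg_star, k1, add_mul, mul_add, smul_mul_assoc,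
    mul_smul_comm, one_mul, mul_one, dg_neg, mul_neg, ← dg_mul, k3, k4, k5, k6, neg_mul, neg_neg]
  have e1 : Real.cos (th x) = Real.cos (th x / 2)^2 - Real.sin (th x / 2)^2 := by
    have := Real.cos_two_mul (th x / 2)
    rw [mul_div_cancel₀ _ (two_ne_zero)] at this
    rw [this]; nlinarith [Real.sin_sq_add_cos_sq (th x / 2)]
  have e2 : Real.sin (th x) = 2 * Real.sin (th x / 2) * Real.cos (th x / 2) := by
    have := Real.sin_two_mul (th x / 2)
    rwa [mul_div_cancel₀ _ (two_ne_zero)] at this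
  have e3 := Real.sin_sq_add_cos_sq (th x / 2)
  set C := Real.cos (th x / 2)
  set S := Real.sin (th x / 2)
  rw [e1, e2]
  have e4 : (S^2 + C^2)*(S^2+C^2) = 1 := by rw [e3]; norm_num
  calc _ = ((S^2 + C^2)*(S^2+C^2)) • dg m J₀ := by module
    _ = _ := by rw [e4, one_smul]
lemma bbC {Q : Type} [TopologicalSpace Q] {l x : Q → ℝ} {g : Q → MB m ι} (hl : Continuous l) (hg : Continuous g)
    (hx : Continuous x) : Continuous fun q => bb J₀ J₁ (l q) (g q) (x q) := by
  have h1 : Continuous fun q => Gr m J₀ J₁ (l q * th (x q)) := Gr_cont.comp (hl.mul (th_cont.comp hx))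
  have h2 : Continuous fun q => bcl J₀ J₁ (g q) (x q) := by
    have a1 : Continuous fun q => cC (x q) := cC_cont.comp hx
    have a2 : Continuous fun q => sP (x q) := sP_cont.comp hx
    have a3 : Continuous fun q => sM (x q) := sM_cont.comp hx
    unfold bcl
    exact ((a1.smul continuous_const).add (a2.smul hg)).add (a3.smul continuous_const)
  exact (h1.mul h2).mul h1.star
lemma Gr_rx (e : m ≃ m') (θ : ℝ) : rx e (Gr m J₀ J₁ θ) = Gr m' J₀ J₁ θ := by
  simp only [Gr, rx_add, rx_smul, rx_one, rx_dg]
lemma Gr_dsum (θ : ℝ) : dsum (Gr m J₀ J₁ θ) (Gr a J₀ J₁ θ) = Gr (m ⊕ a) J₀ J₁ θ := by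
  simp only [Gr, ← dsum_add, ← dsum_smul, dsum_one, dsum_dg]
lemma bb_rx (e : m ≃ m') (l : ℝ) (g : MB m ι) (x : ℝ) : bb J₀ J₁ l (rx e g) x = rx e (bb J₀ J₁ l g x) := by
  simp only [bb, bcl, rx_mul, rx_add, rx_smul, rx_star, Gr_rx, rx_dg]
lemma bb_dsum (l : ℝ) (g : MB m ι) (g' : MB a ι) (x : ℝ) :
    bb J₀ J₁ l (dsum g g') x = dsum (bb J₀ J₁ l g x) (bb J₀ J₁ l g' x) := by
  simp only [bb, bcl, ← dsum_mul, ← dsum_add, ← dsum_smul, ← dsum_star, Gr_dsum, dsum_dg]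
end bet
end BottP

set_option linter.all false
set_option autoImplicit false
set_option linter.unusedSectionVars false
set_option linter.unusedSimpArgs false
namespace BottP
open Matrix Topology

section recs
variable {V : Type} [AddCommGroup V] [Module ℝ V]
lemma rec1 {N i0 : ℕ} {d : ℕ → ℝ} {X : ℕ → V} (h : ∀ i, i + 1 < N → X (i+1) = d i • X i) (h0 : i0 < N)
    (hX : X i0 = 0) (hd : ∀ i < i0, d i ≠ 0) : ∀ i < N, X i = 0 := by
  have up : ∀ k, i0 + k < N → X (i0 + k) = 0 := by
    intro k
    induction k with
    | zero => intro _; exact hX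
    | succ k ih => intro hk; rw [← add_assoc, h _ (by omega), ih (by omega), smul_zero]
  have dn : ∀ k, k ≤ i0 → X (i0 - k) = 0 := by
    intro k
    induction k with
    | zero => intro _; exact hX
    | succ k ih =>
      intro hk
      have e := h (i0 - (k+1)) (by omega)
      rw [show i0 - (k+1) + 1 = i0 - k by omega, ih (by omega)] at e
      exact (smul_eq_zero.mp e.symm).resolve_left (hd _ (by omega))
  intro i hi
  rcases le_total i0 i with g | g
  · have := up (i - i0) (by omega); rwa [show i0 + (i - i0) = i by omega] at this
  · have := dn (i0 - i) (by omega); rwa [show i0 - (i0 - i) = i by omega] at this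
lemma rec2 {N i0 : ℕ} {d : ℕ → ℝ} {X : ℕ → V} (h : ∀ i, i + 1 < N → X i = d (i+1) • X (i+1)) (h0 : i0 < N)
    (hX : X i0 = 0) (hd : ∀ i, i0 < i → i < N → d i ≠ 0) : ∀ i < N, X i = 0 := by
  have := rec1 (N := N) (i0 := N - 1 - i0) (d := fun i => d (N - 1 - i)) (X := fun i => X (N - 1 - i))
    (fun i hi => by
      have := h (N - 1 - (i+1)) (by omega)
      rw [this, show N - 1 - (i+1) + 1 = N - 1 - i by omega]) (by omega)
    (by rw [show N - 1 - (N - 1 - i0) = i0 by omega]; exact hX) (fun i hi => hd _ (by omega) (by omega))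
  intro i hi
  have h2 := this (N - 1 - i) (by omega)
  rwa [show N - 1 - (N - 1 - i) = i by omega] at h2
end recs

lemma cC_half : 1 + cC (1/2) = 0 := by
  unfold cC; rw [psi_mid (by norm_num) (by norm_num), show 2 * Real.pi * (2 * (1/2) - 1/2) = Real.pi by ring, Real.cos_pi]; norm_num

section stage
variable {m ι : Type} [Fintype m] [DecidableEq m] [Fintype ι] [DecidableEq ι]
  {G : Set (Matrix ι ι ℝ)} {J₀ J₁ J₂ : Matrix ι ι ℝ}

def cutw (N : ℕ) (j : Fin N) : ℝ := if j.val + 1 = N then 0 else 1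
def stg (N : ℕ) [NeZero N] (J₁ : Matrix ι ι ℝ) (τ u : ℝ) (g : MB m ι) : MB ((m × Fin N) ⊕ (m × Fin N)) ι :=
  Dop J₁ (bdg fun j => (τ * sP (pt N j) + if j = 0 then u else 0) • g + (τ * sM (pt N j)) • dg m J₁)
    (om m ι (fun j => τ * (1 + cC (pt N j))) - om m ι (cutw N) * shU m ι (cyc N))
    (bdg fun j => (τ * sP (pt N j)) • g + (τ * sM (pt N j) + if j.val + 1 = N then u else 0) • dg m J₁)

lemma stg_cont (N : ℕ) [NeZero N] {Q : Type} [TopologicalSpace Q] {τ u : Q → ℝ} {g : Q → MB m ι}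
    (hτ : Continuous τ) (hu : Continuous u) (hg : Continuous g) : Continuous fun q => stg N J₁ (τ q) (u q) (g q) := by
  refine Dop_cont (bdg_cont fun j => ?_) (Continuous.sub (om_cont fun j => ?_) continuous_const) (bdg_cont fun j => ?_)
  · refine (Continuous.smul ((hτ.mul continuous_const).add ?_) hg).add ((hτ.mul continuous_const).smul continuous_const)
    split_ifs
    · exact hu
    · exact continuous_const
  · exact hτ.mul continuous_const
  · refine (Continuous.smul (hτ.mul continuous_const) hg).add (((hτ.mul continuous_const).add ?_).smul continuous_const)
    split_ifs
    · exact hu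
    · exact continuous_const

lemma k_sk {L : Type} [Fintype L] [DecidableEq L] (ω ω' : L → ℝ) (σ : Equiv.Perm L) (g : Matrix ι ι ℝ) :
    (om m ι ω' - om m ι ω * shU m ι σ) * dg _ g = dg _ g * (om m ι ω' - om m ι ω * shU m ι σ) ∧
    star (om m ι ω' - om m ι ω * shU m ι σ) * dg _ g = dg _ g * star (om m ι ω' - om m ι ω * shU m ι σ) := by
  constructor
  · rw [sub_mul, mul_sub, om_dg, omU_comm]
  · rw [star_sub, sub_mul, mul_sub, om_star, om_dg, omU_comm']

lemma stg_sk (N : ℕ) [NeZero N] (c1 : Cx G J₁) {g : MB m ι} (hg : Os G g) (τ u : ℝ) : Sk G (stg N J₁ τ u g) :=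
  Dop_sk c1 (Sk_bdg fun j => (hg.toSk.smul _).add ((c1.os.toSk).smul _))
    (Sk_bdg fun j => (hg.toSk.smul _).add ((c1.os.toSk).smul _))
    (fun b hb => (k_sk _ _ _ _).1) (fun b hb => (k_sk _ _ _ _).2)

lemma pt_val (N : ℕ) [NeZero N] (j : Fin N) : (pt N j : ℝ) = (j.val : ℝ) / N := rfl
lemma pt_half {p : ℕ} [NeZero (2 * p)] (j : Fin (2 * p)) :
    ((pt (2*p) j : ℝ) ≤ 1/2 ↔ j.val ≤ p) ∧ (1/2 ≤ (pt (2*p) j : ℝ) ↔ p ≤ j.val) := by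
  have hN : (0:ℝ) < ((2 * p : ℕ) : ℝ) := by exact_mod_cast Nat.pos_of_ne_zero (NeZero.ne _)
  rw [pt_val, div_le_iff₀ hN, le_div_iff₀ hN]
  push_cast
  constructor
  · rw [show (1/2 : ℝ) * (2 * p) = p by ring]; exact_mod_cast Iff.rfl
  · rw [show (1/2 : ℝ) * (2 * p) = p by ring]; exact_mod_cast Iff.rfl

lemma stg_gls {p : ℕ} [NeZero (2 * p)] (hp : 2 < p) (c1 : Cx G J₁) {g : MB m ι} (hg : Os G g) {τ u : ℝ}
    (h : (τ = 1 ∧ 0 ≤ u) ∨ (0 ≤ τ ∧ u = 1)) : GLs G (stg (2*p) J₁ τ u g) := by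
  refine ⟨stg_sk _ c1 hg τ u, Dop_unit c1 fun x y e1 e2 => ?_⟩
  have hτ : 0 ≤ τ := by rcases h with h | h; · rw [h.1]; exact zero_le_one
                        · exact h.1
  have hu : 0 ≤ u := by rcases h with h | h; · exact h.2
                        · rw [h.2]; exact zero_le_one
  have hN : (0:ℝ) < ((2 * p : ℕ) : ℝ) := by exact_mod_cast Nat.pos_of_ne_zero (NeZero.ne _)
  let Jx : Fin (2*p) → MB m ι := fun j => if j.val ≤ p then g else dg m J₁
  let Jy : Fin (2*p) → MB m ι := fun j => if j.val < p then g else dg m J₁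
  let s : Fin (2*p) → ℝ := fun j => τ * (sP (pt _ j) + sM (pt _ j)) + if j = 0 then u else 0
  let s' : Fin (2*p) → ℝ := fun j => τ * (sP (pt _ j) + sM (pt _ j)) + if j.val + 1 = 2*p then u else 0
  have hs : ∀ j, 0 ≤ s j := fun j => by
    have := sP0 (pt _ j); have := sM0 (pt _ j)
    simp only [s]; split_ifs <;> positivity
  have hs' : ∀ j, 0 ≤ s' j := fun j => by
    have := sP0 (pt _ j); have := sM0 (pt _ j)
    simp only [s']; split_ifs <;> positivity
  have hJx : Sc (bdg Jx) := Sc_bdg fun j => by simp only [Jx]; split_ifs; exacts [hg.sc, c1.os.sc]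
  have hJy : Sc (bdg Jy) := Sc_bdg fun j => by simp only [Jy]; split_ifs; exacts [hg.sc, c1.os.sc]
  have ex : (bdg fun j : Fin (2*p) => (τ * sP (pt _ j) + if j = 0 then u else 0) • g + (τ * sM (pt _ j)) • dg m J₁)
      = om m ι s * bdg Jx := by
    rw [om, bdg_mul]; congr 1; funext j
    simp only [smul_mul_assoc, one_mul, Jx, s]
    split_ifs with h1 h2 h2
    · rw [sM_zero ((pt_half j).1.mpr h2)]; simp
    · simp [h1] at h2
    · rw [sM_zero ((pt_half j).1.mpr h2)]; simp
    · rw [sP_zero ((pt_half j).2.mpr (by omega))]; simp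
  have ey : (bdg fun j : Fin (2*p) => (τ * sP (pt _ j)) • g + (τ * sM (pt _ j) + if j.val + 1 = 2*p then u else 0) • dg m J₁)
      = om m ι s' * bdg Jy := by
    rw [om, bdg_mul]; congr 1; funext j
    simp only [smul_mul_assoc, one_mul, Jy, s']
    split_ifs with h1 h2 h2
    · omega
    · rw [sP_zero ((pt_half j).2.mpr (by omega))]; simp
    · rw [sM_zero ((pt_half j).1.mpr h2.le)]; simp
    · rw [sP_zero ((pt_half j).2.mpr (by omega))]; simp
  rw [ex] at e1
  rw [ey] at e2
  have dp : ∀ j : Fin (2*p), j.val = p → 1 + cC (pt _ j) = 0 := fun j hj => by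
    have : (pt (2*p) j : ℝ) = 1/2 := le_antisymm ((pt_half j).1.mpr hj.le) ((pt_half j).2.mpr hj.ge)
    rw [this, cC_half]
  have hk : bdg Jy * (om m ι (fun j => τ * (1 + cC (pt (2*p) j))) - om m ι (cutw (2*p)) * shU m ι (cyc (2*p)))
      = (om m ι (fun j => τ * (1 + cC (pt (2*p) j))) - om m ι (cutw (2*p)) * shU m ι (cyc (2*p))) * bdg Jx := by
    rw [mul_sub, sub_mul, mul_assoc _ (shU _ _ _), shU_bdg, ← mul_assoc, ← mul_assoc]
    simp only [om, bdg_mul]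
    congr 2
    · congr 1; funext j
      simp only [smul_mul_assoc, mul_smul_comm, one_mul, mul_one, Jx, Jy]
      split_ifs with h1 h2 h2
      · rfl
      · omega
      · rw [dp j (by omega)]; simp
      · rfl
    · congr 1; funext j
      simp only [smul_mul_assoc, mul_smul_comm, one_mul, mul_one, Jx, Jy, cutw]
      by_cases h0 : j.val + 1 = 2 * p
      · simp [h0]
      · have := cyc_val (2*p) j (by omega)
        rw [this]; simp only [h0, if_false, one_smul]
        split_ifs <;> first | rfl | omega
  obtain ⟨z1, z2, z3, z4⟩ := Ker (om_psd hs) (om_psd0 hs) (om_psd hs') (om_psd0 hs') hJx hJy (om_comm _ _)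
    (om_comm _ _) hk e1 e2
  have Z1 : ∀ j, s j • comp x j = 0 := fun j => by
    have := congrArg (fun v => comp v j) z1; simpa only [comp_om, comp_zero] using this
  have Z2 : ∀ j, s' j • comp y j = 0 := fun j => by
    have := congrArg (fun v => comp v j) z2; simpa only [comp_om, comp_zero] using this
  have Z3 : ∀ j : Fin (2*p), j.val + 1 < 2*p → comp x (cyc _ j) = (τ * (1 + cC (pt _ j))) • comp x j := fun j hj => by
    have := congrArg (fun v => comp v j) z3
    simp only [act_sub, act_mul, comp_sub, comp_om, comp_shU, comp_zero, cutw, hj.ne, if_false, one_smul] at this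
    exact (sub_eq_zero.mp this).symm
  have Z4 : ∀ j : Fin (2*p), j.val + 1 < 2*p → comp y j = (τ * (1 + cC (pt _ (cyc _ j)))) • comp y (cyc _ j) := fun j hj => by
    have := congrArg (fun v => comp v (cyc _ j)) z4
    simp only [star_sub, star_mul, om_star, shU_star, act_sub, act_mul, comp_sub, comp_om, comp_shU, comp_zero, cutw,
      Equiv.symm_apply_apply, hj.ne, if_false, one_smul] at this
    exact (sub_eq_zero.mp this).symm
  let X : ℕ → (m × ι → ℝ) := fun i => if hi : i < 2*p then comp x ⟨i, hi⟩ else 0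
  let Y : ℕ → (m × ι → ℝ) := fun i => if hi : i < 2*p then comp y ⟨i, hi⟩ else 0
  have cy : ∀ i (hi : i + 1 < 2*p), cyc (2*p) ⟨i, by omega⟩ = ⟨i+1, hi⟩ := fun i hi =>
    Fin.ext (cyc_val (2*p) ⟨i, by omega⟩ hi)
  have RX : ∀ i, i + 1 < 2*p → X (i+1) = (fun i : ℕ => τ * (1 + cC ((i:ℝ)/((2*p : ℕ) : ℝ)))) i • X i := fun i hi => by
    have := Z3 ⟨i, by omega⟩ hi
    rw [cy i hi] at this
    simp only [X, hi, (by omega : i < 2*p), dif_pos]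
    exact this
  have RY : ∀ i, i + 1 < 2*p → Y i = (fun i : ℕ => τ * (1 + cC ((i:ℝ)/((2*p : ℕ) : ℝ)))) (i+1) • Y (i+1) := fun i hi => by
    have := Z4 ⟨i, by omega⟩ hi
    rw [cy i hi] at this
    simp only [Y, hi, (by omega : i < 2*p), dif_pos]
    exact this
  have fin : (∀ i < 2*p, X i = 0) ∧ (∀ i < 2*p, Y i = 0) := by
    rcases h with ⟨rfl, hu'⟩ | ⟨hτ', rfl⟩
    · have hd : ∀ i : ℕ, i ≠ p → 1 + cC ((i:ℝ)/((2*p : ℕ) : ℝ)) ≠ 0 := fun i hi => d_ne (by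
        intro hh
        rw [div_eq_iff hN.ne'] at hh
        push_cast at hh
        apply hi
        have : (i:ℝ) = p := by linarith
        exact_mod_cast this)
      have hp' : (2:ℝ) < p := by exact_mod_cast hp
      constructor
      · refine rec1 RX (i0 := p - 1) (by omega) ?_ fun i hi => ?_
        · have := Z1 ⟨p - 1, by omega⟩
          simp only [X, (by omega : p - 1 < 2*p), dif_pos]
          refine (smul_eq_zero.mp this).resolve_left (ne_of_gt ?_)
          have h1 : 0 < sP (pt (2*p) ⟨p-1, by omega⟩) := by
            apply sP_pos
            · rw [pt_val, lt_div_iff₀ hN]; push_cast [Nat.cast_sub (by omega : 1 ≤ p)]; linarith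
            · rw [pt_val, div_lt_iff₀ hN]; push_cast [Nat.cast_sub (by omega : 1 ≤ p)]; linarith
          have h2 := sM0 (pt (2*p) ⟨p-1, by omega⟩)
          simp only [s]; split_ifs <;> linarith
        · simp only [one_mul]; exact hd i (by omega)
      · refine rec2 (d := fun i : ℕ => 1 * (1 + cC ((i:ℝ)/((2*p : ℕ) : ℝ)))) RY (i0 := p + 1) (by omega) ?_ fun i hi hi' => ?_
        · have := Z2 ⟨p + 1, by omega⟩
          simp only [Y, (by omega : p + 1 < 2*p), dif_pos]
          refine (smul_eq_zero.mp this).resolve_left (ne_of_gt ?_)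
          have h1 : 0 < sM (pt (2*p) ⟨p+1, by omega⟩) := by
            apply sM_pos
            · rw [pt_val, lt_div_iff₀ hN]; push_cast; linarith
            · rw [pt_val, div_lt_iff₀ hN]; push_cast; linarith
          have h2 := sP0 (pt (2*p) ⟨p+1, by omega⟩)
          simp only [s']; split_ifs <;> linarith
        · simp only [one_mul]; exact hd i (by omega)
    · constructor
      · refine rec1 RX (i0 := 0) (by omega) ?_ fun i hi => by omega
        have := Z1 ⟨0, by omega⟩
        simp only [X, (by omega : 0 < 2*p), dif_pos]
        refine (smul_eq_zero.mp this).resolve_left (ne_of_gt ?_)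
        have h1 := sP0 (pt (2*p) ⟨0, by omega⟩)
        have h2 := sM0 (pt (2*p) ⟨0, by omega⟩)
        have e : (⟨0, by omega⟩ : Fin (2*p)) = 0 := rfl
        simp only [s, e, if_true] at *; positivity
      · refine rec2 (d := fun i : ℕ => τ * (1 + cC ((i:ℝ)/((2*p : ℕ) : ℝ)))) RY (i0 := 2*p - 1) (by omega) ?_ fun i hi => by omega
        have := Z2 ⟨2*p - 1, by omega⟩
        simp only [Y, (by omega : 2*p - 1 < 2*p), dif_pos]
        refine (smul_eq_zero.mp this).resolve_left (ne_of_gt ?_)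
        have h1 := sP0 (pt (2*p) ⟨2*p - 1, by omega⟩)
        have h2 := sM0 (pt (2*p) ⟨2*p - 1, by omega⟩)
        simp only [s', (by omega : 2*p - 1 + 1 = 2*p), if_true]; positivity
  constructor
  · refine comp_ext fun j => ?_
    have := fin.1 j.val j.2
    simp only [X, j.2, dif_pos] at this; rw [comp_zero]; exact this
  · refine comp_ext fun j => ?_
    have := fin.2 j.val j.2
    simp only [Y, j.2, dif_pos] at this; rw [comp_zero]; exact this

lemma alp_stg (N : ℕ) [NeZero N] (c0 : Cx G J₀) (c1 : Cx (insert J₀ G) J₁) {g : MB m ι} (hg : Os (insert J₀ G) g) :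
    alp (cyc N) J₀ J₁ (cutw N) (fun j => bcl J₀ J₁ g (pt N j)) = stg N J₁ 1 0 g := by
  simp only [alp, stg, aM_bdg, dM_bdg, bcl_aM c0 c1 hg, bcl_dM c0 c1 hg, one_mul, ite_self, add_zero]
  rfl

section split
variable {n : Type} [Fintype n] [DecidableEq n]
open Classical in
def spl (f : m → n) (hf : Function.Injective f) : m ⊕ {z : n // z ∉ Set.range f} ≃ n :=
  (Equiv.sumCongr (Equiv.ofInjective f hf) (Equiv.refl _)).trans (Equiv.Set.sumCompl (Set.range f))
lemma spl_inl (f : m → n) (hf : Function.Injective f) (i : m) : spl f hf (Sum.inl i) = f i := rfl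
lemma spl_inr (f : m → n) (hf : Function.Injective f) (i : {z : n // z ∉ Set.range f}) : spl f hf (Sum.inr i) = i.1 := rfl
lemma spl_eq (f : m → n) (hf : Function.Injective f) [DecidableEq {z : n // z ∉ Set.range f}] [Fintype {z : n // z ∉ Set.range f}]
    {A : MB n ι} {X : MB m ι} {C : MB {z : n // z ∉ Set.range f} ι}
    (h1 : ∀ i j, A (f i) (f j) = X i j) (h2 : ∀ i (z : {z : n // z ∉ Set.range f}), A (f i) z.1 = 0)
    (h3 : ∀ i (z : {z : n // z ∉ Set.range f}), A z.1 (f i) = 0)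
    (h4 : ∀ (z w : {z : n // z ∉ Set.range f}), A z.1 w.1 = C z w) : A = rx (spl f hf) (dsum X C) := by
  ext z w : 1
  obtain ⟨z, rfl⟩ := (spl f hf).surjective z
  obtain ⟨w, rfl⟩ := (spl f hf).surjective w
  simp only [rx, submatrix_apply, Equiv.symm_apply_apply]
  rcases z with z | z <;> rcases w with w | w <;> simp [dsum, spl_inl, spl_inr, h1, h2, h3, h4]
end split
lemma unit_of_dsum {a : Type} [Fintype a] [DecidableEq a] {X : MB m ι} {Y : MB a ι} (h : IsUnit (dsum X Y)) : IsUnit Y := by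
  obtain ⟨⟨x, y, h1, h2⟩, hx⟩ := h
  simp only at hx
  subst hx
  refine ⟨⟨Y, y.toBlocks₂₂, ?_, ?_⟩, rfl⟩
  · rw [← fromBlocks_toBlocks y, dsum, fromBlocks_multiply, ← fromBlocks_one] at h1
    simpa using (fromBlocks_inj.mp h1).2.2.2
  · rw [← fromBlocks_toBlocks y, dsum, fromBlocks_multiply, ← fromBlocks_one] at h2
    simpa using (fromBlocks_inj.mp h2).2.2.2
lemma Sk.of_dsum {a : Type} [Fintype a] [DecidableEq a] {X : MB m ι} {Y : MB a ι} (h : Sk G (BottP.dsum X Y)) : Sk G Y where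
  skew := by
    have := h.skew
    rw [dsum_star, dsum_neg] at this
    exact (fromBlocks_inj.mp this).2.2.2
  anti g hg := by
    have := h.anti g hg
    rw [← dsum_dg, dsum_mul, dsum_mul, dsum_neg] at this
    exact (fromBlocks_inj.mp this).2.2.2
lemma GLs.of_dsum {a : Type} [Fintype a] [DecidableEq a] {X : MB m ι} {Y : MB a ι} (h : GLs G (BottP.dsum X Y)) : GLs G Y :=
  ⟨h.toSk.of_dsum, unit_of_dsum h.unit⟩
lemma GLs.of_rx {m' : Type} [Fintype m'] [DecidableEq m'] {e : m ≃ m'} {X : MB m ι} (h : GLs G (BottP.rx e X)) : GLs G X := by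
  have := h.rx e.symm
  rwa [rx_symm] at this

def inl0 (m : Type) (N : ℕ) [NeZero N] : m → (m × Fin N) ⊕ (m × Fin N) := fun i => Sum.inl (i, 0)
lemma inl0_inj (N : ℕ) [NeZero N] : Function.Injective (inl0 m N) := fun i j h => by
  simpa [inl0] using h
lemma omU_apply {L : Type} [Fintype L] [DecidableEq L] (ω : L → ℝ) (σ : Equiv.Perm L) (i k : m) (j l : L) :
    (om m ι ω * shU m ι σ) (i, j) (k, l) = if σ j = l then ω j • (1 : MB m ι) i k else 0 := by
  rw [mul_shU, submatrix_apply, om, bdg]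
  simp only [id, Prod.map, blockDiagonal_apply, Equiv.eq_symm_apply, Matrix.smul_apply]
lemma dg_mul_apply {n : Type} [Fintype n] [DecidableEq n] (J : Matrix ι ι ℝ) (A : MB n ι) (i j : n) :
    (dg n J * A) i j = J * A i j := by rw [dg, diagonal_mul]
lemma mul_dg_apply {n : Type} [Fintype n] [DecidableEq n] (J : Matrix ι ι ℝ) (A : MB n ι) (i j : n) :
    (A * dg n J) i j = A i j * J := by rw [dg, mul_diagonal]
lemma cutU0 (N : ℕ) [NeZero N] (j : Fin N) (i k : m) : (om m ι (cutw N) * shU m ι (cyc N)) (k, j) (i, 0) = 0 := by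
  rw [omU_apply]
  split_ifs with h
  · have : j.val + 1 = N := by
      by_contra h1
      have := cyc_val N j (by omega)
      rw [h] at this; simp at this
    simp [cutw, this]
  · rfl
open Classical in
lemma stg_end (N : ℕ) [NeZero N] (J₁ : Matrix ι ι ℝ) : ∃ C : MB {z // z ∉ Set.range (inl0 m N)} ι, ∀ g : MB m ι,
    stg N J₁ 0 1 g = rx (spl (inl0 m N) (inl0_inj N)) (dsum g C) := by
  refine ⟨(stg N J₁ 0 1 0).submatrix Subtype.val Subtype.val, fun g => ?_⟩
  have e : ∀ g : MB m ι, stg N J₁ 0 1 g = Dop J₁ (bdg fun j => (if j = 0 then (1:ℝ) else 0) • g)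
      (-(om m ι (cutw N) * shU m ι (cyc N))) (bdg fun j => (if j.val + 1 = N then (1:ℝ) else 0) • dg m J₁) := by
    intro g
    have : om m ι (fun j : Fin N => (0:ℝ)) = 0 := by
      simp only [om, zero_smul]; exact bdg_zero
    simp only [stg, zero_mul, this, zero_sub, zero_smul, zero_add, add_zero]
  refine spl_eq _ _ ?_ ?_ ?_ ?_
  · intro i j
    rw [e]; simp [inl0, Dop, bdg]
  · rintro i ⟨⟨z, j⟩ | ⟨z, j⟩, hz⟩
    · have : (0 : Fin N) ≠ j := fun h => hz ⟨z, by rw [← h]; rfl⟩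
      rw [e]; simp [inl0, Dop, bdg, blockDiagonal_apply, this]
    · rw [e]; simp only [inl0, Dop, fromBlocks_apply₁₂, mul_dg_apply, star_apply, Matrix.neg_apply, cutU0]; simp
  · rintro i ⟨⟨z, j⟩ | ⟨z, j⟩, hz⟩
    · have : j ≠ (0 : Fin N) := fun h => hz ⟨z, by rw [h]; rfl⟩
      rw [e]; simp [inl0, Dop, bdg, blockDiagonal_apply, this]
    · rw [e]; simp only [inl0, Dop, fromBlocks_apply₂₁, dg_mul_apply, Matrix.neg_apply, cutU0]; simp
  · rintro ⟨⟨z, j⟩ | ⟨z, j⟩, hz⟩ ⟨⟨w, l⟩ | ⟨w, l⟩, hw⟩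
    · have : j ≠ (0 : Fin N) := fun h => hz ⟨z, by rw [h]; rfl⟩
      rw [submatrix_apply, e, e]; simp [Dop, bdg, blockDiagonal_apply, this]
    all_goals rw [submatrix_apply, e, e]; rfl
end stage

section thmA
variable {Q : Type} {bd : Set Q} {m m' ι : Type} [Fintype m] [DecidableEq m] [Fintype ι] [DecidableEq ι]
  [Fintype m'] [DecidableEq m'] {G : Set (Matrix ι ι ℝ)} {J₀ J₁ J₂ : Matrix ι ι ℝ}

lemma PEq.fn [TopologicalSpace Q] (c : Ctx G J₁ J₂) {g : Q → MB m ι} (hg : Based bd G J₁ g) (Φ : unitInterval → MB m ι → MB m' ι)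
    (hΦ : ∀ {R : Type} [TopologicalSpace R] {t : R → unitInterval} {f : R → MB m ι}, Continuous t → Continuous f →
      Continuous fun r => Φ (t r) (f r)) (h1 : ∀ t q, GLs G (Φ t (g q)))
    (h2 : ∀ t, GLs G (Φ t (dg m J₁))) : PEq bd G J₁ J₂ (fun q => Φ 0 (g q)) (fun _ => Φ 0 (dg m J₁))
      (fun q => Φ 1 (g q)) (fun _ => Φ 1 (dg m J₁)) := by
  refine PEq.hom c (fun p => Φ p.1 (g p.2)) (fun p => Φ p.1 (dg m J₁)) ⟨hΦ continuous_fst (hg.cont.comp continuous_snd), fun p => h1 _ _⟩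
    ⟨hΦ continuous_fst continuous_const, fun p => h2 _⟩ (fun t q hq => ?_) (fun _ => rfl) (fun _ => rfl) (fun _ => rfl) (fun _ => rfl)
  simp only [hg.base q hq]

/-- the lattice map applied to the Bott family -/
def aB (N : ℕ) [NeZero N] (J₀ J₁ : Matrix ι ι ℝ) (f : ℝ → MB m ι) : MB ((m × Fin N) ⊕ (m × Fin N)) ι :=
  alp (cyc N) J₀ J₁ (fun _ => 1) (fun j => f (pt N j))

theorem thmA [PseudoMetricSpace Q] [CompactSpace Q] (c0 : Cx G J₀) (c : Ctx (insert J₀ G) J₁ J₂) {g : Q → MB m ι}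
    (hg : Based bd (insert J₀ G) J₁ g) : ∃ p₀ : ℕ, ∀ p, p₀ ≤ p → ∀ [NeZero (2 * p)],
      PEq bd (insert J₀ G) J₁ J₂ (fun q => aB (2*p) J₀ J₁ (bb J₀ J₁ 1 (g q)))
        (fun _ => aB (2*p) J₀ J₁ (bb J₀ J₁ 1 (dg m J₁))) g (fun _ => dg m J₁) := by
  have c1 := c.J
  have hJ : Os (insert J₀ G) (dg m J₁) := c1.os
  have fin : ∀ {g : Q → MB m ι}, Continuous g → ∃ N₀ : ℕ, ∀ N [NeZero N], N₀ ≤ N → ∀ (l : unitInterval) q (j : Fin N),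
      Sm (1/4) (bb J₀ J₁ l (g q) (pt N (cyc N j)) - bb J₀ J₁ l (g q) (pt N j)) := by
    intro g hg
    obtain ⟨N₀, h⟩ := fine (Q := unitInterval × Q) (f := fun z => bb J₀ J₁ z.1.1 (g z.1.2) z.2)
      (bbC (by fun_prop) (hg.comp (by fun_prop)) (by fun_prop))
      (fun q => by rw [bb_end _ _ (by left; norm_num), bb_end _ _ (by right; norm_num)])
      (η := 1/4) (by norm_num)
    exact ⟨N₀, fun N _ hN l q j => h N hN (l, q) j⟩
  obtain ⟨N1, h1⟩ := fin hg.cont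
  obtain ⟨N2, h2⟩ := fin (g := fun _ => dg m J₁) continuous_const
  refine ⟨N1 + N2 + 3, fun p hp _ => ?_⟩
  rcases isEmpty_or_nonempty Q with hQ | ⟨⟨q₀⟩⟩
  · refine ⟨_, _, inferInstance, inferInstance, inferInstance, inferInstance, Equiv.sumComm _ _, ?_⟩
    exact ⟨fun p => (hQ.false p.2).elim, continuous_of_const fun p => (hQ.false p.2).elim, fun q => (hQ.false q).elim,
      fun q => (hQ.false q).elim, fun p => (hQ.false p.2).elim, fun t q => (hQ.false q).elim⟩
  have h1' := h1 (2*p) (by omega)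
  have h2' := fun l j => h2 (2*p) (by omega) l q₀ j
  have e0 : ∀ (a : MB m ι) (j : Fin (2*p)), bb J₀ J₁ ((0:unitInterval):ℝ) a (pt (2*p) j) = bcl J₀ J₁ a (pt (2*p) j) :=
    fun a j => bb_zero _ _
  have abs1 : ∀ t : unitInterval, |(1 - (t:ℝ))| ≤ 1 := fun t => by
    rw [abs_le]; constructor <;> linarith [t.2.1, t.2.2]
  -- step 0
  have s0 := PEq.fn c hg (fun t a => aB (2*p) J₀ J₁ (bb J₀ J₁ (unitInterval.symm t) a)) (fun ht hf =>
      alp_cont _ (fun j => continuous_const) (fun j => bbC (by fun_prop) hf continuous_const))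
    (fun t q => alp_gls _ c0 c1 (fun j => bb_os c0 c1 (hg.os q) _ _) (fun j => by simp) (fun j => Or.inl rfl) (h1' _ q))
    (fun t => alp_gls _ c0 c1 (fun j => bb_os c0 c1 hJ _ _) (fun j => by simp) (fun j => Or.inl rfl) (h2' _))
  let w : unitInterval → Fin (2*p) → ℝ := fun t j => if j.val + 1 = 2*p then 1 - (t:ℝ) else 1
  have hw1 : ∀ t j, |w t j| ≤ 1 := fun t j => by
    simp only [w]; split_ifs
    · exact abs1 t
    · simp
  have hwd : ∀ t (a : MB m ι), Os (insert J₀ G) a → ∀ j, w t j = 1 ∨ dM (bb J₀ J₁ ((0:unitInterval):ℝ) a (pt (2*p) j)) (dg m J₀) = (2:ℝ) • 1 := by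
    intro t a ha j
    by_cases hj : j.val + 1 = 2*p
    · right
      rw [e0, bcl_dM c0 c1 ha, (end_vals (Or.inr _)).1]
      · norm_num
      · have hp3 : (3:ℝ) ≤ p := by exact_mod_cast (by omega : 3 ≤ p)
        have hj' : (j.val : ℝ) + 1 = 2 * p := by exact_mod_cast hj
        rw [pt_val, le_div_iff₀ (by push_cast; linarith)]; push_cast; linarith
    · left; simp [w, hj]
  have s1 := PEq.fn c hg (fun t a => alp (cyc (2*p)) J₀ J₁ (w t) (fun j => bb J₀ J₁ ((0:unitInterval):ℝ) a (pt (2*p) j))) (fun ht hf =>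
      alp_cont _ (fun j => by
        simp only [w]; split_ifs
        · fun_prop
        · exact continuous_const) (fun j => bbC continuous_const hf continuous_const))
    (fun t q => alp_gls _ c0 c1 (fun j => bb_os c0 c1 (hg.os q) _ _) (hw1 t) (hwd t _ (hg.os q)) (h1' _ q))
    (fun t => alp_gls _ c0 c1 (fun j => bb_os c0 c1 hJ _ _) (hw1 t) (hwd t _ hJ) (h2' _))
  have s2 := PEq.fn c hg (fun t a => stg (2*p) J₁ 1 t a) (fun ht hf => stg_cont _ continuous_const (by fun_prop) hf)
    (fun t q => stg_gls (by omega) c1 (hg.os q) (Or.inl ⟨rfl, t.2.1⟩)) (fun t => stg_gls (by omega) c1 hJ (Or.inl ⟨rfl, t.2.1⟩))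
  have s3 := PEq.fn c hg (fun t a => stg (2*p) J₁ (unitInterval.symm t) 1 a) (fun ht hf => stg_cont _ (by fun_prop) continuous_const hf)
    (fun t q => stg_gls (by omega) c1 (hg.os q) (Or.inr ⟨(unitInterval.symm t).2.1, rfl⟩))
    (fun t => stg_gls (by omega) c1 hJ (Or.inr ⟨(unitInterval.symm t).2.1, rfl⟩))
  have w0 : w 0 = fun _ => 1 := by funext j; simp [w]
  have w1 : w 1 = cutw (2*p) := by funext j; simp [w, cutw]
  simp only [unitInterval.symm_zero, unitInterval.symm_one, w0, w1] at s0 s1 s2 s3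
  simp only [e0] at s1
  have sA := fun {a : MB m ι} (ha : Os (insert J₀ G) a) => alp_stg (2*p) c0 c1 ha
  have eA : (fun q => alp (cyc (2*p)) J₀ J₁ (cutw (2*p)) (fun j => bcl J₀ J₁ (g q) (pt (2*p) j))) = fun q => stg (2*p) J₁ 1 0 (g q) :=
    funext fun q => sA (hg.os q)
  rw [eA, sA hJ] at s1
  simp only [Set.Icc.coe_zero, Set.Icc.coe_one] at s0 s1 s2 s3
  refine s0.trans c (PEq.trans c ?_ (s1.trans c (s2.trans c (s3.trans c ?_))))
  · simp only [aB, bb_zero]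
    refine PEq.refl c ⟨⟨?_, ?_⟩, ⟨continuous_const, ?_⟩, ?_⟩
    · have := alp_cont (J₀ := J₀) (J₁ := J₁) (cyc (2*p)) (ω := fun _ _ => 1) (f := fun q j => bb J₀ J₁ 0 (g q) (pt (2*p) j))
        (fun j => continuous_const) (fun j => bbC continuous_const hg.cont continuous_const)
      simpa only [bb_zero] using this
    · intro q
      have := alp_gls (cyc (2*p)) (ω := fun _ => 1) (f := fun j => bb J₀ J₁ ((0:unitInterval):ℝ) (g q) (pt (2*p) j)) c0 c1 (fun j => bb_os c0 c1 (hg.os q) _ _) (fun j => by simp) (fun j => Or.inl rfl) (h1' _ q)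
      simpa only [e0] using this
    · intro q
      have := alp_gls (cyc (2*p)) (ω := fun _ => 1) (f := fun j => bb J₀ J₁ ((0:unitInterval):ℝ) (dg m J₁) (pt (2*p) j)) c0 c1 (fun j => bb_os c0 c1 hJ _ _) (fun j => by simp) (fun j => Or.inl rfl) (h2' _)
      simpa only [e0] using this
    · intro q hq; rw [hg.base q hq]
  · obtain ⟨C, hC⟩ := stg_end (m := m) (2*p) J₁
    have hCg : GLs (insert J₀ G) C := by
      have := stg_gls (p := p) (by omega) c1 hJ (τ := 0) (u := 1) (Or.inr ⟨le_rfl, rfl⟩)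
      rw [hC] at this
      exact this.of_rx.of_dsum
    simp only [hC]
    have hf := hg.pf c
    have hCf : GFam (Q := Q) (insert J₀ G) (fun _ => C) := ⟨continuous_const, fun _ => hCg⟩
    refine PEq.trans c (PEq.symm (PEq.rx c ?_ _)) (PEq.add c hf hCf)
    exact ⟨hf.l.dsum hCf, hf.r.dsum hCf, fun q hq => by rw [hg.base q hq]⟩
end thmA
end BottP

set_option linter.all false
set_option autoImplicit false
set_option linter.unusedSectionVars false
set_option linter.unusedSimpArgs false
namespace BottP
open Matrix Topology

section inj
variable {Q : Type} {bd : Set Q} {m m' ι : Type} [Fintype m] [DecidableEq m] [Fintype ι] [DecidableEq ι]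
  [Fintype m'] [DecidableEq m'] {G : Set (Matrix ι ι ℝ)} {J₀ J₁ J₂ : Matrix ι ι ℝ}

/-- boundary of the cylinder -/
def bdI (bd : Set Q) : Set (Q × unitInterval) := {z | z.1 ∈ bd ∨ z.2 = 0 ∨ z.2 = 1}
/-- the Bott map -/
def bet (J₀ J₁ : Matrix ι ι ℝ) (g : Q → MB m ι) : Q × unitInterval → MB m ι := fun z => bb J₀ J₁ 1 (g z.1) z.2

lemma bet_end (g : Q → MB m ι) (q : Q) {x : unitInterval} (h : x = 0 ∨ x = 1) : bet J₀ J₁ g (q, x) = dg m J₀ := by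
  apply bb_end
  rcases h with rfl | rfl
  · left; norm_num
  · right; norm_num
lemma bet_based [TopologicalSpace Q] (c0 : Cx G J₀) (c1 : Cx (insert J₀ G) J₁) {g : Q → MB m ι} (hg : Based bd (insert J₀ G) J₁ g) :
    Based (bdI bd) G J₀ (bet J₀ J₁ g) where
  cont := bbC continuous_const (hg.cont.comp continuous_fst) (by fun_prop)
  os z := bb_os c0 c1 (hg.os _) _ _
  base := by
    rintro ⟨q, x⟩ (h | h)
    · simp only at h; simp only [bet, hg.base q h, bb_J c0 c1]
    · exact bet_end g q h

lemma bet_seq [TopologicalSpace Q] (c0 : Cx G J₀) (c1 : Cx (insert J₀ G) J₁) {g : Q → MB m ι} {g' : Q → MB m' ι}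
    (hg : Based bd (insert J₀ G) J₁ g) (h : SEq bd (insert J₀ G) J₁ g g') : SEq (bdI bd) G J₀ (bet J₀ J₁ g) (bet J₀ J₁ g') := by
  obtain ⟨a, a', i1, i2, i3, i4, e, H, hc, h0, h1, ho, hb⟩ := h
  refine ⟨a, a', i1, i2, i3, i4, e, fun z => bb J₀ J₁ 1 (H (z.1, z.2.1)) z.2.2, ?_, ?_, ?_, ?_, ?_⟩
  · exact bbC continuous_const (hc.comp (by fun_prop)) (by fun_prop)
  · rintro ⟨q, x⟩
    simp only [h0, bb_rx, bb_dsum, bb_J c0 c1, bet]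
  · rintro ⟨q, x⟩
    simp only [h1, bb_dsum, bb_J c0 c1, bet]
  · rintro ⟨t, q, x⟩
    exact bb_os c0 c1 (ho _) _ _
  · rintro t ⟨q, x⟩ (h | h)
    · simp only [hb t q h, bb_rx, bb_dsum, bb_J c0 c1, bet]
    · show bb J₀ J₁ 1 (H (t, q)) x = rx e (dsum (bet J₀ J₁ g (q, x)) (dg a J₀))
      rw [bet_end _ _ h, dsum_dg, rx_dg]
      exact bet_end (fun _ : Q => H (t, q)) q h

lemma Sm_self {η : ℝ} (hη : 0 ≤ η) (X : MB m ι) : Sm η (X - X) := by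
  intro u v
  rw [sub_self, act_zero, dotProduct_zero, mul_zero]
  have h1 := nn u; have h2 := nn v
  positivity

/-- constant pair -/
lemma alp_const {L : Type} [Fintype L] [DecidableEq L] (σ : Equiv.Perm L) (c0 : Cx G J₀) (c1 : Cx (insert J₀ G) J₁) {X : MB m ι} (hX : Os G X) :
    GLs (insert J₀ G) (alp σ J₀ J₁ (fun _ => 1) (fun _ => X)) :=
  alp_gls σ c0 c1 (fun _ => hX) (fun j => by simp) (fun j => Or.inl rfl) (fun j => Sm_self (by norm_num) _)

theorem bet_inj [PseudoMetricSpace Q] [CompactSpace Q] (c0 : Cx G J₀) (c : Ctx (insert J₀ G) J₁ J₂) {g : Q → MB m ι} {g' : Q → MB m' ι}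
    (hg : Based bd (insert J₀ G) J₁ g) (hg' : Based bd (insert J₀ G) J₁ g')
    (h : SEq (bdI bd) G J₀ (bet J₀ J₁ g) (bet J₀ J₁ g')) : SEq bd (insert J₀ G) J₁ g g' := by
  obtain ⟨a, a', i1, i2, i3, i4, e, H, hc, h0, h1, ho, hb⟩ := h
  have c1 := c.J
  let g1 : Q → MB (m' ⊕ a') ι := fun q => rx e (dsum (g q) (dg a J₁))
  let g2 : Q → MB (m' ⊕ a') ι := fun q => dsum (g' q) (dg a' J₁)
  have hg1 : Based bd (insert J₀ G) J₁ g1 := ⟨⟨(rx_cont e).comp (dsumC hg.cont continuous_const),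
    fun q => ((hg.os q).dsum c1.os).rx e⟩, fun q hq => by simp only [g1, hg.base q hq, dsum_dg, rx_dg]⟩
  have hg2 : Based bd (insert J₀ G) J₁ g2 := ⟨⟨(dsumC hg'.cont continuous_const),
    fun q => ((hg'.os q).dsum c1.os)⟩, fun q hq => by simp only [g2, hg'.base q hq, dsum_dg]⟩
  have sg1 : SEq bd (insert J₀ G) J₁ g g1 :=
    (SEq.stab c1 hg.toFam a).trans c1 (SEq.of_eq_rx c1 ⟨dsumC hg.cont continuous_const, fun q => (hg.os q).dsum c1.os⟩ e fun q => rfl)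
  have sg2 : SEq bd (insert J₀ G) J₁ g' g2 := SEq.stab c1 hg'.toFam a'
  suffices SEq bd (insert J₀ G) J₁ g1 g2 from (sg1.trans c1 this).trans c1 sg2.symm
  have k0 : ∀ q x, H (0, (q, x)) = bb J₀ J₁ 1 (g1 q) x := fun q x => by
    simp only [h0, bet, g1, bb_rx, bb_dsum, bb_J c0 c1]
  have k1 : ∀ q x, H (1, (q, x)) = bb J₀ J₁ 1 (g2 q) x := fun q x => by
    simp only [h1, bet, g2, bb_rx, bb_dsum, bb_J c0 c1]
  have kb : ∀ t z, z ∈ bdI bd → H (t, z) = dg _ J₀ := fun t z hz => by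
    rw [hb t z hz]
    show rx e (dsum (bet J₀ J₁ g z) _) = _
    rw [(bet_based c0 c1 hg).base z hz, dsum_dg, rx_dg]
  obtain ⟨N₀, hN⟩ := fine (Q := unitInterval × Q) (f := fun z => H (z.1.1, (z.1.2, z.2))) (hc.comp (by fun_prop))
    (fun q => by rw [kb _ _ (Or.inr (Or.inl rfl)), kb _ _ (Or.inr (Or.inr rfl))]) (η := 1/4) (by norm_num)
  obtain ⟨p1, hp1⟩ := thmA c0 c hg1
  obtain ⟨p2, hp2⟩ := thmA c0 c hg2
  let p := p1 + p2 + N₀ + 1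
  haveI : NeZero (2 * p) := ⟨by omega⟩
  have t1 := hp1 p (by omega)
  have t2 := hp2 p (by omega)
  refine PEq.out c hg1 hg2 (t1.symm.trans c (PEq.trans c ?_ t2))
  have eJ : ∀ x, bb J₀ J₁ 1 (dg (m' ⊕ a') J₁) x = dg _ J₀ := bb_J c0 c1
  simp only [aB, eJ]
  refine PEq.hom c (fun z => alp (cyc (2*p)) J₀ J₁ (fun _ => 1) (fun j => H (z.1, (z.2, pt (2*p) j))))
    (fun z => alp (cyc (2*p)) J₀ J₁ (fun _ => 1) (fun j => dg _ J₀)) ⟨?_, ?_⟩ ⟨continuous_const, fun _ => alp_const _ c0 c1 c0.os⟩ ?_ ?_ ?_ ?_ ?_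
  · exact alp_cont _ (fun j => continuous_const) (fun j => hc.comp (by fun_prop))
  · intro z
    exact alp_gls _ c0 c1 (fun j => ho _) (fun j => by simp) (fun j => Or.inl rfl) (fun j => hN (2*p) (by omega) (z.1, z.2) j)
  · intro t q hq
    simp only [kb t (q, _) (Or.inl hq)]
  · intro q; simp only [k0]
  · intro q; rfl
  · intro q; simp only [k1]
  · intro q; rfl
end inj
end BottP

set_option linter.all false
set_option autoImplicit false
set_option linter.unusedSectionVars false
set_option linter.unusedSimpArgs false
namespace BottP
open Matrix Topology

section cyl
variable {Q : Type} {bd : Set Q} {m n ι : Type} [Fintype m] [DecidableEq m] [Fintype ι] [DecidableEq ι]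
  [Fintype n] [DecidableEq n] {G : Set (Matrix ι ι ℝ)} {A B C D : Matrix ι ι ℝ}

lemma Un.mono {G' : Set (Matrix ι ι ℝ)} {X : MB m ι} (h : Un G' X) (hG : G ⊆ G') : Un G X :=
  ⟨h.l, h.r, fun g hg => h.comm g (hG hg)⟩

lemma cs_gls (c0 : Cx G B) {X : MB n ι} (hX : GLs (insert B G) X) {c s : ℝ} (h : c * c + s * s = 1) :
    GLs G (c • dg n B + s • X) := by
  refine ⟨(c0.os.toSk.smul c).add ((hX.toSk.mono (Set.subset_insert _ _)).smul s), unit_of_act fun v hv => ?_⟩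
  have hB : star (dg n B) * dg n B = 1 := by rw [(c0.os (m := n)).skew, neg_mul, (c0.os (m := n)).sq, neg_neg]
  have ha : X * dg n B = -(dg n B * X) := hX.anti B (by simp)
  have i1 : act (dg n B) v ⬝ᵥ act (dg n B) v = v ⬝ᵥ v := iso hB v v
  have i2 : act (dg n B) v ⬝ᵥ act X v = 0 := by
    have e1 : act (dg n B) v ⬝ᵥ act X v = v ⬝ᵥ act (X * dg n B) v := by
      rw [act_adj, ← act_mul, (c0.os (m := n)).skew, neg_mul, ← ha]
    have e2 : act (dg n B) v ⬝ᵥ act X v = - (v ⬝ᵥ act (X * dg n B) v) := by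
      rw [dotProduct_comm, act_adj, ← act_mul, hX.skew, neg_mul, act_neg, dotProduct_neg]
    linarith
  have key : (c * c) * (v ⬝ᵥ v) + (s * s) * (act X v ⬝ᵥ act X v) = 0 := by
    have : act (c • dg n B + s • X) v ⬝ᵥ act (c • dg n B + s • X) v = 0 := by rw [hv]; simp
    simp only [act_add, act_smul, add_dotProduct, dotProduct_add, smul_dotProduct, dotProduct_smul, smul_eq_mul, i1, i2,
      dotProduct_comm (act X v) (act (dg n B) v)] at this
    linarith
  have n1 := nn v; have n2 := nn (act X v)
  by_cases hs : s = 0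
  · have : c * c = 1 := by rw [hs] at h; linarith
    rw [this, hs] at key
    exact nn0 (by linarith)
  · have hs' : 0 < s * s := mul_self_pos.mpr hs
    have : act X v ⬝ᵥ act X v = 0 := by nlinarith [mul_nonneg (mul_self_nonneg c) n1]
    exact act_unit hX.unit (nn0 this)

lemma cs_gls2 (c0 : Cx G B) {X X₀ : MB n ι} (hX : GLs (insert B G) X) (hX₀ : GLs (insert B G) X₀) (x : ℝ) :
    GLs G (cC x • dg n B + sP x • X + sM x • X₀) := by
  have h := cs2 x
  rcases mul_eq_zero.mp (sPM x) with h0 | h0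
  · rw [h0, zero_smul, add_zero]; apply cs_gls c0 hX₀; rw [h0] at h; linarith
  · rw [h0, zero_smul, add_zero]; apply cs_gls c0 hX; rw [h0] at h; linarith

lemma cylC {R : Type} [TopologicalSpace R] {X X₀ : R → MB n ι} {x : R → ℝ} (hX : Continuous X) (hX₀ : Continuous X₀) (hx : Continuous x) :
    Continuous fun r => cC (x r) • dg n B + sP (x r) • X r + sM (x r) • X₀ r := by
  have a1 : Continuous fun q => cC (x q) := cC_cont.comp hx
  have a2 : Continuous fun q => sP (x q) := sP_cont.comp hx
  have a3 : Continuous fun q => sM (x q) := sM_cont.comp hx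
  exact ((a1.smul continuous_const).add (a2.smul hX)).add (a3.smul hX₀)

lemma zend {x : unitInterval} (h : x = 0 ∨ x = 1) : (x : ℝ) ≤ 1/4 ∨ 3/4 ≤ (x : ℝ) := by
  rcases h with rfl | rfl
  · left; norm_num
  · right; norm_num

lemma cyl [TopologicalSpace Q] (cB : Ctx G B C) (cC' : Ctx (insert B G) C D) {X : Q → MB n ι} {X₀ : MB n ι}
    (h : PF bd (insert B G) X (fun _ => X₀)) :
    PEq (bdI bd) G B C (fun z => cC z.2 • dg n B + sP z.2 • X z.1 + sM z.2 • X₀)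
      (fun z => cC z.2 • dg n B + sP z.2 • X₀ + sM z.2 • X₀)
      (bet B C (NN D C X (fun _ => X₀))) (fun _ => dg _ B) := by
  have c0 := cB.J
  have hr := h.rho
  rcases isEmpty_or_nonempty Q with hQ | ⟨⟨q₀⟩⟩
  · refine ⟨_, _, inferInstance, inferInstance, inferInstance, inferInstance, Equiv.sumComm _ _, ?_⟩
    exact ⟨fun p => (hQ.false p.2.1).elim, continuous_of_const fun p => (hQ.false p.2.1).elim, fun q => (hQ.false q.1).elim,
      fun q => (hQ.false q.1).elim, fun p => (hQ.false p.2.1).elim, fun t q => (hQ.false q.1).elim⟩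
  have hX₀ : GLs (insert B G) X₀ := h.r.gls q₀
  have g0 : Os (insert B G) (rho X₀) := rho_os hX₀
  have p0 := pth_g (Q := Q) h.r
  have p1 := pth_g h.l
  -- path
  have s1 : PEq (bdI bd) G B C (fun z => cC z.2 • dg n B + sP z.2 • X z.1 + sM z.2 • X₀)
      (fun z => cC z.2 • dg n B + sP z.2 • X₀ + sM z.2 • X₀)
      (fun z => cC z.2 • dg n B + sP z.2 • rho (X z.1) + sM z.2 • rho X₀)
      (fun z => cC z.2 • dg n B + sP z.2 • rho X₀ + sM z.2 • rho X₀) := by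
    refine PEq.hom cB (fun z => cC z.2.2 • dg n B + sP z.2.2 • pth X (z.1, z.2.1) + sM z.2.2 • pth (fun _ : Q => X₀) (z.1, z.2.1))
      (fun z => cC z.2.2 • dg n B + sP z.2.2 • pth (fun _ : Q => X₀) (z.1, z.2.1) + sM z.2.2 • pth (fun _ : Q => X₀) (z.1, z.2.1))
      ⟨cylC (p1.cont.comp (by fun_prop)) (p0.cont.comp (by fun_prop)) (by fun_prop), fun z => cs_gls2 c0 (p1.gls _) (p0.gls _) _⟩
      ⟨cylC (p0.cont.comp (by fun_prop)) (p0.cont.comp (by fun_prop)) (by fun_prop), fun z => cs_gls2 c0 (p0.gls _) (p0.gls _) _⟩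
      ?_ ?_ ?_ ?_ ?_
    · rintro t ⟨q, x⟩ (hz | hz)
      · have := h.eq q hz
        simp only [pth, this]
      · obtain ⟨h1, h2, h3, h4⟩ := end_vals (zend hz)
        simp only at h1 h2 h3
        simp only [h1, h2, h3, zero_smul]
    all_goals intro z; simp [pth]
  refine s1.trans cB ?_
  let Y : Q × unitInterval → MB n ι := fun z => cC z.2 • dg n B + sP z.2 • kc D (rho X₀) + sM z.2 • kc D (rho X₀)
  have kD : Os (insert B G) (kc D (rho X₀)) := g0.kc cC'.k
  have hY : GFam G Y := ⟨cylC continuous_const continuous_const (by fun_prop), fun z => cs_gls2 c0 kD.gls kD.gls _⟩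
  have hp : PF (bdI bd) G (fun z : Q × unitInterval => cC z.2 • dg n B + sP z.2 • rho (X z.1) + sM z.2 • rho X₀)
      (fun z => cC z.2 • dg n B + sP z.2 • rho X₀ + sM z.2 • rho X₀) := by
    refine ⟨⟨cylC (hr.l.cont.comp continuous_fst) continuous_const (by fun_prop), fun z => cs_gls2 c0 (hr.l.gls _) g0.gls _⟩,
      ⟨cylC continuous_const continuous_const (by fun_prop), fun z => cs_gls2 c0 g0.gls g0.gls _⟩, ?_⟩
    rintro ⟨q, x⟩ (hz | hz)
    · have := h.eq q hz
      simp only [this]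
    · obtain ⟨h1, h2, h3, h4⟩ := end_vals (zend hz)
      simp only at h1 h2 h3
      simp only [h1, h2, h3, zero_smul]
  refine PEq.trans cB (PEq.symm (PEq.add cB hp hY)) ?_
  have hp2 : PF (bdI bd) G _ _ := ⟨hp.l.dsum hY, hp.r.dsum hY, fun z hz => by rw [hp.eq z hz]⟩
  have Z := Zb_un cC' g0
  have ZG : Un G (Zb D C (rho X₀)) := Z.mono (Set.subset_insert _ _)
  refine PEq.trans cB (PEq.conj cB hp2 (U := fun _ => Zb D C (rho X₀)) continuous_const (fun _ => ZG)) ?_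
  have hp3 := hp2.conj (U := fun _ => Zb D C (rho X₀)) continuous_const (fun _ => ZG)
  have c1 := cC'.J
  have cth : Continuous fun z : Q × unitInterval => Gr (n ⊕ n) B C (1 * th z.2) := Gr_cont.comp (by have := th_cont; fun_prop)
  refine PEq.trans cB (PEq.conj cB hp3 (U := fun z => Gr (n ⊕ n) B C (1 * th z.2)) cth (fun _ => Gr_un c0 c1 _)) ?_
  have hp4 := hp3.conj (U := fun z => Gr (n ⊕ n) B C (1 * th z.2)) cth (fun _ => Gr_un c0 c1 _)
  have key : ∀ (F : MB n ι) (x : ℝ), Zb D C (rho X₀) * dsum (cC x • dg n B + sP x • F + sM x • rho X₀)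
      (cC x • dg n B + sP x • kc D (rho X₀) + sM x • kc D (rho X₀)) * star (Zb D C (rho X₀)) = bcl B C (Nb D C F (rho X₀)) x := by
    intro F x
    have e1 : Zb D C (rho X₀) * dsum (rho X₀) (kc D (rho X₀)) * star (Zb D C (rho X₀)) = dg _ C := Nb_self cC' g0
    have e2 : Zb D C (rho X₀) * dg _ B * star (Zb D C (rho X₀)) = dg _ B := by
      rw [Z.comm B (by simp), mul_assoc, Z.r, mul_one]
    rw [← dsum_add, ← dsum_add, ← dsum_smul, ← dsum_smul, ← dsum_smul, dsum_dg]
    simp only [mul_add, add_mul, mul_smul_comm, smul_mul_assoc, e1, e2]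
    rfl
  have fE : ∀ z : Q × unitInterval, Gr (n ⊕ n) B C (1 * th z.2) * (Zb D C (rho X₀) * dsum (cC z.2 • dg n B + sP z.2 • rho (X z.1) + sM z.2 • rho X₀)
      (Y z) * star (Zb D C (rho X₀))) * star (Gr (n ⊕ n) B C (1 * th z.2)) = bet B C (NN D C X (fun _ => X₀)) z := by
    intro z; simp only [Y, key]; rfl
  have fE0 : ∀ z : Q × unitInterval, Gr (n ⊕ n) B C (1 * th z.2) * (Zb D C (rho X₀) * dsum (cC z.2 • dg n B + sP z.2 • rho X₀ + sM z.2 • rho X₀)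
      (Y z) * star (Zb D C (rho X₀))) * star (Gr (n ⊕ n) B C (1 * th z.2)) = dg _ B := by
    intro z; simp only [Y, key]
    rw [Nb_self cC' g0]; exact bb_J c0 c1 _
  simp only [fE, fE0] at hp4 ⊢
  exact PEq.refl cB hp4
end cyl
end BottP

set_option linter.all false
set_option autoImplicit false
set_option linter.unusedSectionVars false
set_option linter.unusedSimpArgs false
namespace BottP
open Matrix Topology

section u0
variable {n ι : Type} [Fintype ι] [DecidableEq ι]
  [Fintype n] [DecidableEq n] {G : Set (Matrix ι ι ℝ)} {A B C D : Matrix ι ι ℝ}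

def JJ (n : Type) [Fintype n] [DecidableEq n] (B : Matrix ι ι ℝ) : MB (n ⊕ n) ι := Dop B 0 1 0
def U0 (n : Type) [Fintype n] [DecidableEq n] (B C : Matrix ι ι ℝ) : MB (n ⊕ n) ι := dsum 1 (dg n (C * B)) * rot n ι (-(Real.pi/4))

lemma U0_un (c : Ctx G B C) : Un G (U0 n B C) := by
  refine (Un.one.dsum ⟨?_, ?_, ?_⟩).mul (rot_un _ _)
  · rw [dg_star, ← dg_mul, star_mul, c.k.skew, c.J.skew, neg_mul_neg, mul_assoc, ← mul_assoc C, c.k.sq]; simp [c.J.sq, dg_one]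
  · rw [dg_star, ← dg_mul, star_mul, c.k.skew, c.J.skew, neg_mul_neg, mul_assoc, ← mul_assoc B, c.J.sq]; simp [c.k.sq, dg_one]
  · intro g hg
    rw [dg_mul, comm2 ((c.k.os (m := n)).anti g hg) ((c.J.os (m := n)).anti g hg)]

lemma U0_J (c : Ctx G B C) : U0 n B C * JJ n B * star (U0 n B C) = dg (n ⊕ n) B := by
  have hs : Real.sin (Real.pi/4) * Real.sin (Real.pi/4) = 1/2 := by
    rw [Real.sin_pi_div_four]; nlinarith [Real.mul_self_sqrt (show (0:ℝ) ≤ 2 by norm_num)]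
  have hc : Real.cos (Real.pi/4) = Real.sin (Real.pi/4) := by rw [Real.sin_pi_div_four, Real.cos_pi_div_four]
  have e : rot n ι (-(Real.pi/4)) * JJ n B * star (rot n ι (-(Real.pi/4))) = dsum (dg n B) (-dg n B) := by
    rw [rot, star_eq_conjTranspose, fromBlocks_conjTranspose, JJ, Dop, fromBlocks_multiply, fromBlocks_multiply, dsum]
    simp only [← star_eq_conjTranspose, Real.cos_neg, Real.sin_neg, hc, star_smul, star_one, star_trivial, mul_zero, zero_mul,
      add_zero, zero_add, one_mul, mul_one, smul_mul_assoc, mul_smul_comm, smul_smul, neg_smul, neg_neg, neg_mul, mul_neg, hs, smul_neg, star_neg]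
    congr 1
    all_goals module
  have e2 : C * B * (-B) * star (C * B) = B := by
    rw [star_mul, c.k.skew, c.J.skew, neg_mul_neg, mul_neg, mul_assoc C, c.J.sq, mul_neg, neg_neg, mul_one, ← mul_assoc, c.kJ, neg_mul,
      mul_assoc, c.k.sq]; simp
  calc _ = dsum 1 (dg n (C * B)) * (rot n ι (-(Real.pi/4)) * JJ n B * star (rot n ι (-(Real.pi/4)))) * star (dsum 1 (dg n (C * B))) := by
        rw [U0, star_mul]; simp only [mul_assoc]
    _ = _ := by
      rw [e, dsum_star, dsum_mul, dsum_mul, ← dg_neg, dg_star, ← dg_mul, ← dg_mul, e2]; simp [dsum_dg]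

lemma conj_ins (c : Ctx G B C) {X : MB (n ⊕ n) ι} (hX : GLs G X) (ha : X * JJ n B = -(JJ n B * X)) :
    GLs (insert B G) (U0 n B C * X * star (U0 n B C)) := by
  have hU := U0_un (n := n) c
  have h := hU.conjG hX
  refine ⟨⟨h.skew, ?_⟩, h.unit⟩
  rintro g (rfl | hg)
  · rw [← U0_J c]
    calc _ = U0 n g C * X * (star (U0 n g C) * U0 n g C) * JJ n g * star (U0 n g C) := by simp only [mul_assoc]
      _ = U0 n g C * (X * JJ n g) * star (U0 n g C) := by rw [hU.l, mul_one]; simp only [mul_assoc]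
      _ = -(U0 n g C * JJ n g * (star (U0 n g C) * U0 n g C) * X * star (U0 n g C)) := by
        rw [ha, hU.l, mul_one, mul_neg, neg_mul]; simp only [mul_assoc]
      _ = _ := by simp only [mul_assoc]
  · exact h.anti g hg
end u0

section tb
variable {n ι : Type} [Fintype ι] [DecidableEq ι]
  [Fintype n] [DecidableEq n] {G : Set (Matrix ι ι ℝ)} {A B C D : Matrix ι ι ℝ} {U F : MB n ι}

def Tb (B : Matrix ι ι ℝ) (U F : MB n ι) (c s s' b μ a : ℝ) : MB (n ⊕ n) ι :=
  Dop B (s • F + s' • dg n B + b • (wU U * dg n B)) (c • 1 + μ • wU U + a • AU U) (s • F + s' • dg n B + b • (wU U * dg n B))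

lemma wA_comm' (hU : Un G U) {g : Matrix ι ι ℝ} (hg : U * dg n g = dg n g * U) :
    wU U * dg n g = dg n g * wU U ∧ AU U * dg n g = dg n g * AU U := by
  have h2 := hU.comm' hg
  constructor
  · simp only [wU, sub_mul, mul_sub, one_mul, mul_one, smul_mul_assoc, mul_smul_comm, add_mul, mul_add, hg, h2]
  · simp only [AU, sub_mul, mul_sub, one_mul, mul_one, smul_mul_assoc, mul_smul_comm, add_mul, mul_add, hg, h2]

lemma wB_sk (hB : Cx G B) (hU : Un (insert B G) U) : Sk G (wU U * dg n B) where
  skew := by rw [star_mul, wU_sa, (hB.os (m := n)).skew, (wA_comm' hU (hU.comm B (by simp))).1, neg_mul]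
  anti g hg := by
    rw [mul_assoc, (hB.os (m := n)).anti g hg, mul_neg, ← mul_assoc, (wA_comm' hU (hU.comm g (by simp [hg]))).1, mul_assoc]

lemma Tb_sk (hB : Cx G B) (hU : Un (insert B G) U) (hF : Os G F) (c s s' b μ a : ℝ) : Sk G (Tb B U F c s s' b μ a) := by
  have hR := ((hF.toSk.smul s).add ((hB.os (m := n)).toSk.smul s')).add ((wB_sk hB hU).smul b)
  refine Dop_sk hB hR hR ?_ ?_
  · intro g hg
    have h := wA_comm' hU (hU.comm g (by simp [hg]))
    simp only [add_mul, mul_add, smul_mul_assoc, mul_smul_comm, one_mul, mul_one, h.1, h.2]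
  · intro g hg
    have h := wA_comm' hU (hU.comm g (by simp [hg]))
    simp only [star_add, star_smul, star_trivial, star_one, wU_sa, AU_sk, add_mul, mul_add, smul_mul_assoc, mul_smul_comm, one_mul, mul_one, h.1, h.2,
      smul_neg, neg_mul, mul_neg]

lemma Tb_gls (hB : Cx G B) (hU : Un (insert B G) U) (hF : Os G F) (hs : Sm (1/4) (U * F - F * U)) {c s s' b μ a : ℝ}
    (h0 : s * s' = 0) (h1 : c * c + s * s + s' * s' = 1) (h2 : a * a = μ * μ + b * b)
    (s0 : 0 ≤ s) (s0' : 0 ≤ s') (b0 : 0 ≤ b) (a1 : |a| ≤ 1) (h3 : 0 ≤ c * μ - (s + s') * b + a * a) : GLs G (Tb B U F c s s' b μ a) := by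
  refine ⟨Tb_sk hB hU hF _ _ _ _ _ _, Dop_unit hB fun x y e1 e2 => ?_⟩
  have hc := hU.comm B (by simp)
  rcases mul_eq_zero.mp h0 with h | h
  · rw [h, zero_smul, zero_add] at e1 e2
    exact E2 hU.l hU.r (hB.os (m := n)).sc (hB.os (m := n)).sc hc (by rw [hc]; exact Sm_self (by norm_num) _) (by rw [h] at h1; linarith) h2 s0' b0 a1
      (by rw [h] at h3; linarith) e1 e2
  · rw [h, zero_smul, add_zero] at e1 e2
    exact E2 hU.l hU.r (hB.os (m := n)).sc hF.sc hc hs (by rw [h] at h1; linarith) h2 s0 b0 a1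
      (by rw [h] at h3; linarith) e1 e2

lemma TbC {R : Type} [TopologicalSpace R] {F : R → MB n ι} {c s s' b μ a : R → ℝ} (hF : Continuous F) (hc : Continuous c)
    (hs : Continuous s) (hs' : Continuous s') (hb : Continuous b) (hμ : Continuous μ) (ha : Continuous a) :
    Continuous fun r => Tb B U (F r) (c r) (s r) (s' r) (b r) (μ r) (a r) := by
  have h1 : Continuous fun r => s r • F r + s' r • dg n B + b r • (wU U * dg n B) :=
    ((hs.smul hF).add (hs'.smul continuous_const)).add (hb.smul continuous_const)
  exact Dop_cont h1 (((hc.smul continuous_const).add (hμ.smul continuous_const)).add (ha.smul continuous_const)) h1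

def Xb (B : Matrix ι ι ℝ) (U F : MB n ι) : MB (n ⊕ n) ι := Tb B U F 0 1 0 1 0 1
lemma Tb_end (c s s' : ℝ) : Tb B U F c s s' (s + s') 0 (s + s') = c • JJ n B + s • Xb B U F + s' • Xb B U (dg n B) := by
  simp only [Tb, Xb, JJ, Dop, fromBlocks_smul, fromBlocks_add]
  congr 1
  · simp only [smul_zero, zero_smul, zero_add, add_zero]; module
  · simp only [star_add, star_smul, star_one, star_trivial, add_mul, smul_mul_assoc, zero_smul, zero_add, add_zero]; module
  · simp only [mul_add, mul_smul_comm, zero_smul, zero_add, add_zero]; module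
  · simp only [smul_zero, zero_smul, zero_add, add_zero, mul_add, add_mul, mul_smul_comm, smul_mul_assoc, mul_zero, zero_mul]; module
lemma Xb_gls (hB : Cx G B) (hU : Un (insert B G) U) (hF : Os G F) (hs : Sm (1/4) (U * F - F * U)) : GLs G (Xb B U F) :=
  Tb_gls hB hU hF hs (by norm_num) (by norm_num) (by norm_num) (by norm_num) (by norm_num) (by norm_num) (by norm_num) (by norm_num)
lemma Xb_J (hB : Cx G B) (hU : Un (insert B G) U) : Xb B U F * JJ n B = -(JJ n B * Xb B U F) := by
  have h := (wA_comm' hU (hU.comm B (by simp))).2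
  have h2 := (hB.os (m := n)).sq
  simp only [Xb, Tb, JJ, Dop, fromBlocks_multiply, fromBlocks_neg]
  simp only [zero_smul, one_smul, zero_add, add_zero, star_one, one_mul, mul_one, AU_sk, zero_mul, mul_zero, mul_assoc, h2, mul_neg, neg_mul]
  simp only [← mul_assoc, h2]
  congr 1 <;> simp [h]
  all_goals first | (rw [← neg_mul]; congr 1; abel) | (rw [mul_assoc, h, ← mul_assoc, h2]; simp)
end tb
end BottP

set_option linter.all false
set_option autoImplicit false
set_option linter.unusedSectionVars false
set_option linter.unusedSimpArgs false
namespace BottP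
open Matrix Topology

section rotn
def rr (s : ℝ) : ℝ := 1 + 4 * ((1 - s) * s)
def ru (s x t : ℝ) : ℝ := 1/2 + rr s * ((1 - s) * (x - 1/2) - s * (t - 1/2))
def rv (s x t : ℝ) : ℝ := 1/2 + rr s * (s * (x - 1/2) + (1 - s) * (t - 1/2))
lemma ru_cont : Continuous fun z : ℝ × ℝ × ℝ => ru z.1 z.2.1 z.2.2 := by unfold ru rr; fun_prop
lemma rv_cont : Continuous fun z : ℝ × ℝ × ℝ => rv z.1 z.2.1 z.2.2 := by unfold rv rr; fun_prop
lemma r_bd {s x t : ℝ} (s0 : 0 ≤ s) (s1 : s ≤ 1) (h : x = 0 ∨ x = 1 ∨ t = 0 ∨ t = 1) :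
    (ru s x t ≤ 0 ∨ 1 ≤ ru s x t) ∨ (rv s x t ≤ 0 ∨ 1 ≤ rv s x t) := by
  by_contra hc
  push Not at hc
  obtain ⟨⟨h1, h2⟩, h3, h4⟩ := hc
  have c0 : 0 ≤ 1 - s := by linarith
  have hk : 1 ≤ rr s * ((1 - s) * (1 - s) + s * s) := by
    unfold rr
    have : 0 ≤ (1 - s) * s := mul_nonneg c0 s0
    have h4 : (1 - s) * s ≤ 1/4 := by nlinarith [sq_nonneg (s - 1/2)]
    nlinarith
  set k := rr s * ((1 - s) * (1 - s) + s * s)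
  have eX : k * (x - 1/2) = (1 - s) * (ru s x t - 1/2) + s * (rv s x t - 1/2) := by simp only [k, ru, rv]; ring
  have eT : k * (t - 1/2) = (1 - s) * (rv s x t - 1/2) - s * (ru s x t - 1/2) := by simp only [k, ru, rv]; ring
  set a := ru s x t
  set b := rv s x t
  have ha : 0 ≤ (1-s) * a ∧ 0 ≤ s * a := ⟨mul_nonneg c0 h1.le, mul_nonneg s0 h1.le⟩
  have hb : 0 ≤ (1-s) * b ∧ 0 ≤ s * b := ⟨mul_nonneg c0 h3.le, mul_nonneg s0 h3.le⟩
  have ha' : 0 ≤ (1-s) * (1-a) ∧ 0 ≤ s * (1-a) := ⟨mul_nonneg c0 (by linarith), mul_nonneg s0 (by linarith)⟩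
  have hb' : 0 ≤ (1-s) * (1-b) ∧ 0 ≤ s * (1-b) := ⟨mul_nonneg c0 (by linarith), mul_nonneg s0 (by linarith)⟩
  have z1 : 0 < (1 - s) * a + s * b := by
    rcases s0.eq_or_lt with e | e
    · rw [← e]; linarith
    · have := mul_pos e h3; linarith
  have z2 : 0 < (1 - s) * (1-a) + s * (1-b) := by
    rcases s0.eq_or_lt with e | e
    · rw [← e]; linarith
    · have := mul_pos e (show 0 < 1 - b by linarith); linarith
  have z3 : 0 < (1 - s) * b + s * (1 - a) := by
    rcases s0.eq_or_lt with e | e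
    · rw [← e]; linarith
    · have := mul_pos e (show 0 < 1 - a by linarith); linarith
  have z4 : 0 < (1 - s) * (1-b) + s * a := by
    rcases s0.eq_or_lt with e | e
    · rw [← e]; linarith
    · have := mul_pos e h1; linarith
  rcases h with rfl | rfl | rfl | rfl <;> nlinarith
end rotn

section surj
variable {Q : Type} {bd : Set Q} {m ι : Type} [Fintype m] [DecidableEq m] [Fintype ι] [DecidableEq ι]
  {G : Set (Matrix ι ι ℝ)} {A B C D : Matrix ι ι ℝ}

def PI (u : ℝ) : unitInterval := Set.projIcc 0 1 zero_le_one u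
lemma PI_cont : Continuous PI := continuous_projIcc (h := zero_le_one)
lemma PI_end {u : ℝ} (h : u ≤ 0 ∨ 1 ≤ u) : PI u = 0 ∨ PI u = 1 := by
  rcases h with h | h
  · left; exact Set.projIcc_of_le_left _ h
  · right; exact Set.projIcc_of_right_le _ h
lemma PI_coe (x : unitInterval) : PI x = x := Set.projIcc_val zero_le_one x

def KK (A B : Matrix ι ι ℝ) (f : Q × unitInterval → MB m ι) (s : ℝ) (q : Q) (x t : ℝ) : MB m ι :=
  bb A B 1 (f (q, PI (ru s x t))) (rv s x t)

lemma KK_bd (c0 : Cx G A) (c1 : Cx (insert A G) B) [TopologicalSpace Q] {f : Q × unitInterval → MB m ι} (hf : Based (bdI bd) (insert A G) B f)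
    {s : ℝ} (s0 : 0 ≤ s) (s1 : s ≤ 1) {q : Q} {x t : ℝ} (h : q ∈ bd ∨ x = 0 ∨ x = 1 ∨ t = 0 ∨ t = 1) :
    KK A B f s q x t = dg m A := by
  rcases h with h | h
  · rw [KK, hf.base _ (Or.inl h), bb_J c0 c1]
  · rcases r_bd s0 s1 h with h | h
    · rw [KK, hf.base _ (Or.inr (PI_end h)), bb_J c0 c1]
    · rw [KK, bb_end]
      rcases h with h | h
      · left; linarith
      · right; linarith

lemma KKC [TopologicalSpace Q] {R : Type} [TopologicalSpace R] {f : Q × unitInterval → MB m ι} (hf : Continuous f) {s x t : R → ℝ} {q : R → Q}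
    (hs : Continuous s) (hx : Continuous x) (ht : Continuous t) (hq : Continuous q) : Continuous fun r => KK A B f (s r) (q r) (x r) (t r) := by
  have h1 : Continuous fun r => ru (s r) (x r) (t r) := ru_cont.comp (hs.prodMk (hx.prodMk ht))
  have h2 : Continuous fun r => rv (s r) (x r) (t r) := rv_cont.comp (hs.prodMk (hx.prodMk ht))
  exact bbC continuous_const (hf.comp (hq.prodMk (PI_cont.comp h1))) h2

/-- step 1 and 2 -/
lemma surj1 [PseudoMetricSpace Q] [CompactSpace Q] (c0 : Cx G A) (cB : Ctx (insert A G) B C) {f : Q × unitInterval → MB m ι}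
    (hf : Based (bdI bd) (insert A G) B f) : ∃ p₀ : ℕ, ∀ p, p₀ ≤ p → ∀ [NeZero (2 * p)],
      PEq (bdI bd) (insert A G) B C f (fun _ => dg m B)
        (fun z => alp (cyc (2*p)) A B (fun _ => 1) (fun j => bb A B 1 (f (z.1, unitInterval.symm (pt (2*p) j))) z.2))
        (fun z => alp (cyc (2*p)) A B (fun _ => 1) (fun j => bb A B 1 (dg m B) z.2)) := by
  have c1 := cB.J
  obtain ⟨p1, hp1⟩ := thmA c0 cB hf
  obtain ⟨N₀, hN⟩ := fine (Q := unitInterval × Q × unitInterval) (f := fun z => KK A B f z.1.1 z.1.2.1 z.1.2.2 z.2)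
    (KKC hf.cont (by fun_prop) (by fun_prop) (by fun_prop) (by fun_prop))
    (fun z => by
      rw [KK_bd c0 c1 hf z.1.2.1 z.1.2.2 (by simp), KK_bd c0 c1 hf z.1.2.1 z.1.2.2 (by simp)]) (η := 1/4) (by norm_num)
  refine ⟨p1 + N₀, fun p hp _ => ?_⟩
  refine (PEq.symm (hp1 p (by omega))).trans cB ?_
  simp only [aB, bb_J c0 c1]
  refine PEq.hom cB (fun z => alp (cyc (2*p)) A B (fun _ => 1) (fun j => KK A B f z.1 z.2.1 z.2.2 (pt (2*p) j)))
    (fun z => alp (cyc (2*p)) A B (fun _ => 1) (fun j => dg _ A)) ⟨?_, ?_⟩ ⟨continuous_const, fun _ => alp_const _ c0 c1 c0.os⟩ ?_ ?_ ?_ ?_ ?_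
  · exact alp_cont _ (fun j => continuous_const) (fun j => KKC hf.cont (by fun_prop) (by fun_prop) (by fun_prop) (by fun_prop))
  · intro z
    exact alp_gls _ c0 c1 (fun j => bb_os c0 c1 (hf.os _) _ _) (fun j => by simp) (fun j => Or.inl rfl) (fun j => hN (2*p) (by omega) z j)
  · rintro t ⟨q, x⟩ hz
    have : ∀ j, KK A B f t q x (pt (2*p) j) = dg _ A := fun j => KK_bd c0 c1 hf t.2.1 t.2.2 (by
      rcases hz with h | h | h
      · exact Or.inl h
      · simp only at h; subst h; simp
      · simp only at h; subst h; simp)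
    simp only [this]
  · rintro ⟨q, x⟩
    simp only [KK, ru, rv, rr, Set.Icc.coe_zero, sub_zero, mul_zero, add_zero, one_mul, zero_mul, zero_add, add_sub_cancel, PI_coe]
  · intro z; rfl
  · rintro ⟨q, x⟩
    have : ∀ t : unitInterval, PI (ru 1 x t) = unitInterval.symm t := fun t => by
      rw [← PI_coe (unitInterval.symm t)]; congr 1; simp only [ru, rr, unitInterval.coe_symm_eq]; ring
    have h2 : ∀ t : ℝ, rv 1 x t = x := fun t => by simp only [rv, rr]; ring
    simp only [KK, Set.Icc.coe_one, this, h2]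
  · intro z; rfl

/-- step 3 -/
lemma surj2 [PseudoMetricSpace Q] [CompactSpace Q] (c0 : Cx G A) (cB : Ctx (insert A G) B C) {f : Q × unitInterval → MB m ι}
    (hf : Based (bdI bd) (insert A G) B f) : ∃ p₀ : ℕ, ∀ p, p₀ ≤ p → ∀ [NeZero (2 * p)],
      PEq (bdI bd) (insert A G) B C f (fun _ => dg m B)
        (fun z => alp (cyc (2*p)) A B (fun _ => 1) (fun j => bcl A B (f (z.1, unitInterval.symm (pt (2*p) j))) z.2))
        (fun z => alp (cyc (2*p)) A B (fun _ => 1) (fun j => bcl A B (dg m B) z.2)) := by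
  have c1 := cB.J
  obtain ⟨p1, hp1⟩ := surj1 c0 cB hf
  have fc : Continuous fun z : (unitInterval × Q × unitInterval) × unitInterval => bb A B (unitInterval.symm z.1.1 : ℝ) (f (z.1.2.1, unitInterval.symm z.2)) z.1.2.2 :=
    bbC (by fun_prop) (hf.cont.comp (by fun_prop)) (by fun_prop)
  obtain ⟨N₀, hN⟩ := fine (Q := unitInterval × Q × unitInterval) fc
    (fun z => by
      rw [hf.base _ (by right; simp), hf.base _ (by right; simp)]) (η := 1/4) (by norm_num)
  refine ⟨p1 + N₀, fun p hp _ => ?_⟩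
  refine (hp1 p (by omega)).trans cB ?_
  refine PEq.hom cB (fun z => alp (cyc (2*p)) A B (fun _ => 1) (fun j => bb A B (unitInterval.symm z.1 : ℝ) (f (z.2.1, unitInterval.symm (pt (2*p) j))) z.2.2))
    (fun z => alp (cyc (2*p)) A B (fun _ => 1) (fun j => bb A B (unitInterval.symm z.1 : ℝ) (dg m B) z.2.2)) ⟨?_, ?_⟩
      ⟨?_, fun z => alp_const _ c0 c1 (bb_os c0 c1 c1.os _ _)⟩ ?_ ?_ ?_ ?_ ?_
  · exact alp_cont _ (fun j => continuous_const) (fun j => bbC (by fun_prop) (hf.cont.comp (by fun_prop)) (by fun_prop))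
  · intro z
    exact alp_gls _ c0 c1 (fun j => bb_os c0 c1 (hf.os _) _ _) (fun j => by simp) (fun j => Or.inl rfl) (fun j => hN (2*p) (by omega) z j)
  · exact alp_cont _ (fun j => continuous_const) (fun j => bbC (by fun_prop) continuous_const (by fun_prop))
  · rintro t ⟨q, x⟩ (hz | hz)
    · have hb : ∀ y, f (q, y) = dg m B := fun y => hf.base (q, y) (Or.inl hz)
      simp only [hb]
    · simp only [bb_end _ _ (zend hz)]
  all_goals intro z; simp [bb_zero]

lemma alp_Tb (c0 : Cx G A) (c1 : Cx (insert A G) B) {L : Type} [Fintype L] [DecidableEq L] (σ : Equiv.Perm L) {f : L → MB m ι}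
    (hf : ∀ j, Os (insert A G) (f j)) (x : ℝ) : alp σ A B (fun _ => 1) (fun j => bcl A B (f j) x) =
      Tb B (shU m ι σ) (bdg f) (cC x) (sP x) (sM x) 0 1 1 := by
  have e1 : om m ι (fun _ : L => (1:ℝ)) = 1 := by simp only [om, one_smul, bdg_one]
  have e2 : aM (bdg fun j => bcl A B (f j) x) (dg _ A) = sP x • bdg f + sM x • dg _ B + (0:ℝ) • (wU (shU m ι σ) * dg _ B) := by
    rw [aM_bdg]
    simp only [bcl_aM c0 c1 (hf _), zero_smul, add_zero, ← bdg_dg, bdg_smul, bdg_add]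
  have e3 : dM (bdg fun j => bcl A B (f j) x) (dg _ A) - om m ι (fun _ : L => (1:ℝ)) * shU m ι σ =
      cC x • 1 + (1:ℝ) • wU (shU m ι σ) + (1:ℝ) • AU (shU m ι σ) := by
    rw [dM_bdg, e1, one_mul]
    simp only [bcl_dM c0 c1 (hf _), ← bdg_smul, bdg_one, wU, AU]
    module
  rw [alp, e2, e3, Tb]

theorem bet_surj [PseudoMetricSpace Q] [CompactSpace Q] (c0 : Cx G A) (cB : Ctx (insert A G) B C) (cC' : Ctx (insert B (insert A G)) C D)
    {f : Q × unitInterval → MB m ι} (hf : Based (bdI bd) (insert A G) B f) :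
    ∃ (n : Type) (_ : Fintype n) (_ : DecidableEq n) (g : Q → MB n ι), Based bd (insert B (insert A G)) C g ∧
      SEq (bdI bd) (insert A G) B f (bet B C g) := by
  have c1 := cB.J
  obtain ⟨p1, hp1⟩ := surj2 c0 cB hf
  obtain ⟨N₀, hN⟩ := fine (f := fun z : Q × unitInterval => f (z.1, unitInterval.symm z.2)) (hf.cont.comp (by fun_prop))
    (fun z => by rw [hf.base _ (by right; simp), hf.base _ (by right; simp)]) (η := 1/4) (by norm_num)
  let p := p1 + N₀ + 1
  haveI : NeZero (2 * p) := ⟨by omega⟩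
  have s1 := hp1 p (by omega)
  have hN' := hN (2 * p) (by omega)
  let U := shU m ι (cyc (2*p))
  let F : Q → MB (m × Fin (2*p)) ι := fun q => bdg fun j => f (q, unitInterval.symm (pt (2*p) j))
  have hU : Un (insert B (insert A G)) U := ⟨shU_l _, shU_r _, fun g _ => shU_dg _ _⟩
  have hFc : Continuous F := bdg_cont fun j => hf.cont.comp (by fun_prop)
  have hF : ∀ q, Os (insert A G) (F q) := fun q => Os_bdg fun j => hf.os _
  have hFs : ∀ q, Sm (1/4) (U * F q - F q * U) := fun q => by
    simp only [U, F]
    rw [shU_bdg, ← sub_mul, bdg_sub]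
    exact (Sm_bdg fun j => hN' q j).mr (shU_l _)
  have hFb : ∀ q ∈ bd, F q = dg _ B := fun q hq => by
    simp only [F, hf.base (q, _) (Or.inl hq), bdg_dg]
  have hBs : Sm (1/4) (U * dg _ B - dg _ B * U) := by
    rw [hU.comm B (by simp)]; exact Sm_self (by norm_num) _
  have eqA : ∀ z : Q × unitInterval, alp (cyc (2*p)) A B (fun _ => 1) (fun j => bcl A B (f (z.1, unitInterval.symm (pt (2*p) j))) z.2) =
      Tb B U (F z.1) (cC z.2) (sP z.2) (sM z.2) 0 1 1 := fun z => alp_Tb c0 c1 _ (fun j => hf.os _) _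
  have eqA0 : ∀ z : Q × unitInterval, alp (cyc (2*p)) A B (fun _ => 1) (fun j => bcl A B (dg m B) z.2) =
      Tb B U (dg _ B) (cC z.2) (sP z.2) (sM z.2) 0 1 1 := fun z => by
    rw [alp_Tb c0 c1 _ (fun j => c1.os), bdg_dg]
  simp only [eqA, eqA0] at s1
  -- general homotopy
  have gen : ∀ (b μ a : unitInterval × ℝ → ℝ), Continuous b → Continuous μ → Continuous a →
      (∀ t (x : ℝ), a (t,x) * a (t,x) = μ (t,x) * μ (t,x) + b (t,x) * b (t,x) ∧ 0 ≤ b (t,x) ∧ |a (t,x)| ≤ 1 ∧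
        0 ≤ cC x * μ (t,x) - (sP x + sM x) * b (t,x) + a (t,x) * a (t,x)) →
      PEq (bdI bd) (insert A G) B C
        (fun z => Tb B U (F z.1) (cC z.2) (sP z.2) (sM z.2) (b (0,z.2)) (μ (0,z.2)) (a (0,z.2)))
        (fun z => Tb B U (dg _ B) (cC z.2) (sP z.2) (sM z.2) (b (0,z.2)) (μ (0,z.2)) (a (0,z.2)))
        (fun z => Tb B U (F z.1) (cC z.2) (sP z.2) (sM z.2) (b (1,z.2)) (μ (1,z.2)) (a (1,z.2)))
        (fun z => Tb B U (dg _ B) (cC z.2) (sP z.2) (sM z.2) (b (1,z.2)) (μ (1,z.2)) (a (1,z.2))) := by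
    intro b μ a hb hμ ha h
    have xc : Continuous fun z : unitInterval × Q × unitInterval => (z.2.2 : ℝ) := by fun_prop
    have tc : Continuous fun z : unitInterval × Q × unitInterval => (z.1, (z.2.2 : ℝ)) := by fun_prop
    have gl : ∀ {R : MB (m × Fin (2*p)) ι}, Os (insert A G) R → Sm (1/4) (U * R - R * U) → ∀ t x,
        GLs (insert A G) (Tb B U R (cC x) (sP x) (sM x) (b (t,x)) (μ (t,x)) (a (t,x))) := fun hR hs t x =>
      Tb_gls c1 hU hR hs (sPM x) (cs2 x) (h t x).1 (sP0 x) (sM0 x) (h t x).2.1 (h t x).2.2.1 (h t x).2.2.2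
    refine PEq.hom cB (fun z => Tb B U (F z.2.1) (cC z.2.2) (sP z.2.2) (sM z.2.2) (b (z.1,z.2.2)) (μ (z.1,z.2.2)) (a (z.1,z.2.2)))
      (fun z => Tb B U (dg _ B) (cC z.2.2) (sP z.2.2) (sM z.2.2) (b (z.1,z.2.2)) (μ (z.1,z.2.2)) (a (z.1,z.2.2)))
      ⟨TbC (hFc.comp (by fun_prop)) (cC_cont.comp xc) (sP_cont.comp xc) (sM_cont.comp xc) (hb.comp tc) (hμ.comp tc) (ha.comp tc), fun z => gl (hF _) (hFs _) _ _⟩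
      ⟨TbC continuous_const (cC_cont.comp xc) (sP_cont.comp xc) (sM_cont.comp xc) (hb.comp tc) (hμ.comp tc) (ha.comp tc), fun z => gl c1.os hBs _ _⟩
      ?_ (fun _ => rfl) (fun _ => rfl) (fun _ => rfl) (fun _ => rfl)
    rintro t ⟨q, x⟩ (hz | hz)
    · simp only [hFb q hz]
    · have h2 := (end_vals (zend hz)).2.1
      simp only at h2
      simp only [Tb, h2, zero_smul]
  have hsM : ∀ x : ℝ, sP x + sM x ≤ 1 ∧ 0 ≤ sP x + sM x := fun x => by
    have h1 := cs2 x; have h2 := sPM x; have h3 := sP0 x; have h4 := sM0 x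
    constructor
    · nlinarith [mul_self_nonneg (cC x)]
    · linarith
  have s2 := gen (fun z => Real.sin (z.1 * (Real.pi/2))) (fun z => Real.cos (z.1 * (Real.pi/2))) (fun _ => 1)
    (by fun_prop) (by fun_prop) continuous_const (by
      intro t x
      have h1 := cs2 x; have h2 := sPM x
      have h5 := Real.sin_sq_add_cos_sq (t * (Real.pi/2))
      refine ⟨by simp only; nlinarith, ?_, by simp, ?_⟩
      · apply Real.sin_nonneg_of_nonneg_of_le_pi
        · have := t.2.1; have := Real.pi_pos; positivity
        · have := t.2.2; have := Real.pi_pos; nlinarith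
      · simp only
        nlinarith [sq_nonneg (cC x + Real.cos (t * (Real.pi/2))), sq_nonneg (sP x + sM x - Real.sin (t * (Real.pi/2)))])
  have s3 := gen (fun z => 1 - z.1 + z.1 * (sP z.2 + sM z.2)) (fun _ => 0) (fun z => 1 - z.1 + z.1 * (sP z.2 + sM z.2))
    (by have := sP_cont; have := sM_cont; fun_prop) continuous_const (by have := sP_cont; have := sM_cont; fun_prop) (by
      intro t x
      obtain ⟨h1, h2⟩ := hsM x
      have t0 := t.2.1; have t1 := t.2.2
      simp only
      set s := sP x + sM x
      have a0 : 0 ≤ 1 - (t:ℝ) + t * s := by have := mul_nonneg t0 h2; linarith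
      have a1 : 1 - (t:ℝ) + t * s - s = (1 - t) * (1 - s) := by ring
      have a2 : 0 ≤ (1 - (t:ℝ)) * (1 - s) := mul_nonneg (by linarith) (by linarith)
      refine ⟨by ring, a0, ?_, ?_⟩
      · rw [abs_of_nonneg a0]; nlinarith
      · nlinarith [mul_nonneg a0 a2])
  simp only [Set.Icc.coe_zero, Set.Icc.coe_one, zero_mul, one_mul, Real.sin_zero, Real.cos_zero, Real.sin_pi_div_two, Real.cos_pi_div_two,
    sub_zero, add_zero, sub_self, zero_add] at s2 s3
  have s4 := s1.trans cB (s2.trans cB s3)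
  simp only [Tb_end] at s4
  -- conjugation
  let V := U0 (m × Fin (2*p)) B C
  have hV : Un (insert A G) V := U0_un cB
  let X : Q → MB ((m × Fin (2*p)) ⊕ (m × Fin (2*p))) ι := fun q => V * Xb B U (F q) * star V
  let X₀ : MB ((m × Fin (2*p)) ⊕ (m × Fin (2*p))) ι := V * Xb B U (dg _ B) * star V
  have hX : PF bd (insert B (insert A G)) X (fun _ => X₀) := by
    refine ⟨⟨(continuous_const.mul (TbC hFc continuous_const continuous_const continuous_const continuous_const continuous_const continuous_const)).mul continuous_const,
      fun q => conj_ins cB (Xb_gls c1 hU (hF q) (hFs q)) (Xb_J c1 hU)⟩, ⟨continuous_const, fun q => conj_ins cB (Xb_gls c1 hU c1.os hBs) (Xb_J c1 hU)⟩, ?_⟩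
    intro q hq
    simp only [X, X₀, hFb q hq]
  have cy := cyl cB cC' hX
  refine ⟨_, inferInstance, inferInstance, NN D C X (fun _ => X₀), hX.based cC', ?_⟩
  refine PEq.out cB hf (bet_based c1 cC'.J (hX.based cC')) (s4.trans cB (PEq.trans cB ?_ cy))
  have key : ∀ (c s s' : ℝ) (R : MB (m × Fin (2*p)) ι), V * (c • JJ _ B + s • Xb B U R + s' • Xb B U (dg _ B)) * star V =
      c • dg _ B + s • (V * Xb B U R * star V) + s' • X₀ := fun c s s' R => by
    simp only [mul_add, add_mul, mul_smul_comm, smul_mul_assoc, V, U0_J cB, X₀]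
  have hpf : PF (bdI bd) (insert A G) (fun z : Q × unitInterval => cC z.2 • JJ _ B + sP z.2 • Xb B U (F z.1) + sM z.2 • Xb B U (dg _ B))
      (fun z => cC z.2 • JJ _ B + sP z.2 • Xb B U (dg _ B) + sM z.2 • Xb B U (dg _ B)) := by
    have xc : Continuous fun z : Q × unitInterval => (z.2 : ℝ) := by fun_prop
    have b1 := cC_cont.comp xc
    have b2 := sP_cont.comp xc
    have b3 := sM_cont.comp xc
    have gl : ∀ {R : MB (m × Fin (2*p)) ι}, Os (insert A G) R → Sm (1/4) (U * R - R * U) → ∀ x,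
        GLs (insert A G) (Tb B U R (cC x) (sP x) (sM x) (sP x + sM x) 0 (sP x + sM x)) := fun hR hs x =>
      Tb_gls c1 hU hR hs (sPM x) (cs2 x) (by ring) (sP0 x) (sM0 x) (hsM x).2 (by rw [abs_of_nonneg (hsM x).2]; exact (hsM x).1) (by nlinarith)
    simp only [← Tb_end]
    refine ⟨⟨TbC (hFc.comp (by fun_prop)) b1 b2 b3 (b2.add b3) continuous_const (b2.add b3), fun z => gl (hF _) (hFs _) _⟩,
      ⟨TbC continuous_const b1 b2 b3 (b2.add b3) continuous_const (b2.add b3), fun z => gl c1.os hBs _⟩, ?_⟩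
    rintro ⟨q, x⟩ (hz | hz)
    · simp only [hFb q hz]
    · have h2 := (end_vals (zend hz)).2.1
      simp only at h2
      simp only [Tb, h2, zero_smul]
  have := PEq.conj cB hpf (U := fun _ => V) continuous_const (fun _ => hV)
  simp only [key] at this
  exact this
end surj
end BottP

set_option linter.all false
set_option autoImplicit false
set_option linter.unusedSectionVars false
set_option linter.unusedSimpArgs false
namespace BottP
open Matrix Topology

abbrev CI (n : ℕ) := Fin n → unitInterval
abbrev bdc (n : ℕ) : Set (CI n) := Cube.boundary (Fin n)

section homeo
variable {Q R : Type} [TopologicalSpace Q] [TopologicalSpace R] {m m' ι : Type} [Fintype m] [DecidableEq m] [Fintype m'] [DecidableEq m']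
  [Fintype ι] [DecidableEq ι] {G : Set (Matrix ι ι ℝ)} {J : Matrix ι ι ℝ} {bd : Set Q} {bd' : Set R}

lemma Based.pull (φ : C(R, Q)) (hφ : ∀ r ∈ bd', φ r ∈ bd) {F : Q → MB m ι} (h : Based bd G J F) : Based bd' G J (fun r => F (φ r)) where
  cont := h.cont.comp φ.continuous
  os r := h.os _
  base r hr := h.base _ (hφ r hr)

lemma SEq.pull (φ : C(R, Q)) (hφ : ∀ r ∈ bd', φ r ∈ bd) {F : Q → MB m ι} {F' : Q → MB m' ι} (h : SEq bd G J F F') :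
    SEq bd' G J (fun r => F (φ r)) (fun r => F' (φ r)) := by
  obtain ⟨a, a', i1, i2, i3, i4, e, H, hc, h0, h1, ho, hb⟩ := h
  exact ⟨a, a', i1, i2, i3, i4, e, fun z => H (z.1, φ z.2), hc.comp (by fun_prop), fun r => h0 _, fun r => h1 _, fun p => ho _,
    fun t r hr => hb t _ (hφ r hr)⟩
end homeo

/-- concatenation along a coordinate -/
def gl {n : ℕ} {Y : Type} (i : Fin n) (F F' : CI n → Y) : CI n → Y := fun y =>
  if (y i : ℝ) ≤ 1 / 2 then F (Function.update y i <| Set.projIcc 0 1 zero_le_one (2 * y i))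
  else F' (Function.update y i <| Set.projIcc 0 1 zero_le_one (2 * y i - 1))

lemma gl_pos {n : ℕ} {Y : Type} {i : Fin n} {F F' : CI n → Y} {y : CI n} (h : (y i : ℝ) ≤ 1 / 2) :
    gl i F F' y = F (Function.update y i <| Set.projIcc 0 1 zero_le_one (2 * y i)) := if_pos h
lemma gl_neg {n : ℕ} {Y : Type} {i : Fin n} {F F' : CI n → Y} {y : CI n} (h : ¬ (y i : ℝ) ≤ 1 / 2) :
    gl i F F' y = F' (Function.update y i <| Set.projIcc 0 1 zero_le_one (2 * y i - 1)) := if_neg h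

/-- a bijection of stable theories -/
structure Xf {ι ι' : Type} [Fintype ι] [DecidableEq ι] [Fintype ι'] [DecidableEq ι'] (n n' : ℕ) (G : Set (Matrix ι ι ℝ)) (J : Matrix ι ι ℝ)
    (G' : Set (Matrix ι' ι' ℝ)) (J' : Matrix ι' ι' ℝ) : Type 1 where
  T : ∀ {m : Type} [Fintype m] [DecidableEq m], (CI n → MB m ι) → (CI n' → MB m ι')
  based : ∀ {m : Type} [Fintype m] [DecidableEq m] {F : CI n → MB m ι}, Based (bdc n) G J F → Based (bdc n') G' J' (T F)
  seq : ∀ {m m' : Type} [Fintype m] [DecidableEq m] [Fintype m'] [DecidableEq m'] {F : CI n → MB m ι} {F' : CI n → MB m' ι},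
    Based (bdc n) G J F → Based (bdc n) G J F' → (SEq (bdc n) G J F F' ↔ SEq (bdc n') G' J' (T F) (T F'))
  surj : ∀ {m : Type} [Fintype m] [DecidableEq m] {f : CI n' → MB m ι'}, Based (bdc n') G' J' f →
    ∃ (k : Type) (_ : Fintype k) (_ : DecidableEq k) (g : CI n → MB k ι), Based (bdc n) G J g ∧ SEq (bdc n') G' J' f (T g)
  glue : ∀ {m : Type} [Fintype m] [DecidableEq m] (h : 0 < n) (h' : 0 < n') (F F' : CI n → MB m ι),
    T (gl ⟨0, h⟩ F F') = gl ⟨0, h'⟩ (T F) (T F')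

section xf
variable {ι ι' ι'' : Type} [Fintype ι] [DecidableEq ι] [Fintype ι'] [DecidableEq ι'] [Fintype ι''] [DecidableEq ι''] {n n' n'' : ℕ}
  {G : Set (Matrix ι ι ℝ)} {J : Matrix ι ι ℝ} {G' : Set (Matrix ι' ι' ℝ)} {J' : Matrix ι' ι' ℝ}
  {G'' : Set (Matrix ι'' ι'' ℝ)} {J'' : Matrix ι'' ι'' ℝ}

def Xf.refl (hJ : Cx G J) : Xf n n G J G J where
  T F := F
  based h := h
  seq _ _ := Iff.rfl
  surj h := ⟨_, inferInstance, inferInstance, _, h, SEq.refl hJ h.toFam⟩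
  glue _ _ _ _ := rfl

def Xf.comp (hJ : Cx G'' J'') (hn : 0 < n → 0 < n') (x : Xf n n' G J G' J') (y : Xf n' n'' G' J' G'' J'') : Xf n n'' G J G'' J'' where
  T F := y.T (x.T F)
  based h := y.based (x.based h)
  seq h h' := (x.seq h h').trans (y.seq (x.based h) (x.based h'))
  surj h := by
    obtain ⟨k, i1, i2, g, hg, e⟩ := y.surj h
    obtain ⟨k', i1', i2', g', hg', e'⟩ := x.surj hg
    exact ⟨k', i1', i2', g', hg', e.trans hJ ((y.seq hg (x.based hg')).1 e')⟩
  glue h h' F F' := by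
    rw [x.glue h (hn h), y.glue]

def ini {n : ℕ} (y : CI (n+1)) : CI n := fun i => y i.castSucc

lemma ini_bd {y : CI (n+1)} (h : y ∈ bdc (n+1)) : ini y ∈ bdc n ∨ y (Fin.last n) = 0 ∨ y (Fin.last n) = 1 := by
  obtain ⟨i, hi⟩ := h
  induction i using Fin.lastCases with
  | last => right; exact hi
  | cast i => left; exact ⟨i, hi⟩

def toP (n : ℕ) : C(CI (n+1), CI n × unitInterval) := ⟨fun y => (ini y, y (Fin.last n)), by
  unfold ini; fun_prop⟩
def ofP (n : ℕ) : C(CI n × unitInterval, CI (n+1)) := ⟨fun z => Fin.snoc (α := fun _ => unitInterval) z.1 z.2, by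
  refine continuous_pi fun i => ?_
  induction i using Fin.lastCases with
  | last => simp only [Fin.snoc_last]; fun_prop
  | cast i => simp only [Fin.snoc_castSucc]; fun_prop⟩
lemma toP_bd : ∀ r ∈ bdc (n+1), toP n r ∈ bdI (bdc n) := fun r hr => ini_bd hr
lemma ofP_bd : ∀ z ∈ bdI (bdc n), ofP n z ∈ bdc (n+1) := by
  rintro ⟨q, x⟩ (⟨i, hi⟩ | h)
  · exact ⟨i.castSucc, by simpa [ofP] using hi⟩
  · exact ⟨Fin.last n, by simpa [ofP] using h⟩
lemma to_of (z : CI n × unitInterval) : toP n (ofP n z) = z := by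
  ext
  · simp [toP, ofP, ini]
  · simp [toP, ofP]
lemma of_to (y : CI (n+1)) : ofP n (toP n y) = y := by
  funext i
  induction i using Fin.lastCases with
  | last => simp [toP, ofP]
  | cast i => simp [toP, ofP, ini]

lemma gl_ini {Y Z : Type} (Φ : Y → unitInterval → Z) (h : 0 < n) (h' : 0 < n + 1) (F F' : CI n → Y) :
    (fun y : CI (n+1) => Φ (gl ⟨0, h⟩ F F' (ini y)) (y (Fin.last n))) =
      gl ⟨0, h'⟩ (fun y => Φ (F (ini y)) (y (Fin.last n))) (fun y => Φ (F' (ini y)) (y (Fin.last n))) := by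
  funext y
  have h0 : (⟨0, h'⟩ : Fin (n+1)) = Fin.castSucc ⟨0, h⟩ := rfl
  have e1 : ∀ v, ini (Function.update y ⟨0, h'⟩ v) = Function.update (ini y) ⟨0, h⟩ v := by
    intro v; funext i
    simp only [ini, h0, Function.update_apply, Fin.castSucc_inj]
  have e2 : ∀ v, Function.update y ⟨0, h'⟩ v (Fin.last n) = y (Fin.last n) := by
    intro v
    rw [Function.update_of_ne]
    intro hh; have := congrArg Fin.val hh; simp at this; omega
  by_cases hy : (y ⟨0, h'⟩ : ℝ) ≤ 1 / 2
  · rw [gl_pos hy, gl_pos (i := ⟨0, h⟩) (y := ini y) hy]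
    simp only [e1, e2]; rfl
  · rw [gl_neg hy, gl_neg (i := ⟨0, h⟩) (y := ini y) hy]
    simp only [e1, e2]; rfl

def Xf.bott {A B C D : Matrix ι ι ℝ} (c0 : Cx G A) (cB : Ctx (insert A G) B C) (cC' : Ctx (insert B (insert A G)) C D) :
    Xf n (n+1) (insert B (insert A G)) C (insert A G) B where
  T F y := bet B C F (toP n y)
  based h := (bet_based cB.J cC'.J h).pull _ toP_bd
  seq h h' := by
    refine ⟨fun e => (bet_seq cB.J cC'.J h e).pull _ toP_bd, fun e => bet_inj cB.J cC' h h' ?_⟩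
    have := e.pull (ofP n) ofP_bd
    simpa only [to_of] using this
  surj {m _ _ f} h := by
    obtain ⟨k, i1, i2, g, hg, e⟩ := bet_surj c0 cB cC' (h.pull (ofP n) ofP_bd)
    refine ⟨k, i1, i2, g, hg, ?_⟩
    have := e.pull (toP n) toP_bd
    simpa only [of_to] using this
  glue h h' F F' := gl_ini (fun X x => bb B C 1 X (x : ℝ)) h h' F F'
end xf

section cf
variable {ι : Type} [Fintype ι] [DecidableEq ι]
/-- anticommuting family -/
structure CF (N : ℕ) (ε : Matrix ι ι ℝ) (u : ℕ → Matrix ι ι ℝ) : Prop where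
  skew : ∀ i < N, star (u i) = - u i
  sq : ∀ i < N, u i * u i = -1
  anti : ∀ i < N, ∀ j < N, i ≠ j → u i * u j = -(u j * u i)
  eps : ∀ i < N, u i * ε = -(ε * u i)

def GG (ε : Matrix ι ι ℝ) (u : ℕ → Matrix ι ι ℝ) (i : ℕ) : Set (Matrix ι ι ℝ) := {g | g = ε ∨ ∃ j < i, g = u j}
variable {N : ℕ} {ε : Matrix ι ι ℝ} {u : ℕ → Matrix ι ι ℝ}

lemma GG_succ (i : ℕ) : GG ε u (i+1) = insert (u i) (GG ε u i) := by
  ext g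
  simp only [GG, Set.mem_setOf_eq, Set.mem_insert_iff, Nat.lt_succ_iff_lt_or_eq, or_and_right, exists_or]
  simp only [exists_eq_left]
  rw [← or_assoc, or_comm]
lemma GG_zero : GG ε u 0 = {ε} := by
  ext g; simp [GG]
lemma CF.cx (h : CF N ε u) {i j : ℕ} (hi : i < N) (hj : j ≤ i) : Cx (GG ε u j) (u i) where
  skew := h.skew i hi
  sq := h.sq i hi
  anti := by
    rintro g (rfl | ⟨k, hk, rfl⟩)
    · exact h.eps i hi
    · exact h.anti i hi k (by omega) (by omega)
lemma CF.ctx (h : CF N ε u) {i : ℕ} (hi : i + 1 < N) : Ctx (GG ε u i) (u i) (u (i+1)) where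
  k := h.cx hi (by omega)
  kJ := h.anti _ hi _ (by omega) (by omega)
  J := h.cx (by omega) le_rfl

def CF.bott (h : CF N ε u) {i n : ℕ} (hi : i + 3 < N) : Xf n (n+1) (GG ε u (i+2)) (u (i+2)) (GG ε u (i+1)) (u (i+1)) := by
  have a := h.cx (i := i) (j := i) (by omega) le_rfl
  have b := h.ctx (i := i + 1) (by omega)
  have c := h.ctx (i := i + 2) (by omega)
  have e2 := GG_succ (ε := ε) (u := u) (i+1)
  have e1 := GG_succ (ε := ε) (u := u) i
  rw [e2, e1] at c
  rw [e1] at b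
  rw [e2, e1]
  exact Xf.bott a b c

def CF.botts (h : CF N ε u) {n : ℕ} : ∀ (d i : ℕ), i + 2 + d < N →
    Xf n (n+d) (GG ε u (i+1+d)) (u (i+1+d)) (GG ε u (i+1)) (u (i+1))
  | 0, i, hd => Xf.refl (h.cx (by omega) le_rfl)
  | d+1, i, hd => by
    have e : i + 1 + (d + 1) = i + 1 + 1 + d := by omega
    rw [e]
    exact Xf.comp (h.cx (by omega) le_rfl) (by omega) (CF.botts h d (i+1) (by omega)) (h.bott (by omega))
end cf
end BottP

set_option linter.all false
set_option autoImplicit false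
set_option linter.unusedSectionVars false
set_option linter.unusedSimpArgs false
namespace BottP
open Matrix Topology

section mor
variable {ι ι' : Type} [Fintype ι] [DecidableEq ι] [Fintype ι'] [DecidableEq ι'] 
  {G : Set (Matrix ι ι ℝ)} {J : Matrix ι ι ℝ} {G' : Set (Matrix ι' ι' ℝ)} {J' : Matrix ι' ι' ℝ}

structure Mor (G : Set (Matrix ι ι ℝ)) (G' : Set (Matrix ι' ι' ℝ)) (L : Matrix ι ι ℝ → Matrix ι' ι' ℝ) (P : Matrix ι' ι' ℝ → Matrix ι ι ℝ) : Prop where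
  Lc : Continuous L
  Pc : Continuous P
  L0 : L 0 = 0
  P0 : P 0 = 0
  PL : ∀ x, P (L x) = x
  fwd : ∀ {m : Type} [Fintype m] [DecidableEq m] {X : MB m ι}, Os G X → Os G' (X.map L)
  bwd : ∀ {m : Type} [Fintype m] [DecidableEq m] {X : MB m ι'}, Os G' X → Os G (X.map P) ∧ (X.map P).map L = X

lemma dg_map {m : Type} [Fintype m] [DecidableEq m] (L : Matrix ι ι ℝ → Matrix ι' ι' ℝ) (h : L 0 = 0) (x : Matrix ι ι ℝ) :
    (dg m x).map L = dg m (L x) := by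
  simp only [dg, diagonal_map h]

lemma dsum_map {m a : Type} (L : Matrix ι ι ℝ → Matrix ι' ι' ℝ) (h : L 0 = 0) (X : MB m ι) (Y : MB a ι) :
    (dsum X Y).map L = dsum (X.map L) (Y.map L) := by
  simp only [dsum, fromBlocks_map]
  congr 1 <;> (ext1 i j; exact h)

lemma map_cont {m : Type} {L : Matrix ι ι ℝ → Matrix ι' ι' ℝ} (h : Continuous L) : Continuous fun X : MB m ι => (X.map L : MB m ι') := by
  refine continuous_matrix fun i j => h.comp ?_
  exact continuous_apply_apply i j

lemma map_based {Q : Type} [TopologicalSpace Q] {bd : Set Q} {L : Matrix ι ι ℝ → Matrix ι' ι' ℝ} (hc : Continuous L) (h0 : L 0 = 0)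
    (hf : ∀ {m : Type} [Fintype m] [DecidableEq m] {X : MB m ι}, Os G X → Os G' (X.map L)) {m : Type} [Fintype m] [DecidableEq m]
    {F : Q → MB m ι} (h : Based bd G J F) : Based bd G' (L J) (fun q => ((F q).map L : MB m ι')) where
  cont := (map_cont hc).comp h.cont
  os q := hf (h.os q)
  base q hq := by rw [h.base q hq, dg_map L h0]

lemma map_seq {Q : Type} [TopologicalSpace Q] {bd : Set Q} {L : Matrix ι ι ℝ → Matrix ι' ι' ℝ} (hc : Continuous L) (h0 : L 0 = 0)
    (hf : ∀ {m : Type} [Fintype m] [DecidableEq m] {X : MB m ι}, Os G X → Os G' (X.map L)) {m m' : Type} [Fintype m] [DecidableEq m]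
    [Fintype m'] [DecidableEq m']
    {F : Q → MB m ι} {F' : Q → MB m' ι} (h : SEq bd G J F F') : SEq bd G' (L J) (fun q => ((F q).map L : MB m ι')) (fun q => ((F' q).map L : MB m' ι')) := by
  obtain ⟨a, a', i1, i2, i3, i4, e, H, hc', h0', h1, ho, hb⟩ := h
  refine ⟨a, a', i1, i2, i3, i4, e, fun z => (H z).map L, (map_cont hc).comp hc', fun q => ?_, fun q => ?_, fun p => hf (ho p), fun t q hq => ?_⟩
  · simp only [h0', rx, ← submatrix_map]
    rw [dsum_map L h0, dg_map L h0]
  · simp only [h1]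
    rw [dsum_map L h0, dg_map L h0]
  · simp only [hb t q hq, rx, ← submatrix_map]
    rw [dsum_map L h0, dg_map L h0]

lemma map_gl {n : ℕ} {Y Z : Type} (φ : Y → Z) (i : Fin n) (F F' : CI n → Y) : (fun y => φ (gl i F F' y)) = gl i (fun y => φ (F y)) (fun y => φ (F' y)) := by
  funext y
  by_cases hy : (y i : ℝ) ≤ 1 / 2
  · rw [gl_pos hy, gl_pos hy]
  · rw [gl_neg hy, gl_neg hy]

def Mor.xf {L : Matrix ι ι ℝ → Matrix ι' ι' ℝ} {P : Matrix ι' ι' ℝ → Matrix ι ι ℝ} (h : Mor G G' L P) (hJ : Cx G' (L J)) (n : ℕ) : Xf n n G J G' (L J) where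
  T F y := (F y).map L
  based hF := map_based h.Lc h.L0 h.fwd hF
  seq {m m' _ _ _ _ F F'} hF hF' := by
    refine ⟨fun e => map_seq h.Lc h.L0 h.fwd e, fun e => ?_⟩
    have := map_seq h.Pc h.P0 (fun hX => (h.bwd hX).1) e
    rw [h.PL] at this
    have e1 : ∀ {m : Type} (X : MB m ι), ((X.map L : MB m ι').map P : MB m ι) = X := fun X => by ext1 i j; exact h.PL _
    simpa only [e1] using this
  surj {m _ _ f} hf := by
    have b := map_based h.Pc h.P0 (fun hX => (h.bwd hX).1) hf
    rw [h.PL] at b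
    refine ⟨m, inferInstance, inferInstance, _, b, ?_⟩
    have : (fun y => (((f y).map P : MB m ι).map L : MB m ι')) = f := funext fun y => (h.bwd (hf.os y)).2
    rw [this]
    exact SEq.refl hJ hf.toFam
  glue h0 h0' F F' := map_gl (fun X : MB _ ι => (X.map L : MB _ ι')) _ _ _

def Mor.xf' {L : Matrix ι ι ℝ → Matrix ι' ι' ℝ} {P : Matrix ι' ι' ℝ → Matrix ι ι ℝ} (h : Mor G G' L P) (hJ : Cx G J) (n : ℕ) : Xf n n G' (L J) G J where
  T F y := (F y).map P
  based hF := by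
    have b := map_based h.Pc h.P0 (fun hX => (h.bwd hX).1) hF
    rwa [h.PL] at b
  seq {m m' _ _ _ _ F F'} hF hF' := by
    refine ⟨fun e => ?_, fun e => ?_⟩
    · have := map_seq h.Pc h.P0 (fun hX => (h.bwd hX).1) e
      rwa [h.PL] at this
    · have := map_seq h.Lc h.L0 h.fwd e
      have e1 : (fun y => (((F y).map P : MB m ι).map L : MB m ι')) = F := funext fun y => (h.bwd (hF.os y)).2
      have e2 : (fun y => (((F' y).map P : MB m' ι).map L : MB m' ι')) = F' := funext fun y => (h.bwd (hF'.os y)).2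
      rwa [e1, e2] at this
  surj {m _ _ f} hf := by
    have b := map_based h.Lc h.L0 h.fwd hf
    refine ⟨m, inferInstance, inferInstance, _, b, ?_⟩
    have : (fun y => (((f y).map L : MB m ι').map P : MB m ι)) = f := funext fun y => by ext1 i j; exact h.PL _
    rw [this]
    exact SEq.refl hJ hf.toFam
  glue h0 h0' F F' := map_gl (fun X : MB _ ι' => (X.map P : MB _ ι)) _ _ _

lemma Mor.comp {ι'' : Type} [Fintype ι''] [DecidableEq ι''] {G'' : Set (Matrix ι'' ι'' ℝ)} {L : Matrix ι ι ℝ → Matrix ι' ι' ℝ} {P : Matrix ι' ι' ℝ → Matrix ι ι ℝ}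
    {L' : Matrix ι' ι' ℝ → Matrix ι'' ι'' ℝ} {P' : Matrix ι'' ι'' ℝ → Matrix ι' ι' ℝ}
    (h : Mor G G' L P) (h' : Mor G' G'' L' P') : Mor G G'' (fun x => L' (L x)) (fun x => P (P' x)) where
  Lc := h'.Lc.comp h.Lc
  Pc := h.Pc.comp h'.Pc
  L0 := by rw [h.L0, h'.L0]
  P0 := by rw [h'.P0, h.P0]
  PL x := by rw [h'.PL, h.PL]
  fwd hX := h'.fwd (h.fwd hX)
  bwd {m _ _ X} hX := by
    obtain ⟨a, b⟩ := h'.bwd hX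
    obtain ⟨c, d⟩ := h.bwd a
    refine ⟨c, ?_⟩
    calc _ = (((X.map P' : MB m ι').map P : MB m ι).map L : MB m ι').map L' := rfl
      _ = X := by rw [d, b]
end mor

section tstep
variable {ι : Type} [Fintype ι] [DecidableEq ι]

def tt (x : Matrix ι ι ℝ) : Matrix (ι ⊕ ι) (ι ⊕ ι) ℝ := fromBlocks x 0 0 (-x)
def tP (x : Matrix (ι ⊕ ι) (ι ⊕ ι) ℝ) : Matrix ι ι ℝ := x.toBlocks₁₁
def tS (ι : Type) [DecidableEq ι] : Matrix (ι ⊕ ι) (ι ⊕ ι) ℝ := fromBlocks 0 1 1 0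
def tU (ι : Type) [DecidableEq ι] : Matrix (ι ⊕ ι) (ι ⊕ ι) ℝ := fromBlocks 0 (-1) 1 0
def td : Matrix ι ι ℝ →+* Matrix (ι ⊕ ι) (ι ⊕ ι) ℝ where
  toFun x := fromBlocks x 0 0 x
  map_one' := fromBlocks_one
  map_mul' x y := by simp [fromBlocks_multiply]
  map_zero' := fromBlocks_zero
  map_add' x y := by simp [fromBlocks_add]
lemma td_inj : Function.Injective (td (ι := ι)) := fun x y h => (fromBlocks_inj.1 h).1
lemma tt_inj : Function.Injective (tt (ι := ι)) := fun x y h => (fromBlocks_inj.1 h).1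
lemma tt_mul (x y : Matrix ι ι ℝ) : tt x * tt y = td (x * y) := by
  change _ = fromBlocks _ _ _ _
  simp [tt, fromBlocks_multiply]
lemma tt_star (x : Matrix ι ι ℝ) : star (tt x) = tt (star x) := by
  simp [tt, star_eq_conjTranspose, fromBlocks_conjTranspose, fromBlocks_transpose]
lemma tt_neg (x : Matrix ι ι ℝ) : tt (-x) = - tt x := by simp [tt, fromBlocks_neg]
lemma tt_zero : tt (0 : Matrix ι ι ℝ) = 0 := by simp [tt]
lemma tS_tt (x : Matrix ι ι ℝ) : tS ι * tt x = -(tt x * tS ι) := by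
  simp [tt, tS, fromBlocks_multiply, fromBlocks_neg]
lemma tU_tt (x : Matrix ι ι ℝ) : tU ι * tt x = -(tt x * tU ι) := by
  simp [tt, tU, fromBlocks_multiply, fromBlocks_neg]
lemma tS_tU : tS ι * tU ι = -(tU ι * tS ι) := by
  simp [tS, tU, fromBlocks_multiply, fromBlocks_neg]
lemma tS_sq : tS ι * tS ι = 1 := by simp [tS, fromBlocks_multiply]
lemma tU_sq : tU ι * tU ι = -1 := by
  rw [← fromBlocks_one, fromBlocks_neg]; simp [tU, fromBlocks_multiply]
lemma tS_star : star (tS ι) = tS ι := by simp [tS, star_eq_conjTranspose, fromBlocks_conjTranspose, fromBlocks_transpose]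
lemma tU_star : star (tU ι) = - tU ι := by simp [tU, star_eq_conjTranspose, fromBlocks_conjTranspose, fromBlocks_transpose, fromBlocks_neg]

lemma tt_of {x : Matrix (ι ⊕ ι) (ι ⊕ ι) ℝ} (h : x * tS ι = -(tS ι * x)) (h' : x * tU ι = -(tU ι * x)) : tt (tP x) = x := by
  rw [← fromBlocks_toBlocks x] at h h' ⊢
  simp only [tS, tU, fromBlocks_multiply, fromBlocks_neg, fromBlocks_inj] at h h'
  simp only [mul_zero, mul_one, zero_mul, one_mul, add_zero, zero_add, mul_neg, neg_mul, neg_neg] at h h'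
  have h1 : x.toBlocks₁₂ = x.toBlocks₂₁ := h'.1
  have h2 : x.toBlocks₁₂ = 0 := by
    have := h.1; rw [← h1] at this
    ext i j
    have h3 := congrArg (fun y : Matrix ι ι ℝ => y i j) this
    change x.toBlocks₁₂ i j = - x.toBlocks₁₂ i j at h3
    change x.toBlocks₁₂ i j = 0
    linarith
  simp only [tt, tP, toBlocks_fromBlocks₁₁, fromBlocks_inj]
  refine ⟨trivial, h2.symm, (h1 ▸ h2).symm, ?_⟩
  rw [h.2.1, neg_neg]

def tG (G : Set (Matrix ι ι ℝ)) : Set (Matrix (ι ⊕ ι) (ι ⊕ ι) ℝ) := insert (tS ι) (insert (tU ι) (tt '' G))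

variable {m : Type} [Fintype m] [DecidableEq m] {G : Set (Matrix ι ι ℝ)}
lemma mtt_mul (X Y : MB m ι) : (X.map tt : MB m (ι ⊕ ι)) * Y.map tt = (X * Y).map td := by
  ext1 i j
  simp only [mul_apply, map_apply, tt_mul, map_sum]
lemma mtt_neg (X : MB m ι) : ((-X).map tt : MB m (ι ⊕ ι)) = -(X.map tt) := by
  ext1 i j; exact tt_neg _
lemma mtd_neg (X : MB m ι) : ((-X).map td : MB m (ι ⊕ ι)) = -(X.map td) := by
  ext1 i j; exact map_neg td _
lemma mtd_one : ((1 : MB m ι).map td : MB m (ι ⊕ ι)) = 1 := Matrix.map_one _ (map_zero _) (map_one _)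
lemma mtt_star (X : MB m ι) : ((star X).map tt : MB m (ι ⊕ ι)) = star (X.map tt) := by
  ext1 i j; exact (tt_star _).symm
lemma mtd_inj {X Y : MB m ι} (h : (X.map td : MB m (ι ⊕ ι)) = Y.map td) : X = Y := Matrix.map_injective td_inj h
lemma mtt_inj {X Y : MB m ι} (h : (X.map tt : MB m (ι ⊕ ι)) = Y.map tt) : X = Y := Matrix.map_injective tt_inj h
lemma mdg_r (X : MB m ι) (g : Matrix ι ι ℝ) (i j : m) : (X * dg m g) i j = X i j * g := by simp [dg]
lemma mdg_l (X : MB m ι) (g : Matrix ι ι ℝ) (i j : m) : (dg m g * X) i j = g * X i j := by simp [dg]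

lemma tmor : Mor G (tG G) tt tP where
  Lc := by unfold tt; exact Continuous.matrix_fromBlocks continuous_id continuous_const continuous_const continuous_neg
  Pc := by
    refine continuous_matrix fun i j => ?_
    exact continuous_apply_apply _ _
  L0 := tt_zero
  P0 := rfl
  PL x := rfl
  fwd {m _ _ X} h := by
    refine ⟨⟨?_, ?_⟩, ?_⟩
    · rw [← mtt_star, h.skew, mtt_neg]
    · rintro g (rfl | rfl | ⟨g, hg, rfl⟩)
      · ext1 i j
        rw [neg_apply, mdg_r, mdg_l, map_apply, tS_tt, neg_neg]
      · ext1 i j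
        rw [neg_apply, mdg_r, mdg_l, map_apply, tU_tt, neg_neg]
      · rw [← dg_map tt tt_zero, mtt_mul, mtt_mul, h.anti g hg, mtd_neg]
    · rw [mtt_mul, h.sq, mtd_neg, mtd_one]
  bwd {m _ _ X} h := by
    have e : (X.map tP : MB m ι).map tt = X := by
      ext1 i j
      rw [map_apply, map_apply]
      apply tt_of
      · have := congrFun (congrFun (h.anti (tS ι) (by simp [tG])) i) j
        rwa [neg_apply, mdg_r, mdg_l] at this
      · have := congrFun (congrFun (h.anti (tU ι) (by simp [tG])) i) j
        rwa [neg_apply, mdg_r, mdg_l] at this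
    refine ⟨?_, e⟩
    generalize (X.map tP : MB m ι) = Y at e
    subst e
    refine ⟨⟨?_, ?_⟩, ?_⟩
    · apply mtt_inj; rw [mtt_star, h.skew, mtt_neg]
    · intro g hg
      apply mtd_inj
      rw [mtd_neg, ← mtt_mul, ← mtt_mul, dg_map tt tt_zero, h.anti _ (by simp [tG]; right; right; exact ⟨g, hg, rfl⟩)]
    · apply mtd_inj; rw [← mtt_mul, h.sq, mtd_neg, mtd_one]

/-- `k` split pairs -/
structure SF {ι0 ι : Type} [Fintype ι0] [DecidableEq ι0] [Fintype ι] [DecidableEq ι] (k : ℕ) (L : Matrix ι0 ι0 ℝ → Matrix ι ι ℝ)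
    (s u : ℕ → Matrix ι ι ℝ) : Prop where
  s_star : ∀ i < k, star (s i) = s i
  s_sq : ∀ i < k, s i * s i = 1
  s_anti : ∀ i < k, ∀ j < k, i ≠ j → s i * s j = -(s j * s i)
  u_star : ∀ i < k, star (u i) = - u i
  u_sq : ∀ i < k, u i * u i = -1
  u_anti : ∀ i < k, ∀ j < k, i ≠ j → u i * u j = -(u j * u i)
  su : ∀ i < k, ∀ j < k, s i * u j = -(u j * s i)
  sL : ∀ i < k, ∀ x, s i * L x = -(L x * s i)
  uL : ∀ i < k, ∀ x, u i * L x = -(L x * u i)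
  L_star : ∀ x, star x = -x → star (L x) = - L x
  L_sq : ∀ x, x * x = -1 → L x * L x = -1
  L_anti : ∀ x y, x * y = -(y * x) → L x * L y = -(L y * L x)
  L_diag : ∀ x d, x = diagonal d → (∀ i, d i = 1 ∨ d i = -1) → (∃ i, d i = 1) → ∃ d', L x = diagonal d' ∧ (∀ i, d' i = 1 ∨ d' i = -1) ∧ (∃ i, d' i = 1)

def stS (s : ℕ → Matrix ι ι ℝ) : ℕ → Matrix (ι ⊕ ι) (ι ⊕ ι) ℝ
  | 0 => tS ι
  | k+1 => tt (s k)
def stU (s : ℕ → Matrix ι ι ℝ) : ℕ → Matrix (ι ⊕ ι) (ι ⊕ ι) ℝ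
  | 0 => tU ι
  | k+1 => tt (s k)

lemma tt_anti {x y : Matrix ι ι ℝ} (h : x * y = -(y * x)) : tt x * tt y = -(tt y * tt x) := by
  rw [tt_mul, tt_mul, h, map_neg]
lemma tt_sq1 {x : Matrix ι ι ℝ} (h : x * x = 1) : tt x * tt x = 1 := by rw [tt_mul, h, map_one]
lemma tt_sq {x : Matrix ι ι ℝ} (h : x * x = -1) : tt x * tt x = -1 := by rw [tt_mul, h, map_neg, map_one]
lemma asym {R : Type} [Ring R] {x y : R} (h : x * y = -(y * x)) : y * x = -(x * y) := by rw [h, neg_neg]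

variable {ι0 : Type} [Fintype ι0] [DecidableEq ι0] {k : ℕ} {L : Matrix ι0 ι0 ℝ → Matrix ι ι ℝ} {s u : ℕ → Matrix ι ι ℝ}

lemma SF.zero : SF 0 (fun x : Matrix ι ι ℝ => x) s u where
  s_star i h := by omega
  s_sq i h := by omega
  s_anti i h := by omega
  u_star i h := by omega
  u_sq i h := by omega
  u_anti i h := by omega
  su i h := by omega
  sL i h := by omega
  uL i h := by omega
  L_star x h := h
  L_sq x h := h
  L_anti x y h := h
  L_diag x d h h' h'' := ⟨d, h, h', h''⟩

lemma SF.succ (h : SF k L s u) : SF (k+1) (fun x => tt (L x)) (stS s) (stU u) where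
  s_star
    | 0, _ => tS_star
    | i+1, hi => by simp only [stS, tt_star, h.s_star i (by omega)]
  s_sq
    | 0, _ => tS_sq
    | i+1, hi => tt_sq1 (h.s_sq i (by omega))
  s_anti
    | 0, _, 0, _, e => absurd rfl e
    | 0, _, j+1, _, _ => tS_tt _
    | i+1, _, 0, _, _ => asym (tS_tt _)
    | i+1, _, j+1, _, e => tt_anti (h.s_anti i (by omega) j (by omega) (by omega))
  u_star
    | 0, _ => tU_star
    | i+1, hi => by simp only [stU, tt_star, h.u_star i (by omega), tt_neg]
  u_sq
    | 0, _ => tU_sq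
    | i+1, hi => tt_sq (h.u_sq i (by omega))
  u_anti
    | 0, _, 0, _, e => absurd rfl e
    | 0, _, j+1, _, _ => tU_tt _
    | i+1, _, 0, _, _ => asym (tU_tt _)
    | i+1, _, j+1, _, e => tt_anti (h.u_anti i (by omega) j (by omega) (by omega))
  su
    | 0, _, 0, _ => tS_tU
    | 0, _, j+1, _ => tS_tt _
    | i+1, _, 0, _ => asym (tU_tt _)
    | i+1, _, j+1, _ => tt_anti (h.su i (by omega) j (by omega))
  sL
    | 0, _, x => tS_tt _
    | i+1, _, x => tt_anti (h.sL i (by omega) x)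
  uL
    | 0, _, x => tU_tt _
    | i+1, _, x => tt_anti (h.uL i (by omega) x)
  L_star x hx := by rw [tt_star, h.L_star x hx, tt_neg]
  L_sq x hx := tt_sq (h.L_sq x hx)
  L_anti x y hx := tt_anti (h.L_anti x y hx)
  L_diag x d hx h1 h2 := by
    obtain ⟨d', e, h3, i, h4⟩ := h.L_diag x d hx h1 h2
    refine ⟨Sum.elim d' (fun i => - d' i), ?_, ?_, Sum.inl i, h4⟩
    · change tt (L x) = _
      rw [tt, e, ← fromBlocks_diagonal]
      congr 1
      rw [diagonal_neg]
    · rintro (i | i)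
      · exact h3 i
      · rcases h3 i with h | h <;> simp [h]

def HG (k : ℕ) (L : Matrix ι0 ι0 ℝ → Matrix ι ι ℝ) (s u : ℕ → Matrix ι ι ℝ) (G : Set (Matrix ι0 ι0 ℝ)) : Set (Matrix ι ι ℝ) :=
  {g | (∃ i < k, g = s i) ∨ (∃ i < k, g = u i) ∨ ∃ x ∈ G, g = L x}

lemma HG_succ (G : Set (Matrix ι0 ι0 ℝ)) : tG (HG k L s u G) = HG (k+1) (fun x => tt (L x)) (stS s) (stU u) G := by
  ext g
  constructor
  · rintro (rfl | rfl | ⟨g, ⟨i, hi, rfl⟩ | ⟨i, hi, rfl⟩ | ⟨x, hx, rfl⟩, rfl⟩)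
    · exact Or.inl ⟨0, by omega, rfl⟩
    · exact Or.inr (Or.inl ⟨0, by omega, rfl⟩)
    · exact Or.inl ⟨i+1, by omega, rfl⟩
    · exact Or.inr (Or.inl ⟨i+1, by omega, rfl⟩)
    · exact Or.inr (Or.inr ⟨x, hx, rfl⟩)
  · rintro (⟨i, hi, rfl⟩ | ⟨i, hi, rfl⟩ | ⟨x, hx, rfl⟩)
    · rcases i with _ | i
      · exact Or.inl rfl
      · exact Or.inr (Or.inr ⟨_, Or.inl ⟨i, by omega, rfl⟩, rfl⟩)
    · rcases i with _ | i
      · exact Or.inr (Or.inl rfl)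
      · exact Or.inr (Or.inr ⟨_, Or.inr (Or.inl ⟨i, by omega, rfl⟩), rfl⟩)
    · exact Or.inr (Or.inr ⟨_, Or.inr (Or.inr ⟨x, hx, rfl⟩), rfl⟩)

lemma SF.cx (h : SF k L s u) {G : Set (Matrix ι0 ι0 ℝ)} {J : Matrix ι0 ι0 ℝ} (c : Cx G J) : Cx (HG k L s u G) (L J) where
  skew := h.L_star _ c.skew
  sq := h.L_sq _ c.sq
  anti := by
    rintro g (⟨i, hi, rfl⟩ | ⟨i, hi, rfl⟩ | ⟨x, hx, rfl⟩)
    · exact asym (h.sL i hi _)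
    · exact asym (h.uL i hi _)
    · exact h.L_anti _ _ (c.anti x hx)

lemma HG_zero (G : Set (Matrix ι ι ℝ)) : HG 0 (fun x : Matrix ι ι ℝ => x) s u G = G := by
  ext g; simp [HG]

lemma SF.mor {G : Set (Matrix ι0 ι0 ℝ)} (x : ∃ P, Mor G (HG k L s u G) L P) :
    ∃ P, Mor G (HG (k+1) (fun x => tt (L x)) (stS s) (stU u) G) (fun x => tt (L x)) P := by
  obtain ⟨P, x⟩ := x
  rw [← HG_succ]
  exact ⟨_, x.comp tmor⟩

lemma Mor.id {G G' : Set (Matrix ι ι ℝ)} (h : ∀ {m : Type} [Fintype m] [DecidableEq m] {X : MB m ι}, Os G X ↔ Os G' X) : Mor G G' (fun x => x) (fun x => x) where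
  Lc := continuous_id
  Pc := continuous_id
  L0 := rfl
  P0 := rfl
  PL x := rfl
  fwd hX := h.1 hX
  bwd hX := ⟨h.2 hX, rfl⟩

section nu
variable {R : Type} [Ring R] {s : ℕ → R}
def nu (s : ℕ → R) : R := s 0 * s 1 * s 2 * s 3
lemma nu_comm {x : R} (h : ∀ i < 4, x * s i = -(s i * x)) : x * nu s = nu s * x := by
  have h0 := h 0 (by omega); have h1 := h 1 (by omega); have h2 := h 2 (by omega); have h3 := h 3 (by omega)
  calc x * nu s = (x * s 0) * s 1 * s 2 * s 3 := by simp only [nu, mul_assoc]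
    _ = -(s 0 * (x * s 1) * s 2 * s 3) := by rw [h0]; noncomm_ring
    _ = s 0 * s 1 * (x * s 2) * s 3 := by rw [h1]; noncomm_ring
    _ = -(s 0 * s 1 * s 2 * (x * s 3)) := by rw [h2]; noncomm_ring
    _ = nu s * x := by rw [h3, nu]; noncomm_ring
lemma nu_s (sq : ∀ i < 4, s i * s i = 1) (an : ∀ i < 4, ∀ j < 4, i ≠ j → s i * s j = -(s j * s i)) : ∀ i < 4, s i * nu s = -(nu s * s i) := by
  have h10 := an 1 (by omega) 0 (by omega) (by omega)
  have h20 := an 2 (by omega) 0 (by omega) (by omega)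
  have h30 := an 3 (by omega) 0 (by omega) (by omega)
  have h21 := an 2 (by omega) 1 (by omega) (by omega)
  have h31 := an 3 (by omega) 1 (by omega) (by omega)
  have h32 := an 3 (by omega) 2 (by omega) (by omega)
  have g10 : ∀ x, s 1 * (s 0 * x) = -(s 0 * (s 1 * x)) := fun x => by rw [← mul_assoc, h10, neg_mul, mul_assoc]
  have g20 : ∀ x, s 2 * (s 0 * x) = -(s 0 * (s 2 * x)) := fun x => by rw [← mul_assoc, h20, neg_mul, mul_assoc]
  have g30 : ∀ x, s 3 * (s 0 * x) = -(s 0 * (s 3 * x)) := fun x => by rw [← mul_assoc, h30, neg_mul, mul_assoc]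
  have g21 : ∀ x, s 2 * (s 1 * x) = -(s 1 * (s 2 * x)) := fun x => by rw [← mul_assoc, h21, neg_mul, mul_assoc]
  have g31 : ∀ x, s 3 * (s 1 * x) = -(s 1 * (s 3 * x)) := fun x => by rw [← mul_assoc, h31, neg_mul, mul_assoc]
  have g32 : ∀ x, s 3 * (s 2 * x) = -(s 2 * (s 3 * x)) := fun x => by rw [← mul_assoc, h32, neg_mul, mul_assoc]
  intro i hi
  interval_cases i <;>
  simp only [nu, mul_assoc, h10, h20, h30, h21, h31, h32, g10, g20, g30, g21, g31, g32, mul_neg, neg_mul, neg_neg]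
lemma nu_sq (sq : ∀ i < 4, s i * s i = 1) (an : ∀ i < 4, ∀ j < 4, i ≠ j → s i * s j = -(s j * s i)) : nu s * nu s = 1 := by
  have h := nu_s sq an
  have e : ∀ i < 4, nu s * s i = -(s i * nu s) := fun i hi => asym (h i hi)
  calc nu s * nu s = s 0 * s 1 * s 2 * (s 3 * nu s) := by rw [nu]; noncomm_ring
    _ = -(s 0 * s 1 * s 2 * (nu s * s 3)) := by rw [h 3 (by omega)]; noncomm_ring
    _ = -(s 0 * s 1 * s 2 * (s 0 * s 1 * s 2 * (s 3 * s 3))) := by simp only [nu, mul_assoc]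
    _ = -((s 0 * s 1) * s 2 * (s 0 * s 1) * s 2) := by rw [sq 3 (by omega)]; noncomm_ring
    _ = -((s 0 * s 1) * (s 2 * s 0) * s 1 * s 2) := by noncomm_ring
    _ = (s 0 * s 1) * s 0 * (s 2 * s 1) * s 2 := by rw [an 2 (by omega) 0 (by omega) (by omega)]; noncomm_ring
    _ = -((s 0 * (s 1 * s 0)) * s 1 * (s 2 * s 2)) := by rw [an 2 (by omega) 1 (by omega) (by omega)]; noncomm_ring
    _ = (s 0 * s 0) * (s 1 * s 1) := by rw [sq 2 (by omega), an 1 (by omega) 0 (by omega) (by omega)]; noncomm_ring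
    _ = 1 := by rw [sq 0 (by omega), sq 1 (by omega), mul_one]

lemma nu_prod (sq : ∀ i < 4, s i * s i = 1) (an : ∀ i < 4, ∀ j < 4, i ≠ j → s i * s j = -(s j * s i)) : nu (fun i => s i * nu s) = nu s := by
  have h := nu_s sq an
  have n := nu_sq sq an
  have e : ∀ i < 4, nu s * s i = -(s i * nu s) := fun i hi => asym (h i hi)
  calc nu (fun i => s i * nu s) = s 0 * (nu s * s 1) * nu s * s 2 * (nu s * s 3) * nu s := by simp only [nu.eq_def (fun i => s i * nu s)]; noncomm_ring
    _ = s 0 * s 1 * (nu s * nu s) * s 2 * s 3 * (nu s * nu s) := by rw [e 1 (by omega), e 3 (by omega)]; noncomm_ring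
    _ = nu s := by rw [n, mul_one, mul_one]; rfl

lemma nu_iff (sq : ∀ i < 4, s i * s i = 1) (an : ∀ i < 4, ∀ j < 4, i ≠ j → s i * s j = -(s j * s i)) (x : R) :
    (∀ i < 4, x * s i = -(s i * x)) ↔ ∀ i < 4, x * (s i * nu s) = -(s i * nu s * x) := by
  constructor
  · intro h i hi
    rw [mul_assoc, ← nu_comm h, ← mul_assoc, h i hi]; noncomm_ring
  · intro h i hi
    have c := nu_comm h
    rw [nu_prod sq an] at c
    have e : s i = s i * nu s * nu s := by rw [mul_assoc, nu_sq sq an, mul_one]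
    calc x * s i = x * (s i * nu s) * nu s := by rw [mul_assoc, ← e]
      _ = -((s i * nu s) * (x * nu s)) := by rw [h i hi]; noncomm_ring
      _ = -((s i * nu s * nu s) * x) := by rw [c]; noncomm_ring
      _ = _ := by rw [← e]
end nu

def wc (L : Matrix ι0 ι0 ℝ → Matrix ι ι ℝ) (s u : ℕ → Matrix ι ι ℝ) (w : ℕ → Matrix ι0 ι0 ℝ) : ℕ → Matrix ι ι ℝ := fun k =>
  if k < 4 then s k * nu s else if k < 8 then u (k-4) else L (w (k-8))
variable {N : ℕ} {ε : Matrix ι0 ι0 ℝ} {w : ℕ → Matrix ι0 ι0 ℝ}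

lemma wc_ge {i : ℕ} : wc L s u w (i+8) = L (w i) := by
  simp only [wc]; rw [if_neg (by omega), if_neg (by omega)]; congr 1

lemma wc_cases (P : ℕ → Matrix ι ι ℝ → Prop) (h1 : ∀ k < 4, P k (s k * nu s)) (h2 : ∀ k < 4, P (k+4) (u k))
    (h3 : ∀ k < N, P (k+8) (L (w k))) : ∀ k < N + 8, P k (wc L s u w k) := by
  intro k hk
  simp only [wc]
  split_ifs with a b
  · exact h1 k a
  · have := h2 (k-4) (by omega); rwa [show k - 4 + 4 = k by omega] at this
  · have := h3 (k-8) (by omega); rwa [show k - 8 + 8 = k by omega] at this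

lemma nu_star (h : SF 4 L s u) : star (nu s) = nu s := by
  have a := h.s_star 0 (by omega); have b := h.s_star 1 (by omega); have c := h.s_star 2 (by omega); have d := h.s_star 3 (by omega)
  have an := h.s_anti
  calc star (nu s) = s 3 * (s 2 * (s 1 * s 0)) := by simp only [nu, star_mul, a, b, c, d]
    _ = -(s 3 * (s 2 * s 0) * s 1) := by rw [an 1 (by omega) 0 (by omega) (by omega)]; noncomm_ring
    _ = (s 3 * s 0) * (s 2 * s 1) := by rw [an 2 (by omega) 0 (by omega) (by omega)]; noncomm_ring
    _ = s 0 * (s 3 * s 1) * s 2 := by rw [an 2 (by omega) 1 (by omega) (by omega), an 3 (by omega) 0 (by omega) (by omega)]; noncomm_ring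
    _ = -(s 0 * s 1 * (s 3 * s 2)) := by rw [an 3 (by omega) 1 (by omega) (by omega)]; noncomm_ring
    _ = nu s := by rw [an 3 (by omega) 2 (by omega) (by omega), nu]; noncomm_ring

lemma SF.cf (h : SF 4 L s u) (hw : CF N ε w) : CF (N+8) (L ε) (wc L s u w) := by
  have n := nu_sq h.s_sq h.s_anti
  have ns := nu_s h.s_sq h.s_anti
  have e : ∀ i < 4, nu s * s i = -(s i * nu s) := fun i hi => asym (ns i hi)
  have key : ∀ x, (∀ i < 4, x * s i = -(s i * x)) → ∀ i < 4, s i * nu s * x = -(x * (s i * nu s)) := fun x hx i hi =>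
    asym ((nu_iff h.s_sq h.s_anti x).1 hx i hi)
  have ku : ∀ j < 4, ∀ i < 4, s i * nu s * u j = -(u j * (s i * nu s)) := fun j hj => key _ fun i hi => asym (h.su i hi j hj)
  have kL : ∀ x, ∀ i < 4, s i * nu s * L x = -(L x * (s i * nu s)) := fun x => key _ fun i hi => asym (h.sL i hi x)
  have mm : ∀ i < 4, ∀ j < 4, s i * nu s * (s j * nu s) = -(s i * s j) := fun i hi j hj => by
    calc s i * nu s * (s j * nu s) = s i * (nu s * s j) * nu s := by noncomm_ring
      _ = -(s i * s j * (nu s * nu s)) := by rw [e j hj]; noncomm_ring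
      _ = _ := by rw [n, mul_one]
  refine ⟨?_, ?_, ?_, ?_⟩
  · refine wc_cases (fun k x => star x = -x) (fun k hk => ?_) (fun k hk => h.u_star k hk) (fun k hk => h.L_star _ (hw.skew k hk))
    rw [star_mul, nu_star h, h.s_star k hk, e k hk]
  · refine wc_cases (fun k x => x * x = -1) (fun k hk => ?_) (fun k hk => h.u_sq k hk) (fun k hk => h.L_sq _ (hw.sq k hk))
    rw [mm k hk k hk, h.s_sq k hk]
  · refine wc_cases (fun i x => ∀ j < N + 8, i ≠ j → x * wc L s u w j = -(wc L s u w j * x)) (fun i hi => ?_) (fun i hi => ?_) (fun i hi => ?_)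
    · refine wc_cases (fun j y => i ≠ j → s i * nu s * y = -(y * (s i * nu s))) (fun j hj hij => ?_) (fun j hj _ => ku j hj i hi) (fun j hj _ => kL _ i hi)
      rw [mm i hi j hj, mm j hj i hi, h.s_anti i hi j hj hij]
    · refine wc_cases (fun j y => i + 4 ≠ j → u i * y = -(y * u i)) (fun j hj _ => asym (ku i hi j hj)) (fun j hj hij => h.u_anti i hi j hj (by omega)) (fun j hj _ => h.uL i hi _)
    · refine wc_cases (fun j y => i + 8 ≠ j → L (w i) * y = -(y * L (w i))) (fun j hj _ => asym (kL _ j hj)) (fun j hj _ => asym (h.uL j hj _)) (fun j hj hij => h.L_anti _ _ (hw.anti i hi j hj (by omega)))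
  · refine wc_cases (fun i x => x * L ε = -(L ε * x)) (fun i hi => kL _ i hi) (fun i hi => h.uL i hi _) (fun i hi => h.L_anti _ _ (hw.eps i hi))

lemma HG_os (h : SF 4 L s u) {i : ℕ} {X : MB m ι} : Os (HG 4 L s u (GG ε w i)) X ↔ Os (GG (L ε) (wc L s u w) (i+8)) X := by
  have key := nu_iff (R := MB m ι) (s := fun i => dg m (s i)) (fun i hi => by rw [← dg_mul, h.s_sq i hi, dg_one])
    (fun i hi j hj hij => by rw [← dg_mul, ← dg_mul, h.s_anti i hi j hj hij, dg_neg]) X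
  have nd : nu (fun i => dg m (s i)) = dg m (nu s) := by simp only [nu, dg_mul]
  simp only [nd, ← dg_mul] at key
  have w1 : ∀ k < 4, wc L s u w k = s k * nu s := fun k hk => by simp only [wc]; rw [if_pos hk]
  have w2 : ∀ k < 4, wc L s u w (k+4) = u k := fun k hk => by
    simp only [wc]; rw [if_neg (by omega), if_pos (by omega)]; congr 1
  constructor
  · intro hX
    refine ⟨⟨hX.skew, ?_⟩, hX.sq⟩
    rintro g (rfl | ⟨j, hj, rfl⟩)
    · exact hX.anti _ (Or.inr (Or.inr ⟨ε, Or.inl rfl, rfl⟩))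
    · revert j
      refine wc_cases (fun j x => X * dg m x = -(dg m x * X)) (fun j hj => ?_) (fun j hj => ?_) (fun j hj => ?_)
      · exact key.1 (fun j hj => hX.anti _ (Or.inl ⟨j, hj, rfl⟩)) j hj
      · exact hX.anti _ (Or.inr (Or.inl ⟨j, hj, rfl⟩))
      · exact hX.anti _ (Or.inr (Or.inr ⟨w j, Or.inr ⟨j, hj, rfl⟩, rfl⟩))
  · intro hX
    refine ⟨⟨hX.skew, ?_⟩, hX.sq⟩
    rintro g (⟨j, hj, rfl⟩ | ⟨j, hj, rfl⟩ | ⟨x, rfl | ⟨j, hj, rfl⟩, rfl⟩)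
    · exact key.2 (fun j hj => by rw [← w1 j hj]; exact hX.anti _ (Or.inr ⟨j, by omega, rfl⟩)) j hj
    · rw [← w2 j hj]; exact hX.anti _ (Or.inr ⟨j+4, by omega, rfl⟩)
    · exact hX.anti _ (Or.inl rfl)
    · rw [← wc_ge (L := L) (w := w) (s := s) (u := u)]; exact hX.anti _ (Or.inr ⟨j+8, by omega, rfl⟩)

lemma SF.fin (h : SF 4 L s u) {i : ℕ} (x : ∃ P, Mor (GG ε w i) (HG 4 L s u (GG ε w i)) L P) :
    ∃ P, Mor (GG ε w i) (GG (L ε) (wc L s u w) (i+8)) L P := by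
  obtain ⟨P, x⟩ := x
  exact ⟨_, x.comp (Mor.id (HG_os h))⟩

def sg (d : ι → ℝ) : Prop := (∀ i, d i = 1 ∨ d i = -1) ∧ ∃ i, d i = 1

/-- the eightfold Morita step -/
lemma morita8 {d : ι → ℝ} {w : ℕ → Matrix ι ι ℝ} (hd : sg d) (hw : CF N (diagonal d) w) : ∃ (ι' : Type) (_ : Fintype ι') (_ : DecidableEq ι') (d' : ι' → ℝ)
    (w' : ℕ → Matrix ι' ι' ℝ), sg d' ∧ CF (N+8) (diagonal d') w' ∧
      ∃ L, (∀ i, ∃ P, Mor (GG (diagonal d) w i) (GG (diagonal d') w' (i+8)) L P) ∧ ∀ i, w' (i+8) = L (w i) := by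
  have f0 : SF 0 (fun x : Matrix ι ι ℝ => x) (fun _ => 0) (fun _ => 0) := SF.zero
  have f1 := f0.succ
  have f2 := f1.succ
  have f3 := f2.succ
  have f4 := f3.succ
  obtain ⟨d', e, h1, h2⟩ := f4.L_diag _ d rfl hd.1 hd.2
  refine ⟨_, inferInstance, inferInstance, d', wc (fun x => tt (tt (tt (tt x)))) (stS (stS (stS (stS fun _ => 0)))) (stU (stU (stU (stU fun _ => 0)))) w, ⟨h1, h2⟩, ?_, ?_⟩
  · rw [← e]; exact f4.cf hw
  · refine ⟨fun x => tt (tt (tt (tt x))), fun i => ?_, fun i => wc_ge⟩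
    rw [← e]
    refine f4.fin (SF.mor (SF.mor (SF.mor (SF.mor (L := fun x => x) ⟨fun x => x, ?_⟩))))
    rw [HG_zero]
    exact Mor.id Iff.rfl

lemma base_cf : ∃ (ι : Type) (_ : Fintype ι) (_ : DecidableEq ι) (d : ι → ℝ) (w : ℕ → Matrix ι ι ℝ), sg d ∧ CF 2 (diagonal d) w := by
  let j := tU Unit
  have j1 : j * j = -1 := tU_sq
  have j2 : star j = -j := tU_star
  refine ⟨(Unit ⊕ Unit) ⊕ (Unit ⊕ Unit), inferInstance, inferInstance, Sum.elim (fun _ => 1) (fun _ => -1),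
    fun k => if k = 0 then tU _ else fromBlocks 0 j j 0, ⟨?_, ?_⟩, ?_⟩
  · rintro (i | i) <;> simp
  · exact ⟨Sum.inl (Sum.inl ()), rfl⟩
  · have e : (diagonal (Sum.elim (fun _ => 1) (fun _ => -1)) : Matrix ((Unit ⊕ Unit) ⊕ (Unit ⊕ Unit)) ((Unit ⊕ Unit) ⊕ (Unit ⊕ Unit)) ℝ) = tt 1 := by
      rw [tt, ← fromBlocks_diagonal]; congr 1
      rw [← diagonal_one, diagonal_neg]
    have q1 : (fromBlocks 0 j j 0 : Matrix ((Unit ⊕ Unit) ⊕ (Unit ⊕ Unit)) ((Unit ⊕ Unit) ⊕ (Unit ⊕ Unit)) ℝ) * fromBlocks 0 j j 0 = -1 := by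
      rw [← fromBlocks_one, fromBlocks_neg]; simp [fromBlocks_multiply, j1]
    have q2 : star (fromBlocks 0 j j 0 : Matrix ((Unit ⊕ Unit) ⊕ (Unit ⊕ Unit)) ((Unit ⊕ Unit) ⊕ (Unit ⊕ Unit)) ℝ) = - fromBlocks 0 j j 0 := by
      rw [star_eq_conjTranspose, fromBlocks_conjTranspose, fromBlocks_neg, ← j2, star_eq_conjTranspose]; simp
    have q3 : (fromBlocks 0 j j 0 : Matrix ((Unit ⊕ Unit) ⊕ (Unit ⊕ Unit)) ((Unit ⊕ Unit) ⊕ (Unit ⊕ Unit)) ℝ) * tt 1 = -(tt 1 * fromBlocks 0 j j 0) := by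
      simp [tt, fromBlocks_multiply, fromBlocks_neg]
    have q4 : tU (Unit ⊕ Unit) * fromBlocks 0 j j 0 = -(fromBlocks 0 j j 0 * tU _) := by
      simp [tU, fromBlocks_multiply, fromBlocks_neg]
    rw [e]
    refine ⟨?_, ?_, ?_, ?_⟩
    · intro i hi; interval_cases i
      · exact tU_star
      · exact q2
    · intro i hi; interval_cases i
      · exact tU_sq
      · exact q1
    · intro i hi k hk h; interval_cases i <;> interval_cases k
      · exact absurd rfl h
      · exact q4
      · exact asym q4
      · exact absurd rfl h
    · intro i hi; interval_cases i
      · exact tU_tt _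
      · exact q3

/-- the periodicity transfer on the level of stable families -/
theorem stable_periodicity : ∃ (ι ι' : Type) (_ : Fintype ι) (_ : DecidableEq ι) (_ : Fintype ι') (_ : DecidableEq ι')
    (d : ι → ℝ) (d' : ι' → ℝ) (J : Matrix ι ι ℝ) (J' : Matrix ι' ι' ℝ),
    sg d ∧ sg d' ∧ Cx {diagonal d} J ∧ Cx {diagonal d'} J' ∧ ∀ n, Nonempty (Xf n (n+8) {diagonal d} J {diagonal d'} J') := by
  obtain ⟨ι, i1, i2, d, w, hd, hw⟩ := base_cf
  obtain ⟨ι', i1', i2', d', w', hd', hw', L', x', e'⟩ := morita8 hd hw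
  obtain ⟨ι'', i1'', i2'', d'', w'', hd'', hw'', L'', x'', e''⟩ := morita8 hd' hw'
  have c0 := hw.cx (i := 0) (j := 0) (by omega) le_rfl
  have c0' := hw'.cx (i := 0) (j := 0) (by omega) le_rfl
  have c8' := hw'.cx (i := 8) (j := 8) (by omega) le_rfl
  have c8'' := hw''.cx (i := 8) (j := 8) (by omega) le_rfl
  have c16'' := hw''.cx (i := 16) (j := 16) (by omega) le_rfl
  rw [GG_zero] at c0 c0'
  refine ⟨ι, ι', i1, i2, i1', i2', d, d', w 0, w' 0, hd, hd', c0, c0', fun n => ?_⟩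
  obtain ⟨P, a⟩ := x' 0
  obtain ⟨P', b⟩ := x'' 8
  obtain ⟨P'', c⟩ := x'' 0
  rw [GG_zero] at a c
  have e := hw''.botts (n := n) 8 7 (by omega)
  have e1 : w'' 16 = L'' (w' 8) := e'' 8
  have e2 : w'' 8 = L'' (w' 0) := e'' 0
  have e3 : w' 8 = L' (w 0) := e' 0
  simp only [Nat.reduceAdd] at e a b c
  rw [e1, e2] at e
  rw [e3] at c8'
  rw [e1] at c16''
  rw [e2] at c8''
  have y1 := a.xf c8' n
  have y2 := b.xf c16'' n
  have y3 := c.xf' c0' (n+8)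
  rw [← e3] at y1
  have z1 := Xf.comp c16'' id y1 y2
  have z2 : Xf n (n+8) _ _ _ _ := Xf.comp c8'' id z1 e
  exact ⟨Xf.comp c0' (fun _ => by omega) z2 y3⟩
end tstep
end BottP

set_option linter.all false
set_option autoImplicit false
set_option linter.unusedSectionVars false
set_option linter.unusedSimpArgs false
namespace BottP
open Matrix Topology

lemma emb_lt {n : ℕ} (A : Matrix (Fin n) (Fin n) ℝ) (i j : Fin n) : embMat n A i j = A i j := by
  simp [embMat]
lemma emb_ge {n : ℕ} (A : Matrix (Fin n) (Fin n) ℝ) {i j : ℕ} (h : ¬ (i < n ∧ j < n)) :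
    embMat n A i j = if i = j then 1 else 0 := by
  simp only [embMat, dif_neg h]

lemma incl_cont (n : ℕ) : Continuous (OInf.incl n) := by
  rw [continuous_iff_coinduced_le]
  exact le_iSup (fun n : ℕ => TopologicalSpace.coinduced (OInf.incl n) inferInstance) n

lemma oval_cont : Continuous (fun f : OInf => f.1) := by
  refine continuous_iSup_dom.2 fun n => ?_
  rw [continuous_coinduced_dom]
  refine continuous_pi fun i => continuous_pi fun j => ?_
  by_cases h : i < n ∧ j < n
  · simp only [Function.comp_def, OInf.incl, embMat, dif_pos h]
    exact continuous_subtype_val.matrix_elem _ _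
  · simp only [Function.comp_def, OInf.incl, embMat, dif_neg h]
    fun_prop

lemma incl_inj (n : ℕ) : Function.Injective (OInf.incl n) := by
  intro A B h
  have h' : embMat n A.1 = embMat n B.1 := congrArg Subtype.val h
  ext i j
  rw [← emb_lt A.1, h', emb_lt]

def trc (n : ℕ) (f : ℕ → ℕ → ℝ) : Matrix (Fin n) (Fin n) ℝ := of fun i j => f i j

lemma trc_emb {n : ℕ} (A : Matrix (Fin n) (Fin n) ℝ) : trc n (embMat n A) = A := by
  ext i j; simp [trc, emb_lt]

lemma emb_succ {n : ℕ} (A : Matrix (Fin n) (Fin n) ℝ) (h : A ∈ orthogonalGroup (Fin n) ℝ) (k : ℕ) :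
    trc (n+k) (embMat n A) ∈ orthogonalGroup (Fin (n+k)) ℝ ∧ embMat (n+k) (trc (n+k) (embMat n A)) = embMat n A := by
  have e : trc (n+k) (embMat n A) = (fromBlocks A 0 0 1 : Matrix (Fin n ⊕ Fin k) (Fin n ⊕ Fin k) ℝ).submatrix finSumFinEquiv.symm finSumFinEquiv.symm := by
    ext i j
    obtain ⟨i, rfl⟩ := finSumFinEquiv.surjective i
    obtain ⟨j, rfl⟩ := finSumFinEquiv.surjective j
    rcases i with i | i <;> rcases j with j | j
    · simp [trc, emb_lt]
    · have := i.2
      simp [trc, embMat]; omega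
    · have := j.2
      simp [trc, embMat]; omega
    · simp [trc, embMat, one_apply, Fin.ext_iff]
  constructor
  · rw [mem_orthogonalGroup_iff] at h ⊢
    rw [e, transpose_submatrix, submatrix_mul_equiv, fromBlocks_transpose, fromBlocks_multiply]
    simp [h]
  · funext i j
    by_cases hh : i < n + k ∧ j < n + k
    · simp [embMat, trc, hh]
    · rw [emb_ge _ hh, emb_ge]; omega

lemma range_mono {n n' : ℕ} (h : n ≤ n') : Set.range (OInf.incl n) ⊆ Set.range (OInf.incl n') := by
  obtain ⟨k, rfl⟩ := Nat.exists_eq_add_of_le h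
  rintro _ ⟨A, rfl⟩
  exact ⟨⟨_, (emb_succ A.1 A.2 k).1⟩, Subtype.ext (emb_succ A.1 A.2 k).2⟩

lemma range_cover (f : OInf) : ∃ n, f ∈ Set.range (OInf.incl n) := by
  obtain ⟨f, n, A, hA, rfl⟩ := f
  exact ⟨n, ⟨A, hA⟩, rfl⟩

lemma trc_range {n : ℕ} {f : OInf} (h : f ∈ Set.range (OInf.incl n)) :
    trc n f.1 ∈ orthogonalGroup (Fin n) ℝ ∧ embMat n (trc n f.1) = f.1 := by
  obtain ⟨A, rfl⟩ := h
  simp only [OInf.incl, trc_emb]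
  exact ⟨A.2, trivial⟩

lemma compact_range {C : Set OInf} (hC : IsCompact C) : ∃ n, C ⊆ Set.range (OInf.incl n) := by
  by_contra hcon
  push Not at hcon
  have : ∀ n, ∃ y ∈ C, y ∉ Set.range (OInf.incl n) := fun n => Set.not_subset.1 (hcon n)
  choose y hyC hy using this
  let U : ℕ → Set OInf := fun n => {f | ∀ j ≥ n, f ≠ y j}
  have hU : ∀ n, IsOpen (U n) := by
    intro n
    rw [← isClosed_compl_iff]
    refine isClosed_iSup_iff.2 fun k => ?_
    rw [isClosed_coinduced]
    have : (OInf.incl k ⁻¹' (U n)ᶜ).Finite := by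
      refine Set.Finite.preimage ((incl_inj k).injOn) ?_ |>.subset (s := OInf.incl k ⁻¹' (y '' Set.Iio k)) ?_
      · exact (Set.finite_Iio k).image _
      · intro A hA
        simp only [U, Set.mem_preimage, Set.mem_compl_iff, Set.mem_setOf_eq, not_forall, not_not] at hA
        obtain ⟨j, hj, e⟩ := hA
        refine ⟨j, ?_, e.symm⟩
        by_contra hk
        exact hy j (range_mono (not_lt.1 hk) ⟨A, e⟩)
    exact this.isClosed
  obtain ⟨n, hn⟩ := hC.elim_directed_cover U hU (fun f _ => by
    obtain ⟨n, hn⟩ := range_cover f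
    refine Set.mem_iUnion.2 ⟨n, fun j hj e => hy j (range_mono hj (e ▸ hn))⟩)
    (fun a b => ⟨max a b, fun f hf j hj => hf j (le_trans (le_max_left _ _) hj), fun f hf j hj => hf j (le_trans (le_max_right _ _) hj)⟩)
  exact hn (hyC n) n le_rfl rfl

end BottP

set_option linter.all false
set_option autoImplicit false
set_option linter.unusedSectionVars false
set_option linter.unusedSimpArgs false
namespace BottP
open Matrix Topology

section vk
variable {n p : Type} [Fintype n] [DecidableEq n] [Fintype p] [DecidableEq p]
/-- compression data -/
structure VK (E K : Matrix n n ℝ) (V : Matrix n p ℝ) : Prop where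
  vv : Vᵀ * V = 1
  e : E = (2:ℝ) • (V * Vᵀ) - 1
  skew : Kᵀ = -K
  sq : K * K = -1
  anti : K * E = -(E * K)

variable {E K X : Matrix n n ℝ} {V : Matrix n p ℝ}
lemma VK.ev (h : VK E K V) : E * V = V := by
  rw [h.e, Matrix.sub_mul, Matrix.smul_mul, Matrix.mul_assoc, h.vv, Matrix.mul_one, Matrix.one_mul, two_smul]; abel
lemma VK.ve (h : VK E K V) : Vᵀ * E = Vᵀ := by
  rw [h.e, Matrix.mul_sub, Matrix.mul_smul, ← Matrix.mul_assoc, h.vv, Matrix.mul_one, Matrix.one_mul, two_smul]; abel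
lemma VK.vxv (h : VK E K V) (hX : X * E = -(E * X)) : Vᵀ * X * V = 0 := by
  have : Vᵀ * X * V = - (Vᵀ * X * V) := by
    have e1 : Vᵀ * X * V = Vᵀ * (X * E) * V := by rw [Matrix.mul_assoc Vᵀ (X * E), Matrix.mul_assoc X, h.ev, Matrix.mul_assoc]
    conv_lhs => rw [e1, hX, Matrix.mul_neg, Matrix.neg_mul, ← Matrix.mul_assoc Vᵀ E, h.ve]
  have h2 : (2:ℝ) • (Vᵀ * X * V) = 0 := by rw [two_smul]; nth_rw 1 [this]; simp
  simpa using h2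
lemma VK.vw (h : VK E K V) : V * Vᵀ = (1/2 : ℝ) • (1 + E) := by
  rw [h.e]; simp [smul_smul]
lemma VK.xvvx (h : VK E K V) (hX : X * E = -(E * X)) (hs : X * X = -1) : X * (V * Vᵀ) * X = V * Vᵀ - 1 := by
  have h1 : X * E * X = E := by rw [hX, Matrix.neg_mul, Matrix.mul_assoc, hs]; simp
  rw [h.vw]
  simp only [Matrix.mul_smul, Matrix.smul_mul, mul_add, add_mul, Matrix.mul_one, hs, h1]
  module
lemma VK.half (h : VK E K V) (hX : X * E = -(E * X)) : X * (V * Vᵀ) + V * Vᵀ * X = X := by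
  rw [h.vw]
  simp only [Matrix.mul_smul, Matrix.smul_mul, mul_add, add_mul, Matrix.mul_one, Matrix.one_mul, hX]
  module

def tO (K : Matrix n n ℝ) (V : Matrix n p ℝ) (X : Matrix n n ℝ) : Matrix p p ℝ := -(Vᵀ * (K * X) * V)
def fO (K : Matrix n n ℝ) (V : Matrix n p ℝ) (B : Matrix p p ℝ) : Matrix n n ℝ := K * V * B * Vᵀ + V * Bᵀ * Vᵀ * K

lemma VK.tO_mem (h : VK E K V) (hX : X * E = -(E * X)) (hs : X * X = -1) (hk : Xᵀ = -X) : tO K V X ∈ orthogonalGroup p ℝ := by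
  rw [mem_orthogonalGroup_iff']
  have e1 : (tO K V X)ᵀ = -(Vᵀ * (X * K) * V) := by
    simp [tO, transpose_mul, h.skew, hk, Matrix.mul_assoc]
  have e2 : (tO K V X)ᵀ * tO K V X = Vᵀ * X * (K * (V * Vᵀ) * K) * X * V := by
    rw [e1, tO]; simp [Matrix.mul_assoc]
  rw [e2, h.xvvx h.anti h.sq]
  have e3 : Vᵀ * X * (V * Vᵀ - 1) * X * V = (Vᵀ * X * V) * (Vᵀ * X * V) - Vᵀ * (X * X) * V := by
    simp only [mul_sub, sub_mul, Matrix.mul_sub, Matrix.sub_mul, Matrix.mul_one, Matrix.mul_assoc]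
  rw [e3, h.vxv hX, hs]; simp [h.vv]

lemma VK.fO_t (h : VK E K V) (B : Matrix p p ℝ) : (fO K V B)ᵀ = - fO K V B := by
  simp [fO, transpose_mul, h.skew, Matrix.mul_assoc]
lemma VK.fO_anti (h : VK E K V) (B : Matrix p p ℝ) : fO K V B * E = - (E * fO K V B) := by
  have e1 : fO K V B * E = K * V * B * (Vᵀ * E) + V * Bᵀ * Vᵀ * (K * E) := by
    simp only [fO, Matrix.add_mul, Matrix.mul_assoc]
  have e2 : E * fO K V B = (E * K) * V * B * Vᵀ + (E * V) * Bᵀ * Vᵀ * K := by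
    simp only [fO, Matrix.mul_add, Matrix.mul_assoc]
  have e3 : E * K = - (K * E) := by rw [h.anti, neg_neg]
  have e4 : K * E * V = K * V := by rw [Matrix.mul_assoc, h.ev]
  have e5 : V * Bᵀ * Vᵀ * (E * K) = V * Bᵀ * Vᵀ * K := by rw [← Matrix.mul_assoc, Matrix.mul_assoc (V * Bᵀ), h.ve]
  rw [e1, e2, h.ve, h.ev, h.anti, Matrix.mul_neg, e5, e3, Matrix.neg_mul, e4]
  simp only [Matrix.neg_mul]; abel
lemma VK.fO_sq (h : VK E K V) {B : Matrix p p ℝ} (hB : B ∈ orthogonalGroup p ℝ) : fO K V B * fO K V B = -1 := by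
  have b1 := (mem_orthogonalGroup_iff _ _).1 hB
  have b2 := (mem_orthogonalGroup_iff' _ _).1 hB
  have e : fO K V B * fO K V B = K * V * B * (Vᵀ * K * V) * B * Vᵀ + K * V * (B * (Vᵀ * V) * Bᵀ) * Vᵀ * K
    + V * Bᵀ * (Vᵀ * (K * K) * V) * B * Vᵀ + V * Bᵀ * (Vᵀ * K * V) * Bᵀ * Vᵀ * K := by
    simp only [fO, Matrix.mul_add, Matrix.add_mul, Matrix.mul_assoc]; abel
  have e2 : K * V * Vᵀ * K = V * Vᵀ - 1 := by rw [Matrix.mul_assoc K]; exact h.xvvx h.anti h.sq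
  rw [e, h.vxv h.anti, h.sq, h.vv]
  simp only [Matrix.mul_zero, Matrix.zero_mul, Matrix.mul_one, b1, Matrix.mul_neg, Matrix.neg_mul, h.vv, e2]
  rw [Matrix.mul_assoc V, b2]
  simp only [Matrix.mul_one, Matrix.mul_neg, Matrix.neg_mul]
  simp
  abel
lemma VK.t_f (h : VK E K V) (B : Matrix p p ℝ) : tO K V (fO K V B) = B := by
  have e : tO K V (fO K V B) = -(Vᵀ * (K * K) * V * B * (Vᵀ * V)) - (Vᵀ * K * V) * Bᵀ * Vᵀ * K * V := by
    simp only [tO, fO, Matrix.mul_add, Matrix.add_mul, Matrix.mul_assoc]; abel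
  rw [e, h.vxv h.anti, h.sq, h.vv]
  simp [h.vv]
lemma VK.f_t (h : VK E K V) (hX : X * E = -(E * X)) (hk : Xᵀ = -X) : fO K V (tO K V X) = X := by
  have e1 : (tO K V X)ᵀ = -(Vᵀ * (X * K) * V) := by
    simp [tO, transpose_mul, h.skew, hk, Matrix.mul_assoc]
  have e : fO K V (tO K V X) = -((K * (V * Vᵀ) * K) * X * (V * Vᵀ)) - (V * Vᵀ) * X * (K * (V * Vᵀ) * K) := by
    rw [fO, e1, tO]
    simp only [Matrix.mul_assoc, Matrix.mul_neg, Matrix.neg_mul]; abel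
  have e3 : (V * Vᵀ) * X * (V * Vᵀ) = 0 := by
    have : (V * Vᵀ) * X * (V * Vᵀ) = V * (Vᵀ * X * V) * Vᵀ := by simp only [Matrix.mul_assoc]
    rw [this, h.vxv hX]; simp
  rw [e, h.xvvx h.anti h.sq]
  simp only [sub_mul, mul_sub, e3, Matrix.one_mul, Matrix.mul_one]
  conv_rhs => rw [← h.half hX]
  abel
end vk

section conc
variable {m ι : Type} [Fintype m] [DecidableEq m] [Fintype ι] [DecidableEq ι] {d : ι → ℝ} {J : Matrix ι ι ℝ}

abbrev PP (d : ι → ℝ) := {a : ι // d a = 1}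
instance : Fintype (PP d) := Fintype.ofFinite _

def VV (m : Type) [DecidableEq m] (d : ι → ℝ) : Matrix (m × ι) (m × PP d) ℝ :=
  (1 : Matrix (m × ι) (m × ι) ℝ).submatrix id (Prod.map id Subtype.val)

lemma vk (hd : sg d) (hJ : Cx {diagonal d} J) : VK (fl (dg m (diagonal d))) (fl (dg m J)) (VV m d) where
  vv := by
    ext ⟨i, a⟩ ⟨j, b⟩
    rw [Matrix.mul_apply, Finset.sum_eq_single (i, a.1)]
    · simp [VV, one_apply, Subtype.ext_iff]
    · rintro ⟨k, c⟩ - hne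
      have : (VV m d) (k, c) (i, a) = 0 := by
        simp only [VV, submatrix_apply, id, Prod.map]
        exact one_apply_ne hne
      simp [this]
    · simp
  e := by
    ext ⟨i, a⟩ ⟨j, b⟩
    have e1 : (VV m d * (VV m d)ᵀ) (i, a) (j, b) = if d a = 1 ∧ i = j ∧ a = b then 1 else 0 := by
      rw [Matrix.mul_apply]
      by_cases ha : d a = 1
      · rw [Finset.sum_eq_single (i, ⟨a, ha⟩)]
        · simp [VV, one_apply, ha]
          grind
        · rintro ⟨k, c⟩ - hne
          have : (VV m d) (i, a) (k, c) = 0 := by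
            simp only [VV, submatrix_apply, id, Prod.map]
            refine one_apply_ne fun h => hne ?_
            simp only [Prod.ext_iff, Subtype.ext_iff] at h ⊢
            exact ⟨h.1.symm, h.2.symm⟩
          simp [this]
        · simp
      · simp only [ha, false_and, if_false]
        refine Finset.sum_eq_zero ?_
        rintro ⟨k, c⟩ -
        have : (VV m d) (i, a) (k, c) = 0 := by
          simp only [VV, submatrix_apply, id, Prod.map]
          refine one_apply_ne fun h => ha ?_
          simp only [Prod.ext_iff] at h
          have h2 : a = c.1 := h.2
          rw [h2]; exact c.2
        simp [this]
    rw [Matrix.sub_apply, Matrix.smul_apply, e1]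
    have e2 : fl (dg m (diagonal d)) (i, a) (j, b) = if i = j ∧ a = b then d a else 0 := by
      change (dg m (diagonal d)) i j a b = _
      by_cases hij : i = j
      · subst hij; simp [dg, diagonal_apply]
      · simp [dg, diagonal_apply, hij]
    rw [e2, one_apply]
    by_cases hh : i = j ∧ a = b
    · obtain ⟨rfl, rfl⟩ := hh
      rcases hd.1 a with h | h <;> norm_num [h]
    · have : ¬ ((i, a) = (j, b)) := by simpa [Prod.ext_iff] using hh
      simp [hh, this]
  skew := by
    have := congrArg fl (hJ.os (m := m)).skew
    rwa [fl_star, star_eq_conjTranspose, conjTranspose_eq_transpose_of_trivial, map_neg] at this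
  sq := by rw [← map_mul, (hJ.os (m := m)).sq, map_neg, map_one]
  anti := by rw [← map_mul, (hJ.os (m := m)).anti _ rfl, map_neg, map_mul]

/-- the orthogonal matrix of a complex structure -/
def toO (d : ι → ℝ) (J : Matrix ι ι ℝ) (X : MB m ι) : Matrix (m × PP d) (m × PP d) ℝ := tO (fl (dg m J)) (VV m d) (fl X)
def frO (J : Matrix ι ι ℝ) (B : Matrix (m × PP d) (m × PP d) ℝ) : MB m ι := fl.symm (fO (fl (dg m J)) (VV m d) B)

lemma VVx (z : m × ι) (x : m × PP d) : VV m d z x = if z = Prod.map id Subtype.val x then 1 else 0 := by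
  simp only [VV, submatrix_apply, one_apply, id]
lemma VV_conj (M : Matrix (m × ι) (m × ι) ℝ) : (VV m d)ᵀ * M * VV m d = M.submatrix (Prod.map id Subtype.val) (Prod.map id Subtype.val) := by
  ext x y
  rw [Matrix.mul_apply, Finset.sum_eq_single (Prod.map id Subtype.val y)]
  · rw [Matrix.mul_apply, Finset.sum_eq_single (Prod.map id Subtype.val x)]
    · rw [transpose_apply, VVx, VVx]; simp
    · intro z _ hz
      rw [transpose_apply, VVx, if_neg hz, zero_mul]
    · simp
  · intro z _ hz
    rw [VVx, if_neg hz, mul_zero]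
  · simp

lemma toO_apply (X : MB m ι) (i j : m) (a b : PP d) : toO d J X (i, a) (j, b) = -((J * X i j) a.1 b.1) := by
  rw [toO, tO, VV_conj, ← map_mul]
  change -((dg m J * X) i j a.1 b.1) = _
  rw [dg, diagonal_mul]

lemma toO_cont : Continuous (toO (m := m) d J) := by
  refine continuous_matrix ?_
  rintro ⟨i, a⟩ ⟨j, b⟩
  simp only [toO_apply]
  have : Continuous fun X : MB m ι => J * X i j := continuous_const.matrix_mul (continuous_id.matrix_elem i j)
  exact (this.matrix_elem _ _).neg

lemma flsymm_cont : Continuous (fl (m := m) (ι := ι)).symm := by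
  refine continuous_matrix fun i j => continuous_matrix fun a b => ?_
  exact continuous_id.matrix_elem (i, a) (j, b)

lemma frO_cont : Continuous (frO (m := m) (d := d) J) := by
  refine flsymm_cont.comp ?_
  unfold fO
  fun_prop

lemma Os.fl3 {X : MB m ι} (h : Os {diagonal d} X) : fl X * fl (dg m (diagonal d)) = -(fl (dg m (diagonal d)) * fl X) ∧
    fl X * fl X = -1 ∧ (fl X)ᵀ = - fl X := by
  refine ⟨by rw [← map_mul, h.anti _ rfl, map_neg, map_mul], by rw [← map_mul, h.sq, map_neg, map_one], ?_⟩
  have := congrArg fl h.skew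
  rwa [fl_star, star_eq_conjTranspose, conjTranspose_eq_transpose_of_trivial, map_neg] at this

lemma toO_mem (hd : sg d) (hJ : Cx {diagonal d} J) {X : MB m ι} (h : Os {diagonal d} X) : toO d J X ∈ orthogonalGroup (m × PP d) ℝ :=
  (vk hd hJ).tO_mem h.fl3.1 h.fl3.2.1 h.fl3.2.2
lemma fr_to (hd : sg d) (hJ : Cx {diagonal d} J) {X : MB m ι} (h : Os {diagonal d} X) : frO J (toO d J X) = X := by
  rw [frO, toO, (vk hd hJ).f_t h.fl3.1 h.fl3.2.2, RingEquiv.symm_apply_apply]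
lemma to_fr (hd : sg d) (hJ : Cx {diagonal d} J) (B : Matrix (m × PP d) (m × PP d) ℝ) : toO d J (frO J B) = B := by
  rw [frO, toO, RingEquiv.apply_symm_apply, (vk hd hJ).t_f]
lemma frO_os (hd : sg d) (hJ : Cx {diagonal d} J) {B : Matrix (m × PP d) (m × PP d) ℝ} (hB : B ∈ orthogonalGroup (m × PP d) ℝ) :
    Os {diagonal d} (frO J B) where
  skew := by
    apply fl.injective
    rw [fl_star, map_neg, frO, RingEquiv.apply_symm_apply, star_eq_conjTranspose, conjTranspose_eq_transpose_of_trivial, (vk hd hJ).fO_t]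
  anti g hg := by
    obtain rfl := hg
    apply fl.injective
    rw [map_neg, map_mul, map_mul, frO, RingEquiv.apply_symm_apply, (vk hd hJ).fO_anti]
  sq := by
    apply fl.injective
    rw [map_mul, map_neg, map_one, frO, RingEquiv.apply_symm_apply, (vk hd hJ).fO_sq hB]
lemma toO_one (hJ : Cx {diagonal d} J) : toO d J (dg m J) = 1 := by
  ext ⟨i, a⟩ ⟨j, b⟩
  rw [toO_apply]
  by_cases h : i = j
  · subst h
    simp [dg, hJ.sq, one_apply, Subtype.ext_iff]
  · simp [dg, h, one_apply]

/-- canonical enumeration -/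
def ek (d : ι → ℝ) (k : ℕ) : Fin k × PP d ≃ Fin (k * Fintype.card (PP d)) :=
  (Equiv.prodCongr (Equiv.refl _) (Fintype.equivFin (PP d))).trans finProdFinEquiv

lemma ek_val (k : ℕ) (i : Fin k) (a : PP d) : (ek d k (i, a) : ℕ) = (Fintype.equivFin (PP d) a : ℕ) + Fintype.card (PP d) * i := by
  simp [ek, finProdFinEquiv]

def thm (d : ι → ℝ) (J : Matrix ι ι ℝ) (k : ℕ) (X : MB (Fin k) ι) : Matrix (Fin (k * Fintype.card (PP d))) (Fin (k * Fintype.card (PP d))) ℝ :=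
  (toO d J X).submatrix (ek d k).symm (ek d k).symm

lemma reidx_mem {n n' : Type} [Fintype n] [DecidableEq n] [Fintype n'] [DecidableEq n'] (e : n' ≃ n) {B : Matrix n n ℝ}
    (h : B ∈ orthogonalGroup n ℝ) : B.submatrix e e ∈ orthogonalGroup n' ℝ := by
  rw [mem_orthogonalGroup_iff] at h ⊢
  rw [transpose_submatrix, submatrix_mul_equiv, h, submatrix_one_equiv]

def tht (hd : sg d) (hJ : Cx {diagonal d} J) (k : ℕ) (X : {X : MB (Fin k) ι // Os {diagonal d} X}) : OInf :=
  OInf.incl (k * Fintype.card (PP d)) ⟨thm d J k X.1, reidx_mem _ (toO_mem hd hJ X.2)⟩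

variable (hd : sg d) (hJ : Cx {diagonal d} J)

lemma tht_cont (k : ℕ) : Continuous (tht hd hJ k) := by
  refine (incl_cont _).comp (Continuous.subtype_mk ?_ _)
  unfold thm
  exact (toO_cont.comp continuous_subtype_val).matrix_submatrix _ _

lemma tht_inj (k : ℕ) : Function.Injective (tht hd hJ k) := by
  intro X Y h
  have h1 := congrArg Subtype.val (incl_inj _ h)
  have h2 : toO d J X.1 = toO d J Y.1 := by
    ext x y
    have := congrFun (congrFun h1 (ek d k x)) (ek d k y)
    simpa [thm] using this
  apply Subtype.ext
  rw [← fr_to hd hJ X.2, h2, fr_to hd hJ Y.2]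

lemma emb_one (n : ℕ) : embMat n 1 = embMat 0 1 := by
  funext i j
  simp only [embMat]
  by_cases h : i < n ∧ j < n
  · simp [h, one_apply]
  · simp [h]

lemma tht_one (k : ℕ) : tht hd hJ k ⟨dg (Fin k) J, hJ.os⟩ = OInf.one := by
  apply Subtype.ext
  simp only [tht, OInf.incl, OInf.one, thm, toO_one hJ, submatrix_one_equiv]
  exact emb_one _

def stb (J : Matrix ι ι ℝ) {k K : ℕ} (l : ℕ) (h : k + l = K) (X : MB (Fin k) ι) : MB (Fin K) ι :=
  rx (finSumFinEquiv.trans (finCongr h)) (dsum X (dg (Fin l) J))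

lemma stb_os {d : ι → ℝ} {J : Matrix ι ι ℝ} (hJ : Cx {diagonal d} J) {k K : ℕ} (l : ℕ) (h : k + l = K) {X : MB (Fin k) ι} (hX : Os {diagonal d} X) : Os {diagonal d} (stb J l h X) := by
  have := hJ
  exact (hX.dsum hJ.os).rx _

lemma tht_stb {k K : ℕ} (l : ℕ) (h : k + l = K) (X : {X : MB (Fin k) ι // Os {diagonal d} X}) :
    tht hd hJ K ⟨stb J l h X.1, stb_os hJ l h X.2⟩ = tht hd hJ k X := by
  subst h
  apply Subtype.ext
  simp only [tht, OInf.incl]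
  funext p q
  by_cases hh : p < (k + l) * Fintype.card (PP d) ∧ q < (k + l) * Fintype.card (PP d)
  · obtain ⟨⟨i, a⟩, hi⟩ := (ek d (k+l)).surjective ⟨p, hh.1⟩
    obtain ⟨⟨j, b⟩, hj⟩ := (ek d (k+l)).surjective ⟨q, hh.2⟩
    obtain rfl : (ek d (k+l) (i, a) : ℕ) = p := congrArg Fin.val hi
    obtain rfl : (ek d (k+l) (j, b) : ℕ) = q := congrArg Fin.val hj
    rw [emb_lt]
    simp only [thm, submatrix_apply, Equiv.symm_apply_apply, toO_apply]
    obtain ⟨i, rfl⟩ := finSumFinEquiv.surjective i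
    obtain ⟨j, rfl⟩ := finSumFinEquiv.surjective j
    have bnd : ∀ (u : Fin k) (c : PP d), (Fintype.equivFin (PP d) c : ℕ) + Fintype.card (PP d) * u < k * Fintype.card (PP d) := by
      intro u c
      rw [← ek_val k u c]; exact (ek d k (u, c)).2
    have bnd' : ∀ (u : ℕ) (c : PP d), ¬ ((Fintype.equivFin (PP d) c : ℕ) + Fintype.card (PP d) * (k + u) < k * Fintype.card (PP d)) := by
      intro u c; rw [mul_add, mul_comm (Fintype.card (PP d)) k]; omega
    have stv : ∀ s t, stb J l rfl X.1 (finSumFinEquiv s) (finSumFinEquiv t) = dsum X.1 (dg (Fin l) J) s t := by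
      intro s t; simp [stb, rx]
    rw [stv]
    rcases i with i | i <;> rcases j with j | j
    · have e1 : ((ek d (k+l)) (finSumFinEquiv (Sum.inl i), a) : ℕ) = ek d k (i, a) := by simp [ek_val]
      have e2 : ((ek d (k+l)) (finSumFinEquiv (Sum.inl j), b) : ℕ) = ek d k (j, b) := by simp [ek_val]
      rw [e1, e2, emb_lt]
      simp [thm, toO_apply, dsum]
    · rw [emb_ge]
      · have h1 := bnd i a
        have h2 := bnd' j b
        rw [if_neg]
        · simp [dsum]
        · simp [ek_val]; omega
      · have h2 := bnd' j b
        simp [ek_val]; omega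
    · rw [emb_ge]
      · have h1 := bnd j b
        have h2 := bnd' i a
        rw [if_neg]
        · simp [dsum]
        · simp [ek_val]; omega
      · have h2 := bnd' i a
        simp [ek_val]; omega
    · rw [emb_ge]
      · have : ((ek d (k+l) (finSumFinEquiv (Sum.inr i), a) : ℕ) = ek d (k+l) (finSumFinEquiv (Sum.inr j), b)) ↔ (i = j ∧ a = b) := by
          rw [Fin.val_inj, Equiv.apply_eq_iff_eq, Prod.ext_iff]
          simp
        simp only [this]
        by_cases hij : i = j
        · subst hij
          simp [dsum, dg, hJ.sq, one_apply, Subtype.ext_iff]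
        · simp [dsum, dg, hij]
      · have h2 := bnd' i a
        simp [ek_val]; omega
  · rw [emb_ge _ hh, emb_ge]
    rw [add_mul] at hh; omega

lemma tht_lift {Y : Type} [TopologicalSpace Y] [CompactSpace Y] (f : C(Y, OInf)) : ∃ k0, ∀ k ≥ k0, ∃ F : Y → MB (Fin k) ι,
    Continuous F ∧ ∃ ho : ∀ y, Os {diagonal d} (F y), ∀ y, tht hd hJ k ⟨F y, ho y⟩ = f y := by
  obtain ⟨n, hn⟩ := compact_range (isCompact_range f.continuous)
  refine ⟨n, fun k hk => ?_⟩
  have hr : 1 ≤ Fintype.card (PP d) := by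
    obtain ⟨i, hi⟩ := hd.2
    exact Fintype.card_pos_iff.2 ⟨⟨i, hi⟩⟩
  have hnk : n ≤ k * Fintype.card (PP d) := by nlinarith
  have hm : ∀ y, f y ∈ Set.range (OInf.incl (k * Fintype.card (PP d))) := fun y => range_mono hnk (hn ⟨y, rfl⟩)
  have ho : ∀ y, Os {diagonal d} (frO (d := d) J ((trc (k * Fintype.card (PP d)) (f y).1).submatrix (ek d k) (ek d k))) := fun y =>
    frO_os hd hJ (reidx_mem _ (trc_range (hm y)).1)
  refine ⟨_, ?_, ho, ?_⟩
  · refine frO_cont.comp ?_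
    have : Continuous fun y => trc (k * Fintype.card (PP d)) (f y).1 := by
      refine continuous_matrix fun i j => ?_
      have h1 := oval_cont.comp f.continuous
      exact (continuous_apply_apply (i : ℕ) (j : ℕ)).comp h1
    exact this.matrix_submatrix _ _
  · intro y
    apply Subtype.ext
    simp only [tht, OInf.incl, thm, to_fr hd hJ]
    rw [submatrix_submatrix]
    simp only [Equiv.self_comp_symm, submatrix_id_id]
    exact (trc_range (hm y)).2
end conc
end BottP

set_option linter.all false
set_option autoImplicit false
set_option linter.unusedSectionVars false
set_option linter.unusedSimpArgs false
namespace BottP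
open Matrix Topology

section perm
variable {Q : Type} [TopologicalSpace Q] {ι m : Type} [Fintype m] [DecidableEq m]
  [Fintype ι] [DecidableEq ι] {G : Set (Matrix ι ι ℝ)} {bd : Set Q} {J : Matrix ι ι ℝ}

lemma RelH.conj (hJ : Cx G J) {F P : Q → MB m ι} (hF : Based bd G J F) (hP : Continuous P)
    (hU : ∀ q, Un (insert J G) (P q)) : RelH bd G (fun q => dsum (F q) (dg m J)) (fun q => dsum (P q * F q * star (P q)) (dg m J)) := by
  let W : unitInterval × Q → MB (m ⊕ m) ι := fun p =>
    dsum (P p.2) 1 * rot m ι ((p.1 : ℝ) * (Real.pi / 2)) * dsum (star (P p.2)) 1 *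
      star (rot m ι ((p.1 : ℝ) * (Real.pi / 2)))
  have hW : ∀ p, Un (insert J G) (W p) := fun p =>
    ((((hU p.2).dsum Un.one).mul (rot_un _ _)).mul ((hU p.2).star.dsum Un.one)).mul (rot_un _ _).star
  have hWc : Continuous W := by
    have r1 : Continuous fun p : unitInterval × Q => rot m ι ((p.1 : ℝ) * (Real.pi / 2)) :=
      rot_cont.comp (by fun_prop)
    have r2 : Continuous fun p : unitInterval × Q => dsum (P p.2) (1 : MB m ι) :=
      dsumC (by fun_prop) continuous_const
    have r3 : Continuous fun p : unitInterval × Q => dsum (star (P p.2)) (1 : MB m ι) :=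
      dsumC (by fun_prop) continuous_const
    exact ((r2.mul r1).mul r3).mul r1.star
  have hd : Continuous fun p : unitInterval × Q => dsum (F p.2) (dg m J) :=
    dsumC (hF.cont.comp continuous_snd) continuous_const
  have r0 : rot m ι 0 = 1 := by simp [rot]
  have hG : ∀ p, Un G (W p) := fun p => ⟨(hW p).l, (hW p).r, fun g hg => (hW p).comm g (by simp [hg])⟩
  refine ⟨fun p => W p * dsum (F p.2) (dg m J) * star (W p), (hWc.mul hd).mul hWc.star,
    fun q => ?_, fun q => ?_, fun p => (hG p).conj ((hF.os p.2).dsum hJ.os), fun t q hq => ?_⟩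
  · have : W (0, q) = 1 := by
      simp only [W, Set.Icc.coe_zero, zero_mul, r0, mul_one, star_one, dsum_mul, (hU q).r, dsum_one]
    simp only [this, one_mul, star_one, mul_one]
  · have : W (1, q) = dsum (P q) (star (P q)) := by
      simp only [W, Set.Icc.coe_one, one_mul, rot, Real.cos_pi_div_two, Real.sin_pi_div_two,
        star_eq_conjTranspose, fromBlocks_conjTranspose, dsum, fromBlocks_multiply]
      simp
    simp only [this, dsum_star, dsum_mul, star_star]
    congr 1
    rw [(hU q).comm' ((hU q).comm J (by simp)), mul_assoc, (hU q).l, mul_one]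
  · simp only [hF.base q hq, dsum_dg]
    rw [(hW (t, q)).comm J (by simp), mul_assoc, (hW (t, q)).r, mul_one]

def pm (σ : m ≃ m) : MB m ι := (1 : MB m ι).submatrix σ.symm id

lemma pm_star (σ : m ≃ m) : star (pm (ι := ι) σ) = (1 : MB m ι).submatrix id σ.symm := by
  rw [pm, star_eq_conjTranspose, conjTranspose_submatrix, conjTranspose_one]
lemma pm_conj (σ : m ≃ m) (X : MB m ι) : pm σ * X * star (pm σ) = rx σ X := by
  rw [pm_star, pm]
  ext i j : 1
  simp [rx, Matrix.mul_apply, one_apply]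
lemma pm_un (σ : m ≃ m) : Un G (pm (ι := ι) σ : MB m ι) where
  l := by
    rw [pm_star, pm]
    rw [submatrix_mul_equiv]; simp
  r := by
    have := pm_conj σ (1 : MB m ι)
    rwa [mul_one, rx_one] at this
  comm g hg := by
    ext i j : 1
    simp [pm, dg, one_apply, mul_diagonal, diagonal_mul]
    

end perm

section cls
variable {n : ℕ} {ι : Type} [Fintype ι] [DecidableEq ι] {d : ι → ℝ} {J : Matrix ι ι ℝ} (hd : sg d) (hJ : Cx {diagonal d} J)

abbrev BB (n : ℕ) (d : ι → ℝ) (J : Matrix ι ι ℝ) {m : Type} [Fintype m] [DecidableEq m] (F : CI n → MB m ι) : Prop := Based (bdc n) {diagonal d} J F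

def lp {k : ℕ} {F : CI n → MB (Fin k) ι} (hF : BB n d J F) : GenLoop (Fin n) OInf OInf.one :=
  ⟨⟨fun q => tht hd hJ k ⟨F q, hF.os q⟩, (tht_cont hd hJ k).comp (hF.cont.subtype_mk _)⟩, fun q hq => by
    have : (⟨F q, hF.os q⟩ : {X // Os {diagonal d} X}) = ⟨dg (Fin k) J, hJ.os⟩ := Subtype.ext (hF.base q hq)
    simp only [ContinuousMap.coe_mk, this, tht_one]⟩

lemma lp_apply {k : ℕ} {F : CI n → MB (Fin k) ι} (hF : BB n d J F) (q : CI n) : lp hd hJ hF q = tht hd hJ k ⟨F q, hF.os q⟩ := rfl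

def cl {k : ℕ} {F : CI n → MB (Fin k) ι} (hF : BB n d J F) : HomotopyGroup (Fin n) OInf OInf.one := Quotient.mk _ (lp hd hJ hF)

lemma cl_relH {k : ℕ} {F F' : CI n → MB (Fin k) ι} (hF : BB n d J F) (hF' : BB n d J F') (h : RelH (bdc n) {diagonal d} F F') :
    cl hd hJ hF = cl hd hJ hF' := by
  obtain ⟨H, hc, h0, h1, ho, hb⟩ := h
  refine Quotient.sound ?_
  refine ⟨{ toFun := fun p => tht hd hJ k ⟨H p, ho p⟩
            continuous_toFun := (tht_cont hd hJ k).comp (hc.subtype_mk _)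
            map_zero_left := fun q => ?_
            map_one_left := fun q => ?_
            prop' := fun t q hq => ?_ }⟩
  · exact congrArg (tht hd hJ k) (Subtype.ext (h0 q))
  · exact congrArg (tht hd hJ k) (Subtype.ext (h1 q))
  · exact congrArg (tht hd hJ k) (Subtype.ext (hb t q hq))

lemma BB.stb {k K : ℕ} {F : CI n → MB (Fin k) ι} (hJ : Cx {diagonal d} J) (hF : BB n d J F) (l : ℕ) (h : k + l = K) :
    BB n d J (fun q => stb J l h (F q)) where
  cont := (rx_cont _).comp (dsumC hF.cont continuous_const)
  os q := stb_os hJ l h (hF.os q)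
  base q hq := by rw [hF.base q hq, BottP.stb, dsum_dg, rx_dg]

lemma BB.rx {m m' : Type} [Fintype m] [DecidableEq m] [Fintype m'] [DecidableEq m'] {F : CI n → MB m ι} (hF : BB n d J F) (e : m ≃ m') :
    BB n d J (fun q => rx e (F q)) where
  cont := (rx_cont _).comp hF.cont
  os q := (hF.os q).rx e
  base q hq := by rw [hF.base q hq, rx_dg]

lemma cl_stb {k K : ℕ} {F : CI n → MB (Fin k) ι} (hF : BB n d J F) (l : ℕ) (h : k + l = K) :
    cl hd hJ (hF.stb hJ l h) = cl hd hJ hF := by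
  refine congrArg (Quotient.mk _) ?_
  ext1 q
  exact tht_stb hd hJ l h ⟨F q, hF.os q⟩

lemma cl_congr {k : ℕ} {F F' : CI n → MB (Fin k) ι} (hF : BB n d J F) (hF' : BB n d J F') (h : ∀ q, F q = F' q) :
    cl hd hJ hF = cl hd hJ hF' := by
  obtain rfl : F = F' := funext h
  rfl

lemma cl_rx {k k' : ℕ} {F : CI n → MB (Fin k) ι} (hF : BB n d J F) (σ : Fin k ≃ Fin k') : cl hd hJ (hF.rx σ) = cl hd hJ hF := by
  obtain rfl : k = k' := by simpa using Fintype.card_congr σ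
  rw [← cl_stb hd hJ hF k rfl, ← cl_stb hd hJ (hF.rx σ) k rfl]
  symm
  have h1 := RelH.conj hJ hF continuous_const (P := fun _ => pm σ) (fun _ => pm_un σ)
  have h2 := h1.rx (finSumFinEquiv.trans (finCongr rfl))
  refine cl_relH hd hJ _ _ (h2.congr (fun q => rfl) (fun q => ?_))
  rw [pm_conj]; rfl

lemma cl_seq {k k' : ℕ} {F : CI n → MB (Fin k) ι} {F' : CI n → MB (Fin k') ι} (hF : BB n d J F) (hF' : BB n d J F')
    (h : SEq (bdc n) {diagonal d} J F F') : cl hd hJ hF = cl hd hJ hF' := by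
  obtain ⟨a, a', i1, i2, i3, i4, e, h⟩ := h
  obtain ⟨l, ⟨f⟩⟩ : ∃ l, Nonempty (a ≃ Fin l) := ⟨_, ⟨Fintype.equivFin a⟩⟩
  obtain ⟨l', ⟨f'⟩⟩ : ∃ l, Nonempty (a' ≃ Fin l) := ⟨_, ⟨Fintype.equivFin a'⟩⟩
  rw [← cl_stb hd hJ hF l rfl, ← cl_stb hd hJ hF' l' rfl]
  let g : Fin k ⊕ a ≃ Fin (k + l) := (Equiv.sumCongr (Equiv.refl _) f).trans (finSumFinEquiv.trans (finCongr rfl))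
  let g' : Fin k' ⊕ a' ≃ Fin (k' + l') := (Equiv.sumCongr (Equiv.refl _) f').trans (finSumFinEquiv.trans (finCongr rfl))
  rw [← cl_rx hd hJ (hF.stb hJ l rfl) (g.symm.trans (e.trans g'))]
  have key : ∀ {k l : ℕ} {a : Type} [Fintype a] [DecidableEq a] (f : a ≃ Fin l) (X : MB (Fin k) ι),
      rx ((Equiv.sumCongr (Equiv.refl _) f).trans (finSumFinEquiv.trans (finCongr rfl))) (dsum X (dg a J)) = stb J l rfl X := by
    intro k l a _ _ f X
    rw [stb, ← rx_rx]
    congr 1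
    ext i j : 1
    rcases i with i | i <;> rcases j with j | j <;> simp [rx, dsum, dg, diagonal_apply]
  refine cl_relH hd hJ _ _ ((h.rx g').congr (fun q => ?_) (fun q => ?_))
  · rw [← key f, rx_rx, rx_rx]
    congr 1
    ext x; simp [g]
  · exact key f' _

lemma seq_cl {k k' : ℕ} {F : CI n → MB (Fin k) ι} {F' : CI n → MB (Fin k') ι} (hF : BB n d J F) (hF' : BB n d J F')
    (h : cl hd hJ hF = cl hd hJ hF') : SEq (bdc n) {diagonal d} J F F' := by
  obtain ⟨H⟩ : GenLoop.Homotopic (lp hd hJ hF) (lp hd hJ hF') := Quotient.exact h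
  obtain ⟨k0, hk0⟩ := tht_lift hd hJ H.toContinuousMap
  let K := max k0 (max k k')
  obtain ⟨l, hl⟩ : ∃ l, k + l = K := ⟨K - k, by omega⟩
  obtain ⟨l', hl'⟩ : ∃ l, k' + l = K := ⟨K - k', by omega⟩
  obtain ⟨W, hWc, hWo, hW⟩ := hk0 K (by omega)
  have e0 : ∀ q, W (0, q) = stb J l hl (F q) := by
    intro q
    have : tht hd hJ K ⟨W (0, q), hWo _⟩ = tht hd hJ K ⟨_, (hF.stb hJ l hl).os q⟩ := by
      rw [hW]
      refine (H.apply_zero q).trans ?_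
      exact (tht_stb hd hJ l hl ⟨F q, hF.os q⟩).symm
    exact congrArg Subtype.val (tht_inj hd hJ K this)
  have e1 : ∀ q, W (1, q) = stb J l' hl' (F' q) := by
    intro q
    have : tht hd hJ K ⟨W (1, q), hWo _⟩ = tht hd hJ K ⟨_, (hF'.stb hJ l' hl').os q⟩ := by
      rw [hW]
      refine (H.apply_one q).trans ?_
      exact (tht_stb hd hJ l' hl' ⟨F' q, hF'.os q⟩).symm
    exact congrArg Subtype.val (tht_inj hd hJ K this)
  have hR : RelH (bdc n) {diagonal d} (fun q => stb J l hl (F q)) (fun q => stb J l' hl' (F' q)) := by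
    refine ⟨W, hWc, e0, e1, hWo, fun t q hq => ?_⟩
    refine Eq.trans ?_ (e0 q)
    have : tht hd hJ K ⟨W (t, q), hWo _⟩ = tht hd hJ K ⟨W (0, q), hWo _⟩ := by
      rw [hW, hW]
      exact (H.eq_fst t hq).trans (H.eq_fst 0 hq).symm
    exact congrArg Subtype.val (tht_inj hd hJ K this)
  have s1 : SEq (bdc n) {diagonal d} J F (fun q => stb J l hl (F q)) :=
    (SEq.stab hJ hF.toFam (Fin l)).trans hJ (SEq.of_eq_rx hJ ⟨dsumC hF.cont continuous_const, fun q => (hF.os q).dsum hJ.os⟩ _ fun q => rfl)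
  have s2 : SEq (bdc n) {diagonal d} J F' (fun q => stb J l' hl' (F' q)) :=
    (SEq.stab hJ hF'.toFam (Fin l')).trans hJ (SEq.of_eq_rx hJ ⟨dsumC hF'.cont continuous_const, fun q => (hF'.os q).dsum hJ.os⟩ _ fun q => rfl)
  exact s1.trans hJ ((SEq.of_relH hJ hR).trans hJ s2.symm)

lemma cl_surj_aux (p : GenLoop (Fin n) OInf OInf.one) : ∃ k0, ∀ k ≥ k0, ∃ (F : CI n → MB (Fin k) ι) (hF : BB n d J F), lp hd hJ hF = p := by
  obtain ⟨k0, h⟩ := tht_lift hd hJ p.1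
  refine ⟨k0, fun k hk => ?_⟩
  obtain ⟨F, hc, ho, hF⟩ := h k hk
  have hb : BB n d J F := ⟨⟨hc, ho⟩, fun q hq => by
    have : tht hd hJ k ⟨F q, ho q⟩ = tht hd hJ k ⟨dg (Fin k) J, hJ.os⟩ := by
      rw [hF, tht_one]; exact p.2 q hq
    exact congrArg Subtype.val (tht_inj hd hJ k this)⟩
  exact ⟨F, hb, GenLoop.ext _ _ hF⟩

lemma cl_surj2 (p q : HomotopyGroup (Fin n) OInf OInf.one) : ∃ (k : ℕ) (F F' : CI n → MB (Fin k) ι) (hF : BB n d J F) (hF' : BB n d J F'),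
    cl hd hJ hF = p ∧ cl hd hJ hF' = q := by
  induction p using Quotient.inductionOn with | _ p => ?_
  induction q using Quotient.inductionOn with | _ q => ?_
  obtain ⟨k0, h⟩ := cl_surj_aux hd hJ p
  obtain ⟨k1, h'⟩ := cl_surj_aux hd hJ q
  obtain ⟨F, hF, e⟩ := h (max k0 k1) (by omega)
  obtain ⟨F', hF', e'⟩ := h' (max k0 k1) (by omega)
  exact ⟨_, F, F', hF, hF', by rw [cl, e], by rw [cl, e']⟩

lemma gl_based (hJ : Cx {diagonal d} J) {k : ℕ} (i : Fin n) {F F' : CI n → MB (Fin k) ι} (hF : BB n d J F) (hF' : BB n d J F') : BB n d J (gl i F F') := by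
  let X := {X : MB (Fin k) ι // Os {diagonal d} X}
  let b : X := ⟨dg (Fin k) J, hJ.os⟩
  let f : GenLoop (Fin n) X b := ⟨⟨fun q => ⟨F q, hF.os q⟩, hF.cont.subtype_mk _⟩, fun q hq => Subtype.ext (hF.base q hq)⟩
  let f' : GenLoop (Fin n) X b := ⟨⟨fun q => ⟨F' q, hF'.os q⟩, hF'.cont.subtype_mk _⟩, fun q hq => Subtype.ext (hF'.base q hq)⟩
  have e : ∀ y, gl i F F' y = (GenLoop.transAt i f f' y).1 := by
    intro y
    by_cases hy : (y i : ℝ) ≤ 1 / 2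
    · rw [gl_pos hy, GenLoop.transAt, GenLoop.coe_copy, if_pos hy]; rfl
    · rw [gl_neg hy, GenLoop.transAt, GenLoop.coe_copy, if_neg hy]; rfl
  have e' := funext e
  rw [e']
  refine ⟨⟨continuous_subtype_val.comp (GenLoop.transAt i f f').1.continuous, fun q => (GenLoop.transAt i f f' q).2⟩, fun q hq => ?_⟩
  exact congrArg Subtype.val ((GenLoop.transAt i f f').2 q hq)

lemma cl_gl {k : ℕ} (i : Fin n) {F F' : CI n → MB (Fin k) ι} (hF : BB n d J F) (hF' : BB n d J F') (hg : BB n d J (gl i F F')) :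
    haveI : Nonempty (Fin n) := ⟨i⟩
    cl hd hJ hg = cl hd hJ hF' * cl hd hJ hF := by
  haveI : Nonempty (Fin n) := ⟨i⟩
  have h := HomotopyGroup.mul_spec (i := i) (p := lp hd hJ hF') (q := lp hd hJ hF)
  refine Eq.trans ?_ h.symm
  refine congrArg (Quotient.mk _) ?_
  ext1 y
  rw [lp_apply]
  by_cases hy : (y i : ℝ) ≤ 1 / 2
  · rw [GenLoop.transAt, GenLoop.coe_copy, if_pos hy, lp_apply]
    congr 2
    exact gl_pos hy
  · rw [GenLoop.transAt, GenLoop.coe_copy, if_neg hy, lp_apply]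
    congr 2
    exact gl_neg hy
end cls
end BottP

set_option linter.all false
set_option autoImplicit false
set_option linter.unusedSectionVars false
set_option linter.unusedSimpArgs false
namespace BottP
open Matrix Topology

section asm
variable {n n' : ℕ} {ι ι' : Type} [Fintype ι] [DecidableEq ι] [Fintype ι'] [DecidableEq ι'] {d : ι → ℝ} {J : Matrix ι ι ℝ}
  {d' : ι' → ℝ} {J' : Matrix ι' ι' ℝ}

lemma exists_theta (hd : sg d) (hJ : Cx {diagonal d} J) (hd' : sg d') (hJ' : Cx {diagonal d'} J')
    (x : Xf n n' {diagonal d} J {diagonal d'} J') :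
    ∃ θ : HomotopyGroup (Fin n) OInf OInf.one → HomotopyGroup (Fin n') OInf OInf.one, Function.Bijective θ ∧
      ∀ (k : ℕ) (F : CI n → MB (Fin k) ι) (hF : BB n d J F), θ (cl hd hJ hF) = cl hd' hJ' (x.based hF) := by
  have hs : ∀ p : HomotopyGroup (Fin n) OInf OInf.one, ∃ (k : ℕ) (F : CI n → MB (Fin k) ι) (hF : BB n d J F), cl hd hJ hF = p := by
    intro p
    obtain ⟨k, F, F', hF, hF', e, e'⟩ := cl_surj2 hd hJ p p
    exact ⟨k, F, hF, e⟩
  choose k F hF e using hs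
  have key : ∀ (l : ℕ) (f : CI n → MB (Fin l) ι) (hf : BB n d J f), cl hd' hJ' (x.based (hF (cl hd hJ hf))) = cl hd' hJ' (x.based hf) := by
    intro l f hf
    apply cl_seq
    exact (x.seq (hF _) hf).1 (seq_cl hd hJ _ _ (e _))
  refine ⟨fun p => cl hd' hJ' (x.based (hF p)), ⟨?_, ?_⟩, key⟩
  · intro p q h
    have h1 := seq_cl hd' hJ' _ _ h
    have h2 := (x.seq (hF p) (hF q)).2 h1
    rw [← e p, ← e q]
    exact cl_seq hd hJ _ _ h2
  · intro p
    obtain ⟨l, f, -, hf, -, e1, -⟩ := cl_surj2 hd' hJ' p p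
    obtain ⟨a, i1, i2, g, hg, hs⟩ := x.surj hf
    obtain ⟨l', ⟨σ⟩⟩ : ∃ l, Nonempty (a ≃ Fin l) := ⟨_, ⟨Fintype.equivFin a⟩⟩
    have hg' : BB n d J (fun q => rx σ (g q)) := BB.rx hg σ
    have s1 : SEq (bdc n) {diagonal d} J g (fun q => rx σ (g q)) := SEq.of_eq_rx hJ hg.toFam σ fun q => rfl
    have s2 := (x.seq hg hg').1 s1
    refine ⟨cl hd hJ hg', ?_⟩
    simp only
    rw [key, ← e1]
    exact (cl_seq hd' hJ' _ _ (hs.trans hJ' s2)).symm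

lemma theta_mul (hn : 0 < n) (hn' : 0 < n') (hd : sg d) (hJ : Cx {diagonal d} J) (hd' : sg d') (hJ' : Cx {diagonal d'} J')
    (x : Xf n n' {diagonal d} J {diagonal d'} J') :
    haveI : Nonempty (Fin n) := ⟨⟨0, hn⟩⟩
    haveI : Nonempty (Fin n') := ⟨⟨0, hn'⟩⟩
    Nonempty (HomotopyGroup (Fin n') OInf OInf.one ≃* HomotopyGroup (Fin n) OInf OInf.one) := by
  haveI : Nonempty (Fin n) := ⟨⟨0, hn⟩⟩
  haveI : Nonempty (Fin n') := ⟨⟨0, hn'⟩⟩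
  obtain ⟨θ, hb, hθ⟩ := exists_theta hd hJ hd' hJ' x
  refine ⟨(MulEquiv.ofBijective (MulHom.mk θ ?_) hb).symm⟩
  intro p q
  obtain ⟨k, F, F', hF, hF', rfl, rfl⟩ := cl_surj2 hd hJ p q
  have hg := gl_based hJ ⟨0, hn⟩ hF' hF
  rw [← cl_gl hd hJ ⟨0, hn⟩ hF' hF hg, hθ, hθ, hθ]
  have hg' := gl_based hJ' ⟨0, hn'⟩ (x.based hF') (x.based hF)
  rw [← cl_gl hd' hJ' ⟨0, hn'⟩ (x.based hF') (x.based hF) hg']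
  apply cl_congr
  intro q
  rw [x.glue hn hn']
end asm
end BottP

/-- **Bott periodicity (real form).** The homotopy groups of `O(∞)` are `8`-periodic:
`π_{k+8} O(∞) ≅ π_k O(∞)` for all `k ≥ 0` (a group isomorphism for `k ≥ 1`, and a bijection of
path-component sets for `k = 0`). -/
theorem bott_periodicity_real :
    (∀ k : ℕ, Nonempty
      (HomotopyGroup (Fin (k + 1 + 8)) OInf OInf.one ≃* HomotopyGroup (Fin (k + 1)) OInf OInf.one))
    ∧ Nonempty (HomotopyGroup (Fin 8) OInf OInf.one ≃ HomotopyGroup (Fin 0) OInf OInf.one) := by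
  obtain ⟨ι, ι', i1, i2, i3, i4, d, d', J, J', hd, hd', hJ, hJ', hx⟩ := BottP.stable_periodicity
  constructor
  · intro k
    obtain ⟨x⟩ := hx (k + 1)
    exact BottP.theta_mul (by omega) (by omega) hd hJ hd' hJ' x
  · obtain ⟨x⟩ := hx 0
    obtain ⟨θ, hb, -⟩ := BottP.exists_theta hd hJ hd' hJ' x
    exact ⟨(Equiv.ofBijective θ hb).symm⟩
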